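/- There exist absolute constants C₁, C₂, C₃ such that for all real x > 1 and all T ≥ 2: | Σ_{T≤γ≤2T} x^ρ + (T/2π)Λ(x) | ≤ C₁ x log(2xT) log log(3x) + C₂ (log x) min(T, x/⟨x⟩) + C₃ (log(T/2π)) min(T, 1/log x), where the sum runs over the nontrivial zeros ρ = β + iγ of the Riemann zeta-function with γ ∈ [T, 2T], counted with multiplicity; ⟨x⟩ denotes the distance from x to the nearest prime power other than x itself; and Λ(x) = log p if x = p^m is a positive integral power of a prime p, and Λ(x) = 0 otherwise. -/

import Mathlib

noncomputable section

/-- The multiplicity of a zero of `ζ` at `ρ`. -/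
def zetaZeroOrder (ρ : ℂ) : ℕ := sInf {n : ℕ | iteratedDeriv n riemannZeta ρ ≠ 0}

/-- Sum of `f` over the nontrivial zeros `ρ` of `ζ` with `T ≤ Im ρ ≤ 2T`, counted with
multiplicity. -/
def zetaZeroSum (T : ℝ) (f : ℂ → ℂ) : ℂ :=
  ∑ᶠ ρ ∈ {ρ : ℂ | riemannZeta ρ = 0 ∧ 0 < ρ.re ∧ ρ.re < 1 ∧ T ≤ ρ.im ∧ ρ.im ≤ 2*T},
    (zetaZeroOrder ρ : ℂ) * f ρ

/-- The von Mangoldt function extended to positive reals: `Λ(x) = log p` if `x = p^m` is an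
exact prime power, `0` otherwise. -/
def LambdaR (x : ℝ) : ℝ :=
  if (⌊x⌋₊ : ℝ) = x then ArithmeticFunction.vonMangoldt ⌊x⌋₊ else 0

/-- `⟨x⟩`: the distance from `x` to the nearest prime power other than `x` itself. -/
def primePowerDist (x : ℝ) : ℝ :=
  sInf {d : ℝ | ∃ q : ℕ, IsPrimePow q ∧ (q : ℝ) ≠ x ∧ d = |x - (q:ℝ)|}

open Finset in
theorem sum_moebius_between {k m : ℕ} (hm : Squarefree m) (hk : k ∣ m) :
    ∑ d ∈ m.divisors with k ∣ d, (ArithmeticFunction.moebius d : ℝ) =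
      if m = k then (ArithmeticFunction.moebius k : ℝ) else 0 := by
  obtain ⟨e, rfl⟩ := hk
  have hke0 : k * e ≠ 0 := hm.ne_zero
  have hk0 : k ≠ 0 := left_ne_zero_of_mul hke0
  have he0 : e ≠ 0 := right_ne_zero_of_mul hke0
  have hcop : Nat.Coprime k e := Nat.coprime_of_squarefree_mul hm
  have h1 : ∑ d ∈ (k * e).divisors with k ∣ d, (ArithmeticFunction.moebius d : ℝ) =
      ∑ f ∈ e.divisors, (ArithmeticFunction.moebius (k * f) : ℝ) := by
    symm
    apply Finset.sum_bij (fun f _ => k * f)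
    · intro f hf
      simp only [mem_filter, Nat.mem_divisors] at hf ⊢
      exact ⟨⟨mul_dvd_mul_left k hf.1, hke0⟩, dvd_mul_right _ _⟩
    · intro a _ b _ h
      exact Nat.eq_of_mul_eq_mul_left (Nat.pos_of_ne_zero hk0) h
    · intro d hd
      simp only [mem_filter, Nat.mem_divisors] at hd
      obtain ⟨f, rfl⟩ := hd.2
      exact ⟨f, by
        simp only [Nat.mem_divisors]
        exact ⟨Nat.dvd_of_mul_dvd_mul_left (Nat.pos_of_ne_zero hk0) hd.1.1, he0⟩, rfl⟩
    · intros; rfl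
  rw [h1]
  have h2 : ∀ f ∈ e.divisors, (ArithmeticFunction.moebius (k * f) : ℝ) =
      (ArithmeticFunction.moebius k : ℝ) * (ArithmeticFunction.moebius f : ℝ) := by
    intro f hf
    have : Nat.Coprime k f := Nat.Coprime.coprime_dvd_right (Nat.dvd_of_mem_divisors hf) hcop
    rw [ArithmeticFunction.isMultiplicative_moebius.map_mul_of_coprime this]
    push_cast; ring
  rw [Finset.sum_congr rfl h2, ← Finset.mul_sum]
  have h3 : ∑ f ∈ e.divisors, (ArithmeticFunction.moebius f : ℝ) = if e = 1 then 1 else 0 := by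
    have h := congrArg (fun f : ArithmeticFunction ℤ => f e)
      ArithmeticFunction.moebius_mul_coe_zeta
    simp only [ArithmeticFunction.one_apply, ArithmeticFunction.coe_mul_zeta_apply] at h
    exact_mod_cast h
  rw [h3]
  by_cases he : e = 1
  · simp [he]
  · have : k * e ≠ k := by
      intro h
      exact he (Nat.eq_of_mul_eq_mul_left (Nat.pos_of_ne_zero hk0) (by rw [h, mul_one]))
    simp [he, this]

/-- Number of multiples of `m` in `(a, a + N]`. -/
theorem abs_card_multiples_sub_le (a N m : ℕ) (hm : 0 < m) :
    |(((Finset.Ioc a (a + N)).filter (m ∣ ·)).card : ℝ) - N / m| ≤ 1 := by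
  have h1 : ((Finset.Ioc a (a + N)).filter (m ∣ ·)).card + a / m = (a + N) / m := by
    rw [← Nat.Ioc_filter_dvd_card_eq_div a m, ← Nat.Ioc_filter_dvd_card_eq_div (a + N) m,
      ← Finset.card_union_of_disjoint]
    · rw [← Finset.filter_union, Finset.union_comm, Finset.Ioc_union_Ioc_eq_Ioc] <;> omega
    · rw [Finset.disjoint_left]
      intro x hx hx'
      simp only [Finset.mem_filter, Finset.mem_Ioc] at hx hx'
      omega
  have hmR : (0:ℝ) < m := by exact_mod_cast hm
  have e1 := Nat.div_add_mod a m
  have e2 := Nat.div_add_mod (a + N) m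
  have l1 := Nat.mod_lt a hm
  have l2 := Nat.mod_lt (a + N) hm
  rw [← h1] at e2
  set c := ((Finset.Ioc a (a + N)).filter (m ∣ ·)).card
  set q := a / m
  set r := a % m
  set r' := (a + N) % m
  have e1' : (m:ℝ) * q + r = a := by exact_mod_cast e1
  have e2' : (m:ℝ) * (c + q) + r' = a + N := by exact_mod_cast e2
  have l1' : (r:ℝ) < m := by exact_mod_cast l1
  have l2' : (r':ℝ) < m := by exact_mod_cast l2
  have hr : (0:ℝ) ≤ r := by positivity
  have hr' : (0:ℝ) ≤ r' := by positivity
  have : (c:ℝ) - N / m = (r - r') / m := by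
    field_simp
    linarith
  rw [this, abs_div, abs_of_pos hmR, div_le_one hmR, abs_le]
  constructor <;> linarith

/-- Squarefree numbers in `[1, R]`. -/
def squarefreeUpTo (R : ℕ) : Finset ℕ := (Finset.Icc 1 R).filter Squarefree

theorem mem_squarefreeUpTo {R d : ℕ} : d ∈ squarefreeUpTo R ↔ (1 ≤ d ∧ d ≤ R) ∧ Squarefree d := by
  simp [squarefreeUpTo]

/-- The denominator of the Selberg sieve. -/
def selbergDenom (R : ℕ) : ℝ := ∑ k ∈ squarefreeUpTo R, (1 : ℝ) / Nat.totient k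

/-- The Selberg weights. -/
def selbergWeight (R d : ℕ) : ℝ :=
  ArithmeticFunction.moebius d * d / selbergDenom R *
    ∑ k ∈ squarefreeUpTo R with d ∣ k, (1 : ℝ) / Nat.totient k

theorem sum_inv_sq_le (R : ℕ) : ∑ b ∈ Finset.Icc 1 R, (1:ℝ) / (b:ℝ)^2 ≤ 2 := by
  have key : ∀ n : ℕ, ∑ b ∈ Finset.Icc 1 (n + 1), (1:ℝ) / (b:ℝ)^2 ≤ 2 - 1 / (n + 1) := by
    intro n
    induction n with
    | zero => norm_num
    | succ n ih =>
      rw [Finset.sum_Icc_succ_top (by omega)]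
      have : (1:ℝ) / ((n + 1 + 1 : ℕ):ℝ)^2 ≤ 1 / (n + 1) - 1 / (n + 1 + 1) := by
        push_cast
        rw [div_sub_div _ _ (by positivity) (by positivity), div_le_div_iff₀ (by positivity)
          (by positivity)]
        ring_nf
        nlinarith [(Nat.cast_nonneg n : (0:ℝ) ≤ n)]
      push_cast at this ⊢
      linarith
  rcases R with _ | n
  · simp
  · have : (0:ℝ) ≤ 1 / (n + 1) := by positivity
    linarith [key n]

theorem log_le_selbergDenom {R : ℕ} (hR : 1 ≤ R) : Real.log R ≤ 2 * selbergDenom R := by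
  have h1 : Real.log R ≤ ∑ n ∈ Finset.Icc 1 R, (1:ℝ) / n := by
    have := log_le_harmonic_floor (R:ℝ) (by positivity)
    rw [Nat.floor_natCast] at this
    refine this.trans (le_of_eq ?_)
    rw [harmonic_eq_sum_Icc]
    push_cast
    simp
  have h2 : ∑ n ∈ Finset.Icc 1 R, (1:ℝ) / n ≤
      ∑ p ∈ squarefreeUpTo R ×ˢ Finset.Icc 1 R, (1:ℝ) / ((p.2:ℝ)^2 * p.1) := by
    have key : ∀ n ∈ Finset.Icc 1 R, ∃ p ∈ squarefreeUpTo R ×ˢ Finset.Icc 1 R,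
        p.2 ^ 2 * p.1 = n := by
      intro n hn
      rw [Finset.mem_Icc] at hn
      obtain ⟨a, b, ha, hb, hab, hsq⟩ := Nat.sq_mul_squarefree_of_pos (n := n) (by omega)
      refine ⟨(a, b), ?_, hab⟩
      rw [Finset.mem_product, mem_squarefreeUpTo, Finset.mem_Icc]
      have h1 : a ≤ n := by nlinarith [pow_pos hb 2]
      have h2 : b ≤ n := by nlinarith
      exact ⟨⟨⟨ha, by omega⟩, hsq⟩, hb, by simp; omega⟩
    choose! f hf hf' using key
    calc ∑ n ∈ Finset.Icc 1 R, (1:ℝ) / n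
        = ∑ n ∈ Finset.Icc 1 R, (1:ℝ) / (((f n).2:ℝ)^2 * (f n).1) := by
          apply Finset.sum_congr rfl
          intro n hn
          rw [← hf' n hn]
          push_cast
          rw [hf' n hn]
      _ = ∑ p ∈ (Finset.Icc 1 R).image f, (1:ℝ) / ((p.2:ℝ)^2 * p.1) := by
          rw [Finset.sum_image]
          intro a ha b hb hab
          rw [← hf' a ha, ← hf' b hb, hab]
      _ ≤ _ := by
          apply Finset.sum_le_sum_of_subset_of_nonneg
          · intro p hp
            obtain ⟨n, hn, rfl⟩ := Finset.mem_image.mp hp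
            exact hf n hn
          · intros; positivity
  have h3 : ∑ p ∈ squarefreeUpTo R ×ˢ Finset.Icc 1 R, (1:ℝ) / ((p.2:ℝ)^2 * p.1) =
      (∑ k ∈ squarefreeUpTo R, (1:ℝ) / k) * ∑ b ∈ Finset.Icc 1 R, (1:ℝ) / (b:ℝ)^2 := by
    rw [Finset.sum_mul_sum, ← Finset.sum_product']
    apply Finset.sum_congr rfl
    intro p _
    rw [one_div_mul_one_div, mul_comm]
  have h4 : ∑ k ∈ squarefreeUpTo R, (1:ℝ) / k ≤ selbergDenom R := by
    apply Finset.sum_le_sum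
    intro k hk
    rw [mem_squarefreeUpTo] at hk
    have : 0 < Nat.totient k := Nat.totient_pos.mpr (by omega)
    apply one_div_le_one_div_of_le (by exact_mod_cast this)
    exact_mod_cast Nat.totient_le k
  have h5 : (0:ℝ) ≤ ∑ k ∈ squarefreeUpTo R, (1:ℝ) / k := by positivity
  have h6 := sum_inv_sq_le R
  calc _ ≤ _ := h1
    _ ≤ _ := h2
    _ = _ := h3
    _ ≤ (∑ k ∈ squarefreeUpTo R, (1:ℝ) / k) * 2 := by gcongr
    _ ≤ _ := by linarith

theorem selbergDenom_pos {R : ℕ} (hR : 1 ≤ R) : 0 < selbergDenom R := by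
  apply Finset.sum_pos
  · intro k hk
    rw [mem_squarefreeUpTo] at hk
    have : 0 < Nat.totient k := Nat.totient_pos.mpr (by omega)
    positivity
  · exact ⟨1, by simp [mem_squarefreeUpTo, hR]⟩

theorem selbergWeight_one {R : ℕ} (hR : 1 ≤ R) : selbergWeight R 1 = 1 := by
  have := selbergDenom_pos hR
  simp only [selbergWeight, ArithmeticFunction.moebius_apply_one, one_dvd, Finset.filter_true]
  rw [← selbergDenom]
  field_simp
  simp

theorem abs_selbergWeight_le {R : ℕ} (hR : 1 ≤ R) (d : ℕ) : |selbergWeight R d| ≤ d := by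
  have hS := selbergDenom_pos hR
  have h1 : ∑ k ∈ squarefreeUpTo R with d ∣ k, (1 : ℝ) / Nat.totient k ≤ selbergDenom R := by
    apply Finset.sum_le_sum_of_subset_of_nonneg (Finset.filter_subset _ _)
    intros; positivity
  have h0 : 0 ≤ ∑ k ∈ squarefreeUpTo R with d ∣ k, (1 : ℝ) / Nat.totient k := by positivity
  have hmu : |(ArithmeticFunction.moebius d : ℝ)| ≤ 1 := by
    exact_mod_cast ArithmeticFunction.abs_moebius_le_one
  rw [selbergWeight, abs_mul, abs_div, abs_mul, abs_of_nonneg h0, abs_of_pos hS, Nat.abs_cast]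
  calc |(ArithmeticFunction.moebius d : ℝ)| * d / selbergDenom R * _
      ≤ 1 * d / selbergDenom R * selbergDenom R := by gcongr
    _ = d := by field_simp

theorem sum_selbergWeight_div {R k : ℕ} (hk : k ∈ squarefreeUpTo R) :
    ∑ d ∈ squarefreeUpTo R with k ∣ d, selbergWeight R d / d =
      ArithmeticFunction.moebius k / (Nat.totient k * selbergDenom R) := by
  have hk' := mem_squarefreeUpTo.mp hk
  calc ∑ d ∈ squarefreeUpTo R with k ∣ d, selbergWeight R d / d
      = ∑ d ∈ squarefreeUpTo R with k ∣ d, ∑ m ∈ squarefreeUpTo R with d ∣ m,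
          (ArithmeticFunction.moebius d : ℝ) * (1 / (selbergDenom R * Nat.totient m)) := by
        apply Finset.sum_congr rfl
        intro d hd
        rw [Finset.mem_filter, mem_squarefreeUpTo] at hd
        have hd0 : (d:ℝ) ≠ 0 := by
          have : d ≠ 0 := by omega
          exact_mod_cast this
        rw [selbergWeight, ← Finset.mul_sum]
        have : ∑ m ∈ squarefreeUpTo R with d ∣ m, 1 / (selbergDenom R * Nat.totient m) =
            1 / selbergDenom R * ∑ m ∈ squarefreeUpTo R with d ∣ m, (1:ℝ) / Nat.totient m := by
          rw [Finset.mul_sum]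
          apply Finset.sum_congr rfl
          intros
          rw [one_div_mul_one_div]
        rw [this]
        field_simp
    _ = ∑ m ∈ squarefreeUpTo R, ∑ d ∈ m.divisors with k ∣ d,
          (ArithmeticFunction.moebius d : ℝ) * (1 / (selbergDenom R * Nat.totient m)) := by
        apply Finset.sum_comm'
        intro d m
        simp only [Finset.mem_filter, mem_squarefreeUpTo, Nat.mem_divisors]
        constructor
        · rintro ⟨⟨⟨h1, h2⟩, h3⟩, ⟨h4, h5⟩, h6⟩
          exact ⟨⟨⟨h6, by omega⟩, h3⟩, h4, h5⟩
        · rintro ⟨⟨⟨h6, h7⟩, h3⟩, ⟨h4, h4'⟩, h5⟩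
          have := Nat.le_of_dvd (by omega) h6
          have h0 := Nat.pos_of_dvd_of_pos h6 (by omega)
          exact ⟨⟨⟨⟨h0, by omega⟩, h5.squarefree_of_dvd h6⟩, h3⟩, ⟨⟨h4, h4'⟩, h5⟩, h6⟩
    _ = ∑ m ∈ squarefreeUpTo R, (if m = k then (ArithmeticFunction.moebius k : ℝ) else 0) *
          (1 / (selbergDenom R * Nat.totient m)) := by
        apply Finset.sum_congr rfl
        intro m hm
        rw [mem_squarefreeUpTo] at hm
        rw [← Finset.sum_mul]
        congr 1
        by_cases hkm : k ∣ m
        · exact sum_moebius_between hm.2 hkm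
        · rw [Finset.sum_eq_zero, if_neg]
          · rintro rfl; exact hkm dvd_rfl
          · intro d hd
            rw [Finset.mem_filter, Nat.mem_divisors] at hd
            exact absurd (hd.2.trans hd.1.1) hkm
    _ = _ := by
        simp only [ite_mul, zero_mul]
        rw [Finset.sum_ite_eq' _ k, if_pos hk]
        rw [mul_one_div, mul_comm]

open Finset in
theorem gcd_div_mul_eq {d e : ℕ} (hd : d ≠ 0) (he : e ≠ 0) :
    (1:ℝ) / (Nat.lcm d e : ℕ) = (Nat.gcd d e : ℕ) / (d * e : ℝ) := by
  have h := Nat.gcd_mul_lcm d e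
  have h' : ((Nat.gcd d e : ℕ):ℝ) * (Nat.lcm d e : ℕ) = d * e := by exact_mod_cast h
  have h0 : ((Nat.lcm d e : ℕ):ℝ) ≠ 0 := by exact_mod_cast Nat.lcm_ne_zero hd he
  have hd' : (d:ℝ) ≠ 0 := by exact_mod_cast hd
  have he' : (e:ℝ) ≠ 0 := by exact_mod_cast he
  rw [div_eq_div_iff h0 (by positivity)]
  linarith

/-- The quadratic form of the Selberg sieve takes the value `1 / S` at the Selberg weights. -/
theorem selberg_main_term {R : ℕ} (hR : 1 ≤ R) :
    ∑ d ∈ squarefreeUpTo R, ∑ e ∈ squarefreeUpTo R,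
      selbergWeight R d * selbergWeight R e * (1 / (Nat.lcm d e : ℕ)) = 1 / selbergDenom R := by
  have hS := selbergDenom_pos hR
  have h1 : ∀ d ∈ squarefreeUpTo R, ∀ e ∈ squarefreeUpTo R,
      selbergWeight R d * selbergWeight R e * (1 / (Nat.lcm d e : ℕ)) =
      ∑ k ∈ squarefreeUpTo R, (Nat.totient k : ℝ) *
        ((if k ∣ d then selbergWeight R d / d else 0) *
          (if k ∣ e then selbergWeight R e / e else 0)) := by
    intro d hd e he
    rw [mem_squarefreeUpTo] at hd he
    rw [gcd_div_mul_eq (by omega) (by omega), ← Nat.sum_totient (Nat.gcd d e)]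
    have : (Nat.gcd d e).divisors = (squarefreeUpTo R).filter (fun k => k ∣ d ∧ k ∣ e) := by
      ext k
      simp only [Nat.mem_divisors, Finset.mem_filter, mem_squarefreeUpTo, Nat.dvd_gcd_iff]
      constructor
      · rintro ⟨⟨h1, h2⟩, h3⟩
        have := Nat.le_of_dvd (by omega) h1
        exact ⟨⟨⟨Nat.pos_of_dvd_of_pos h1 (by omega), by omega⟩, hd.2.squarefree_of_dvd h1⟩, h1, h2⟩
      · rintro ⟨_, h1, h2⟩
        exact ⟨⟨h1, h2⟩, Nat.gcd_ne_zero_left (by omega)⟩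
    rw [this, Finset.sum_filter]
    push_cast
    rw [Finset.sum_div, Finset.mul_sum]
    apply Finset.sum_congr rfl
    intro k _
    by_cases h1 : k ∣ d <;> by_cases h2 : k ∣ e <;> simp [h1, h2]
    ring
  rw [Finset.sum_congr rfl fun d hd => Finset.sum_congr rfl (h1 d hd)]
  have h2 : ∀ k ∈ squarefreeUpTo R, ∑ d ∈ squarefreeUpTo R, ∑ e ∈ squarefreeUpTo R,
      (Nat.totient k : ℝ) * ((if k ∣ d then selbergWeight R d / d else 0) *
          (if k ∣ e then selbergWeight R e / e else 0)) =
      1 / selbergDenom R ^ 2 * (1 / Nat.totient k) := by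
    intro k hk
    simp_rw [← Finset.mul_sum]
    rw [← Finset.sum_mul, ← Finset.sum_filter, sum_selbergWeight_div hk]
    rw [mem_squarefreeUpTo] at hk
    have hφ : (0:ℝ) < Nat.totient k := by exact_mod_cast Nat.totient_pos.mpr (by omega)
    have hmu : (ArithmeticFunction.moebius k : ℝ) ^ 2 = 1 := by
      exact_mod_cast ArithmeticFunction.moebius_sq_eq_one_of_squarefree hk.2
    field_simp
    exact hmu
  have h3 : ∑ d ∈ squarefreeUpTo R, ∑ e ∈ squarefreeUpTo R, ∑ k ∈ squarefreeUpTo R,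
      (Nat.totient k : ℝ) * ((if k ∣ d then selbergWeight R d / d else 0) *
          (if k ∣ e then selbergWeight R e / e else 0)) =
      ∑ k ∈ squarefreeUpTo R, ∑ d ∈ squarefreeUpTo R, ∑ e ∈ squarefreeUpTo R,
      (Nat.totient k : ℝ) * ((if k ∣ d then selbergWeight R d / d else 0) *
          (if k ∣ e then selbergWeight R e / e else 0)) := by
    rw [Finset.sum_comm (s := squarefreeUpTo R) (t := squarefreeUpTo R)
      (f := fun k d => ∑ e ∈ squarefreeUpTo R, (Nat.totient k : ℝ) *
        ((if k ∣ d then selbergWeight R d / d else 0) *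
          (if k ∣ e then selbergWeight R e / e else 0)))]
    exact Finset.sum_congr rfl fun d _ => Finset.sum_comm
  rw [h3, Finset.sum_congr rfl h2, ← Finset.mul_sum, ← selbergDenom]
  field_simp

/-- Upper bound sieve for a set of integers in an interval without small divisors. -/
theorem card_le_of_no_small_divisor {R : ℕ} (hR : 1 ≤ R) (a N : ℕ) (A : Finset ℕ)
    (hA : A ⊆ Finset.Ioc a (a + N)) (hA' : ∀ n ∈ A, ∀ d, d ∣ n → d ≤ R → d = 1) :
    (A.card : ℝ) ≤ N / selbergDenom R + (R:ℝ) ^ 4 := by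
  set w := selbergWeight R with hw
  set D := squarefreeUpTo R with hD
  have h1 : (A.card : ℝ) ≤ ∑ n ∈ Finset.Ioc a (a + N), (∑ d ∈ D with d ∣ n, w d) ^ 2 := by
    calc (A.card : ℝ) = ∑ n ∈ A, (∑ d ∈ D with d ∣ n, w d) ^ 2 := by
          rw [Finset.card_eq_sum_ones, Nat.cast_sum]
          apply Finset.sum_congr rfl
          intro n hn
          have : D.filter (· ∣ n) = {1} := by
            ext d
            simp only [hD, Finset.mem_filter, mem_squarefreeUpTo, Finset.mem_singleton]
            constructor
            · rintro ⟨⟨⟨_, h⟩, _⟩, h'⟩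
              exact hA' n hn d h' h
            · rintro rfl
              exact ⟨⟨⟨le_rfl, hR⟩, squarefree_one⟩, one_dvd _⟩
          rw [this, Finset.sum_singleton, hw, selbergWeight_one hR]
          norm_num
      _ ≤ _ := Finset.sum_le_sum_of_subset_of_nonneg hA (fun _ _ _ => sq_nonneg _)
  have h2 : ∑ n ∈ Finset.Ioc a (a + N), (∑ d ∈ D with d ∣ n, w d) ^ 2 =
      ∑ d ∈ D, ∑ e ∈ D, w d * w e *
        (((Finset.Ioc a (a + N)).filter (Nat.lcm d e ∣ ·)).card : ℝ) := by
    have : ∀ n, (∑ d ∈ D with d ∣ n, w d) ^ 2 =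
        ∑ d ∈ D, ∑ e ∈ D, w d * w e * (if Nat.lcm d e ∣ n then 1 else 0) := by
      intro n
      rw [sq, Finset.sum_filter, Finset.sum_mul_sum]
      apply Finset.sum_congr rfl
      intro d _
      apply Finset.sum_congr rfl
      intro e _
      by_cases h1 : d ∣ n <;> by_cases h2 : e ∣ n <;> simp [h1, h2, Nat.lcm_dvd_iff]
    simp_rw [this]
    rw [Finset.sum_comm]
    apply Finset.sum_congr rfl
    intro d _
    rw [Finset.sum_comm]
    apply Finset.sum_congr rfl
    intro e _
    rw [← Finset.mul_sum, Finset.sum_boole]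
  have h3 : ∀ d ∈ D, ∀ e ∈ D, w d * w e *
        (((Finset.Ioc a (a + N)).filter (Nat.lcm d e ∣ ·)).card : ℝ) ≤
        w d * w e * (1 / (Nat.lcm d e : ℕ)) * N + (R:ℝ) ^ 2 := by
    intro d hd e he
    rw [hD, mem_squarefreeUpTo] at hd he
    have hb := abs_card_multiples_sub_le a N (Nat.lcm d e)
      (Nat.pos_of_ne_zero (Nat.lcm_ne_zero (by omega) (by omega)))
    have hwd : |w d| ≤ R := (abs_selbergWeight_le hR d).trans (by exact_mod_cast hd.1.2)
    have hwe : |w e| ≤ R := (abs_selbergWeight_le hR e).trans (by exact_mod_cast he.1.2)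
    set c := (((Finset.Ioc a (a + N)).filter (Nat.lcm d e ∣ ·)).card : ℝ)
    have : w d * w e * (c - N / (Nat.lcm d e : ℕ)) ≤ (R:ℝ) ^ 2 := by
      refine (le_abs_self _).trans ?_
      rw [abs_mul, abs_mul]
      calc |w d| * |w e| * _ ≤ R * R * 1 := by gcongr
        _ = _ := by ring
    have e1 : w d * w e * (1 / (Nat.lcm d e : ℕ)) * N = w d * w e * (N / (Nat.lcm d e : ℕ)) := by
      ring
    rw [e1]
    linarith
  have hcard : (D.card : ℝ) ≤ R := by
    have : D.card ≤ (Finset.Icc 1 R).card := Finset.card_filter_le _ _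
    rw [Nat.card_Icc] at this
    exact_mod_cast this
  calc (A.card : ℝ) ≤ _ := h1
    _ = _ := h2
    _ ≤ ∑ d ∈ D, ∑ e ∈ D, (w d * w e * (1 / (Nat.lcm d e : ℕ)) * N + (R:ℝ) ^ 2) :=
        Finset.sum_le_sum fun d hd => Finset.sum_le_sum fun e he => h3 d hd e he
    _ = N / selbergDenom R + D.card * D.card * (R:ℝ) ^ 2 := by
        simp_rw [Finset.sum_add_distrib, ← Finset.sum_mul]
        rw [selberg_main_term hR]
        simp only [Finset.sum_const, nsmul_eq_mul]
        ring
    _ ≤ N / selbergDenom R + R * R * (R:ℝ) ^ 2 := by gcongr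
    _ = _ := by ring

/-- A Brun–Titchmarsh inequality for prime powers. -/
theorem card_primePow_Ioc_le {a N : ℕ} (hN : 2 ≤ N) (haN : N ≤ a) :
    (((Finset.Ioc a (a + N)).filter IsPrimePow).card : ℝ) ≤ 52 * (N / Real.log N) := by
  set R := ⌈(N:ℝ) ^ (1/8:ℝ)⌉₊ with hRdef
  have hN1 : (1:ℝ) < N := by exact_mod_cast (by omega : 1 < N)
  have hN0 : (0:ℝ) < N := by linarith
  have hp1 : 1 ≤ (N:ℝ) ^ (1/8:ℝ) := Real.one_le_rpow hN1.le (by norm_num)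
  have hR1 : 1 ≤ R := Nat.one_le_ceil_iff.mpr (by linarith)
  have hRlow : (N:ℝ) ^ (1/8:ℝ) ≤ R := Nat.le_ceil _
  have hRup : (R:ℝ) ≤ 2 * (N:ℝ) ^ (1/8:ℝ) := by
    have := Nat.ceil_lt_add_one (a := (N:ℝ) ^ (1/8:ℝ)) (by positivity)
    linarith
  have hlogN : 0 < Real.log N := Real.log_pos hN1
  have hlogR : Real.log N / 8 ≤ Real.log R := by
    have := Real.log_le_log (by positivity) hRlow
    rw [Real.log_rpow hN0] at this
    linarith
  set P := (Finset.Ioc a (a + N)).filter IsPrimePow with hP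
  set A := P.filter (fun n => R < n.minFac) with hA
  set B := P.filter (fun n => ¬ R < n.minFac) with hB
  have hcard : P.card = A.card + B.card :=
    (Finset.card_filter_add_card_filter_not _).symm
  have hAc : (A.card : ℝ) ≤ N / selbergDenom R + (R:ℝ) ^ 4 := by
    apply card_le_of_no_small_divisor hR1 a N A
    · exact (Finset.filter_subset _ _).trans (Finset.filter_subset _ _)
    · intro n hn d hd hdR
      rw [hA, Finset.mem_filter] at hn
      by_contra h1
      have := Nat.minFac_le_of_dvd (n := n) (m := d) (by
        have : d ≠ 0 := by
          rintro rfl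
          have : n = 0 := by simpa using hd
          rw [this] at hn
          simp [hP] at hn
        omega) hd
      omega
  have hBc : B.card ≤ R := by
    have : B.card ≤ (Finset.Icc 1 R).card := by
      apply Finset.card_le_card_of_injOn Nat.minFac
      · intro n hn
        rw [Finset.mem_coe, hB, Finset.mem_filter] at hn
        rw [Finset.mem_coe, Finset.mem_Icc]
        exact ⟨Nat.minFac_pos n, by omega⟩
      · have key : ∀ n ∈ B, ∃ k, n.minFac.Prime ∧ n = n.minFac ^ k ∧ n ∈ Finset.Ioc a (a + N) := by
          intro n hn
          rw [hB, Finset.mem_filter, hP, Finset.mem_filter] at hn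
          obtain ⟨p, k, hp, hk, rfl⟩ := hn.1.2
          rw [← Nat.prime_iff] at hp
          refine ⟨k, ?_, ?_, hn.1.1⟩
          · rw [hp.pow_minFac hk.ne']; exact hp
          · rw [hp.pow_minFac hk.ne']
        have aux : ∀ p i j : ℕ, p.Prime → i < j → p ^ i ∈ Finset.Ioc a (a + N) →
            p ^ j ∈ Finset.Ioc a (a + N) → False := by
          intro p i j hp hij h1 h2
          rw [Finset.mem_Ioc] at h1 h2
          have : p ^ (i + 1) ≤ p ^ j := Nat.pow_le_pow_right hp.pos hij
          have h3 : 2 * p ^ i ≤ p ^ (i + 1) := by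
            rw [pow_succ, mul_comm]; exact Nat.mul_le_mul_left _ hp.two_le
          omega
        intro n hn m hm hnm
        obtain ⟨i, hp, hi, hni⟩ := key n hn
        obtain ⟨j, _, hj, hmj⟩ := key m hm
        rw [← hnm] at hj
        rw [hi] at hni
        rw [hj] at hmj
        rcases lt_trichotomy i j with h | h | h
        · exact (aux _ _ _ hp h hni hmj).elim
        · rw [hi, hj, h]
        · exact (aux _ _ _ hp h hmj hni).elim
    simpa using this
  have hden : Real.log N / 16 ≤ selbergDenom R := by
    have := log_le_selbergDenom hR1
    linarith
  have h1 : (N:ℝ) / selbergDenom R ≤ 16 * (N / Real.log N) := by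
    calc (N:ℝ) / selbergDenom R ≤ N / (Real.log N / 16) := by gcongr
      _ = _ := by field_simp
  have hsq : ((N:ℝ) ^ (1/8:ℝ)) ^ 4 = Real.sqrt N := by
    rw [← Real.rpow_natCast, ← Real.rpow_mul hN0.le, Real.sqrt_eq_rpow]
    norm_num
  have h2 : (R:ℝ) ^ 4 ≤ 16 * Real.sqrt N := by
    calc (R:ℝ) ^ 4 ≤ (2 * (N:ℝ) ^ (1/8:ℝ)) ^ 4 := by gcongr
      _ = _ := by rw [mul_pow, hsq]; norm_num
  have h3 : (R:ℝ) ≤ 2 * Real.sqrt N := by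
    refine hRup.trans ?_
    rw [← hsq]
    have := le_self_pow₀ hp1 (n := 4) (by norm_num)
    linarith
  have h4 : Real.sqrt N ≤ 2 * (N / Real.log N) := by
    have hs : 0 < Real.sqrt N := Real.sqrt_pos.mpr hN0
    have : Real.log N ≤ 2 * Real.sqrt N := by
      have e := Real.log_le_self hs.le
      rw [Real.log_sqrt hN0.le] at e
      linarith
    rw [← mul_div_assoc, le_div_iff₀ hlogN]
    calc Real.sqrt N * Real.log N ≤ Real.sqrt N * (2 * Real.sqrt N) := by gcongr
      _ = 2 * N := by rw [mul_left_comm, Real.mul_self_sqrt hN0.le]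
  have hBc' : (B.card : ℝ) ≤ R := by exact_mod_cast hBc
  have hcard' : (P.card : ℝ) = A.card + B.card := by exact_mod_cast hcard
  rw [hcard']
  linarith

theorem loglog_three_pos : 0 < Real.log (Real.log 3) := by
  apply Real.log_pos
  rw [Real.lt_log_iff_exp_lt (by norm_num)]
  linarith [Real.exp_one_lt_d9]

theorem loglog_three_le {x : ℝ} (hx : 1 < x) :
    Real.log (Real.log 3) ≤ Real.log (Real.log (3 * x)) := by
  have h3 : 0 < Real.log 3 := Real.log_pos (by norm_num)
  apply Real.log_le_log h3
  apply Real.log_le_log (by norm_num)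
  linarith

theorem one_le_mul_loglog {x : ℝ} (hx : 1 < x) :
    1 ≤ 1 / Real.log (Real.log 3) * Real.log (Real.log (3 * x)) := by
  have := loglog_three_pos
  have h := loglog_three_le hx
  rw [one_div_mul_eq_div, le_div_iff₀ this]
  linarith

theorem one_le_log_three_mul {x : ℝ} (hx : 1 < x) : 1 ≤ Real.log (3 * x) := by
  rw [Real.le_log_iff_exp_le (by linarith)]
  linarith [Real.exp_one_lt_d9]

/-- Dyadic block of the sum over prime powers near `x`. -/
theorem sum_vonMangoldt_dyadic_le {x : ℝ} (hx1 : 1 < x) (k : ℕ) (A : Finset ℕ)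
    (hA : ∀ n ∈ A, (2:ℝ) ^ k ≤ |(n:ℝ) - x| ∧ |(n:ℝ) - x| < 2 ^ (k + 1) ∧ |(n:ℝ) - x| ≤ x / 4) :
    ∑ n ∈ A, ArithmeticFunction.vonMangoldt n / |(n:ℝ) - x| ≤
      208 / Real.log 2 * Real.log (2 * x) * (1 / (k + 1)) := by
  rcases A.eq_empty_or_nonempty with rfl | ⟨n₀, hn₀⟩
  · have : 0 < Real.log 2 := Real.log_pos (by norm_num)
    have : 0 < Real.log (2 * x) := Real.log_pos (by linarith)
    rw [Finset.sum_empty]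
    positivity
  have hkx : (2:ℝ) ^ k ≤ x / 4 := (hA n₀ hn₀).1.trans (hA n₀ hn₀).2.2
  have hx : 4 ≤ x := by
    have : (1:ℝ) ≤ 2 ^ k := one_le_pow₀ (by norm_num)
    linarith
  have hlog2 : 0 < Real.log 2 := Real.log_pos (by norm_num)
  have hlog2x : 0 < Real.log (2 * x) := Real.log_pos (by linarith)
  have h2k : (0:ℝ) < 2 ^ k := by positivity
  have hfl : 2 ^ (k + 2) ≤ ⌊x⌋₊ := by
    apply Nat.le_floor
    push_cast
    rw [pow_add]; linarith
  have hlog : Real.log ((2 ^ (k + 1) : ℕ) : ℝ) = (k + 1) * Real.log 2 := by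
    push_cast
    rw [Real.log_pow]; push_cast; ring
  have hpow : 2 ^ (k + 2) = 2 * 2 ^ (k + 1) := by ring
  have h2le : 2 ≤ 2 ^ (k + 1) := by
    rw [pow_succ]; have : 0 < 2 ^ k := by positivity
    omega
  have b1 := card_primePow_Ioc_le (a := ⌊x⌋₊) (N := 2 ^ (k + 1)) h2le (by omega)
  have b2 := card_primePow_Ioc_le (a := ⌊x⌋₊ - 2 ^ (k + 1)) (N := 2 ^ (k + 1)) h2le (by omega)
  have hsub : A.filter IsPrimePow ⊆
      (Finset.Ioc ⌊x⌋₊ (⌊x⌋₊ + 2 ^ (k + 1))).filter IsPrimePow ∪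
      (Finset.Ioc (⌊x⌋₊ - 2 ^ (k + 1)) (⌊x⌋₊ - 2 ^ (k + 1) + 2 ^ (k + 1))).filter IsPrimePow := by
    intro n hn
    rw [Finset.mem_filter] at hn
    obtain ⟨h1, h2, h3⟩ := hA n hn.1
    have hf := Nat.floor_le (a := x) (by linarith)
    have hf' := Nat.lt_floor_add_one x
    rw [Finset.mem_union, Finset.mem_filter, Finset.mem_filter, Finset.mem_Ioc, Finset.mem_Ioc]
    rw [abs_lt] at h2
    rcases le_or_gt (n:ℝ) x with hnx | hnx
    · right
      refine ⟨⟨?_, ?_⟩, hn.2⟩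
      · have : (⌊x⌋₊ : ℝ) < n + 2 ^ (k + 1) := by linarith
        have : ⌊x⌋₊ < n + 2 ^ (k + 1) := by exact_mod_cast this
        omega
      · have := Nat.le_floor hnx
        omega
    · left
      refine ⟨⟨(Nat.floor_lt (by linarith)).mpr hnx, ?_⟩, hn.2⟩
      have : (n : ℝ) < ⌊x⌋₊ + 2 ^ (k + 1) + 1 := by linarith
      have : n < ⌊x⌋₊ + 2 ^ (k + 1) + 1 := by exact_mod_cast this
      omega
  have hcard : ((A.filter IsPrimePow).card : ℝ) ≤
      2 * (52 * ((2 ^ (k + 1) : ℕ) / ((k + 1) * Real.log 2))) := by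
    have h := (Finset.card_le_card hsub).trans (Finset.card_union_le _ _)
    have h' := (Nat.cast_le (α := ℝ)).mpr h
    push_cast at h'
    rw [hlog] at b1 b2
    push_cast at b1 b2 ⊢
    linarith
  calc ∑ n ∈ A, ArithmeticFunction.vonMangoldt n / |(n:ℝ) - x|
      = ∑ n ∈ A.filter IsPrimePow, ArithmeticFunction.vonMangoldt n / |(n:ℝ) - x| := by
        symm
        apply Finset.sum_filter_of_ne
        intro n _ hne
        by_contra h
        rw [ArithmeticFunction.vonMangoldt_eq_zero_iff.mpr h, zero_div] at hne
        exact hne rfl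
    _ ≤ ∑ n ∈ A.filter IsPrimePow, Real.log (2 * x) / 2 ^ k := by
        apply Finset.sum_le_sum
        intro n hn
        rw [Finset.mem_filter] at hn
        obtain ⟨h1, h2, h3⟩ := hA n hn.1
        rw [abs_le] at h3
        have hn0 : (0:ℝ) < n := by linarith
        have : ArithmeticFunction.vonMangoldt n ≤ Real.log (2 * x) :=
          ArithmeticFunction.vonMangoldt_le_log.trans (Real.log_le_log hn0 (by linarith))
        gcongr
    _ = (A.filter IsPrimePow).card * (Real.log (2 * x) / 2 ^ k) := by
        rw [Finset.sum_const, nsmul_eq_mul]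
    _ ≤ 2 * (52 * ((2 ^ (k + 1) : ℕ) / ((k + 1) * Real.log 2))) * (Real.log (2 * x) / 2 ^ k) := by
        gcongr
    _ = _ := by
        push_cast
        rw [pow_succ]
        field_simp
        ring

/-- The sum over prime powers close to `x`, excluding those at distance less than `1`. -/
theorem exists_sum_vonMangoldt_near_le : ∃ C : ℝ, 0 < C ∧ ∀ x : ℝ, 1 < x → ∀ A : Finset ℕ,
    (∀ n ∈ A, 1 ≤ |(n:ℝ) - x| ∧ |(n:ℝ) - x| ≤ x / 4) →
    ∑ n ∈ A, ArithmeticFunction.vonMangoldt n / |(n:ℝ) - x| ≤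
      C * (Real.log (3 * x) * Real.log (Real.log (3 * x))) := by
  have hlog2 : 0 < Real.log 2 := Real.log_pos (by norm_num)
  have hll := loglog_three_pos
  refine ⟨208 / Real.log 2 * ((1 + Real.log (1 / Real.log 2)) / Real.log (Real.log 3) + 1), ?_, ?_⟩
  · have : 0 ≤ Real.log (1 / Real.log 2) := by
      apply Real.log_nonneg
      rw [le_div_iff₀ hlog2]
      linarith [Real.log_two_lt_d9]
    positivity
  intro x hx A hA
  have hl2x : 0 < Real.log (2 * x) := Real.log_pos (by linarith)
  have hl3 := one_le_log_three_mul hx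
  have hl23 : Real.log (2 * x) ≤ Real.log (3 * x) := Real.log_le_log (by linarith) (by linarith)
  have hlpos : 0 < Real.log (Real.log (3 * x)) := hll.trans_le (loglog_three_le hx)
  set K := Nat.log 2 ⌊x⌋₊ + 1 with hK
  set κ : ℕ → ℕ := fun n => Nat.log 2 ⌊|(n:ℝ) - x|⌋₊ with hκ
  have hmaps : ∀ n ∈ A, κ n ∈ Finset.range K := by
    intro n hn
    rw [Finset.mem_range, hK, Nat.lt_succ_iff]
    apply Nat.log_mono_right
    apply Nat.floor_le_floor
    have := (hA n hn).2
    linarith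
  rw [← Finset.sum_fiberwise_of_maps_to hmaps]
  have hblock : ∀ k ∈ Finset.range K, ∑ n ∈ A with κ n = k,
      ArithmeticFunction.vonMangoldt n / |(n:ℝ) - x| ≤
      208 / Real.log 2 * Real.log (2 * x) * (1 / (k + 1)) := by
    intro k _
    apply sum_vonMangoldt_dyadic_le hx
    intro n hn
    rw [Finset.mem_filter] at hn
    obtain ⟨h1, h2⟩ := hA n hn.1
    have hfl : ⌊|(n:ℝ) - x|⌋₊ ≠ 0 := by
      have := Nat.le_floor (n := 1) (a := |(n:ℝ) - x|) (by simpa using h1)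
      omega
    rw [← hn.2]
    refine ⟨?_, ?_, h2⟩
    · have := Nat.pow_log_le_self 2 hfl
      calc (2:ℝ) ^ κ n = ((2 ^ κ n : ℕ) : ℝ) := by push_cast; rfl
        _ ≤ ⌊|(n:ℝ) - x|⌋₊ := by exact_mod_cast this
        _ ≤ _ := Nat.floor_le (abs_nonneg _)
    · have := Nat.lt_pow_succ_log_self (b := 2) (by norm_num) ⌊|(n:ℝ) - x|⌋₊
      rw [Nat.floor_lt (abs_nonneg _)] at this
      exact_mod_cast this
  refine (Finset.sum_le_sum hblock).trans ?_
  rw [← Finset.mul_sum]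
  have hharm : ∑ k ∈ Finset.range K, (1:ℝ) / (k + 1) ≤ 1 + Real.log K := by
    have := harmonic_le_one_add_log K
    rw [harmonic] at this
    push_cast at this
    simpa using this
  have hKle : (K:ℝ) ≤ 1 / Real.log 2 * Real.log (3 * x) := by
    rw [one_div_mul_eq_div, le_div_iff₀ hlog2]
    have hfl : ⌊x⌋₊ ≠ 0 := by
      have := Nat.le_floor (n := 1) (a := x) (by simpa using hx.le)
      omega
    have h1 : ((2 ^ Nat.log 2 ⌊x⌋₊ : ℕ) : ℝ) ≤ x :=
      (Nat.cast_le.mpr (Nat.pow_log_le_self 2 hfl)).trans (Nat.floor_le (by linarith))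
    have h2 : ((2 ^ K : ℕ):ℝ) ≤ 3 * x := by
      rw [hK, pow_succ]; push_cast at h1 ⊢; linarith
    have h3 := Real.log_le_log (by positivity) h2
    push_cast at h3
    rwa [Real.log_pow] at h3
  have hlogK : Real.log K ≤ Real.log (1 / Real.log 2) + Real.log (Real.log (3 * x)) := by
    rw [← Real.log_mul (by positivity) (by positivity)]
    exact Real.log_le_log (by positivity) hKle
  have hnn : 0 ≤ 1 + Real.log (1 / Real.log 2) := by
    have : 0 ≤ Real.log (1 / Real.log 2) := by
      apply Real.log_nonneg
      rw [le_div_iff₀ hlog2]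
      linarith [Real.log_two_lt_d9]
    linarith
  have hfin : ∑ k ∈ Finset.range K, (1:ℝ) / (k + 1) ≤
      ((1 + Real.log (1 / Real.log 2)) / Real.log (Real.log 3) + 1) *
        Real.log (Real.log (3 * x)) := by
    have h1 := mul_le_mul_of_nonneg_left (one_le_mul_loglog hx) hnn
    calc _ ≤ (1 + Real.log (1 / Real.log 2)) * 1 + Real.log (Real.log (3 * x)) := by linarith
      _ ≤ (1 + Real.log (1 / Real.log 2)) * (1 / Real.log (Real.log 3) *
          Real.log (Real.log (3 * x))) + Real.log (Real.log (3 * x)) := by linarith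
      _ = _ := by ring
  calc _ ≤ 208 / Real.log 2 * Real.log (3 * x) *
        (((1 + Real.log (1 / Real.log 2)) / Real.log (Real.log 3) + 1) *
        Real.log (Real.log (3 * x))) := by gcongr
    _ = _ := by ring

/-- A bounded nonvanishing holomorphic function on a disc has small logarithmic derivative near the
centre. -/
theorem exists_holomorphic_log {f : ℂ → ℂ} {c : ℂ} {R M : ℝ} (hR : 0 < R) (hM : 0 < M)
    (hf : DifferentiableOn ℂ f (Metric.ball c R)) (hf0 : ∀ z ∈ Metric.ball c R, f z ≠ 0)
    (hfM : ∀ z ∈ Metric.ball c R, ‖f z‖ ≤ Real.exp M * ‖f c‖) :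
    ∃ G : ℂ → ℂ, (∀ z ∈ Metric.ball c R, HasDerivAt G (logDeriv f z) z) ∧ G c = 0 ∧
      (∀ z ∈ Metric.ball c R, f z = f c * Complex.exp (G z)) ∧
      ∀ z ∈ Metric.closedBall c (R / 2), ‖G z‖ ≤ 2 * M := by
  have hc : c ∈ Metric.ball c R := Metric.mem_ball_self hR
  have hld : DifferentiableOn ℂ (logDeriv f) (Metric.ball c R) :=
    (hf.deriv Metric.isOpen_ball).div hf hf0
  obtain ⟨G₀, hG₀⟩ := hld.isExactOn_ball
  set G : ℂ → ℂ := fun z => G₀ z - G₀ c with hGdef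
  have hG : ∀ z ∈ Metric.ball c R, HasDerivAt G (logDeriv f z) z := fun z hz =>
    (hG₀ z hz).sub_const _
  have hconst : ∀ z ∈ Metric.ball c R, f z * Complex.exp (-G z) = f c := by
    have hder : ∀ z ∈ Metric.ball c R,
        HasDerivAt (fun z => f z * Complex.exp (-G z)) 0 z := by
      intro z hz
      have h1 : HasDerivAt f (deriv f z) z :=
        (hf.differentiableAt (Metric.isOpen_ball.mem_nhds hz)).hasDerivAt
      have h2 := (h1.mul ((hG z hz).neg.cexp))
      refine h2.congr_deriv ?_
      have := hf0 z hz
      rw [logDeriv_apply]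
      field_simp
      ring
    intro z hz
    have := (convex_ball c R).is_const_of_fderivWithin_eq_zero (𝕜 := ℂ)
      (f := fun z => f z * Complex.exp (-G z))
      (fun w hw => (hder w hw).differentiableAt.differentiableWithinAt) ?_ hz hc
    · simpa [hGdef] using this
    · intro w hw
      rw [fderivWithin_of_isOpen Metric.isOpen_ball hw]
      have := (hder w hw).hasFDerivAt.fderiv
      rw [this]
      ext
      simp
  have hre : ∀ z ∈ Metric.ball c R, (G z).re ≤ M := by
    intro z hz
    have h1 := hconst z hz
    have h2 : ‖f z‖ * Real.exp (-(G z).re) = ‖f c‖ := by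
      rw [← h1, norm_mul, Complex.norm_exp]
      simp
    have h3 : ‖f z‖ = Real.exp ((G z).re) * ‖f c‖ := by
      rw [← h2, mul_comm, mul_assoc, ← Real.exp_add]
      simp
    have h4 := hfM z hz
    rw [h3] at h4
    have h5 : 0 < ‖f c‖ := norm_pos_iff.mpr (hf0 c hc)
    exact Real.exp_le_exp.mp (le_of_mul_le_mul_right h4 h5)
  refine ⟨G, hG, by simp [hGdef], ?_, ?_⟩
  · intro z hz
    rw [← hconst z hz, mul_assoc, ← Complex.exp_add]
    simp
  intro z hz
  have hmem : ∀ w ∈ Metric.ball (0:ℂ) R, w + c ∈ Metric.ball c R := by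
    intro w hw
    simpa [dist_eq_norm] using hw
  have hz' : ‖z - c‖ ≤ R / 2 := by simpa [dist_eq_norm] using hz
  have h := Complex.borelCaratheodory_zero (f := fun w => G (w + c)) (z := z - c) (R := R) hM
    (fun w hw => by
      have h1 : DifferentiableAt ℂ G (w + c) := (hG _ (hmem w hw)).differentiableAt
      have h2 : DifferentiableAt ℂ (fun w : ℂ => w + c) w := by fun_prop
      exact (h1.comp w h2).differentiableWithinAt)
    (fun w hw => hre _ (hmem w hw)) hR (by simpa using hz'.trans_lt (by linarith))
    (by simp [hGdef])
  simp only [sub_add_cancel] at h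
  refine h.trans ?_
  rw [div_le_iff₀ (by linarith)]
  nlinarith [norm_nonneg (z - c)]

theorem norm_logDeriv_le {f : ℂ → ℂ} {c : ℂ} {R M : ℝ} (hR : 0 < R) (hM : 0 < M)
    (hf : DifferentiableOn ℂ f (Metric.ball c R)) (hf0 : ∀ z ∈ Metric.ball c R, f z ≠ 0)
    (hfM : ∀ z ∈ Metric.ball c R, ‖f z‖ ≤ Real.exp M * ‖f c‖) {z : ℂ} (hz : ‖z - c‖ ≤ R / 4) :
    ‖logDeriv f z‖ ≤ 8 * M / R := by
  obtain ⟨G, hG, -, -, hGM⟩ := exists_holomorphic_log hR hM hf hf0 hfM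
  have hsub : ∀ w ∈ Metric.closedBall z (R / 4), w ∈ Metric.closedBall c (R / 2) := by
    intro w hw
    rw [Metric.mem_closedBall, dist_eq_norm] at *
    calc ‖w - c‖ = ‖(w - z) + (z - c)‖ := by ring_nf
      _ ≤ _ := norm_add_le _ _
      _ ≤ _ := by linarith
  have hsub2 : ∀ w ∈ Metric.closedBall c (R / 2), w ∈ Metric.ball c R := by
    intro w hw
    rw [Metric.mem_closedBall] at hw
    rw [Metric.mem_ball]
    linarith
  have h := Complex.norm_deriv_le_of_forall_mem_sphere_norm_le (f := G) (c := z) (R := R / 4)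
    (C := 2 * M) (by positivity)
    (DifferentiableOn.diffContOnCl (fun w hw => by
      rw [closure_ball _ (by positivity)] at hw
      exact (hG w (hsub2 _ (hsub w hw))).differentiableAt.differentiableWithinAt))
    (fun w hw => hGM w (hsub w (Metric.sphere_subset_closedBall hw)))
  rw [(hG z (hsub2 z (hsub z (Metric.mem_closedBall_self (by positivity))))).deriv] at h
  refine h.trans (le_of_eq ?_)
  field_simp
  norm_num

theorem norm_deriv_logDeriv_le {f : ℂ → ℂ} {c : ℂ} {R M : ℝ} (hR : 0 < R) (hM : 0 < M)
    (hf : DifferentiableOn ℂ f (Metric.ball c R)) (hf0 : ∀ z ∈ Metric.ball c R, f z ≠ 0)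
    (hfM : ∀ z ∈ Metric.ball c R, ‖f z‖ ≤ Real.exp M * ‖f c‖) {z : ℂ} (hz : ‖z - c‖ ≤ R / 8) :
    ‖deriv (logDeriv f) z‖ ≤ 64 * M / R ^ 2 := by
  have hld : DifferentiableOn ℂ (logDeriv f) (Metric.ball c R) :=
    (hf.deriv Metric.isOpen_ball).div hf hf0
  have hsub : ∀ w ∈ Metric.closedBall z (R / 8), ‖w - c‖ ≤ R / 4 := by
    intro w hw
    rw [Metric.mem_closedBall, dist_eq_norm] at *
    calc ‖w - c‖ = ‖(w - z) + (z - c)‖ := by ring_nf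
      _ ≤ _ := norm_add_le _ _
      _ ≤ _ := by linarith
  have h := Complex.norm_deriv_le_of_forall_mem_sphere_norm_le (f := logDeriv f) (c := z)
    (R := R / 8) (C := 8 * M / R) (by positivity)
    (DifferentiableOn.diffContOnCl (hld.mono fun w hw => by
      rw [closure_ball _ (by positivity)] at hw
      rw [Metric.mem_ball, dist_eq_norm]
      linarith [hsub w hw]))
    (fun w hw => norm_logDeriv_le hR hM hf hf0 hfM
      (hsub w (Metric.sphere_subset_closedBall hw)))
  refine h.trans (le_of_eq ?_)
  field_simp
  norm_num

theorem norm_Gamma_le_Gamma_re {s : ℂ} (hs : 0 < s.re) : ‖Complex.Gamma s‖ ≤ Real.Gamma s.re := by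
  rw [Complex.Gamma_eq_integral hs, Real.Gamma_eq_integral hs, Complex.GammaIntegral]
  refine (MeasureTheory.norm_integral_le_integral_norm _).trans (le_of_eq ?_)
  apply MeasureTheory.setIntegral_congr_fun measurableSet_Ioi
  intro x hx
  have hx : 0 < x := hx
  simp only [norm_mul, Complex.norm_real, Real.norm_eq_abs, Real.abs_exp]
  rw [Complex.norm_cpow_eq_rpow_re_of_pos hx]
  simp

theorem norm_Gamma_le_norm_Gamma_add_nat {s : ℂ} (hs : 1 ≤ |s.im|) (n : ℕ) :
    ‖Complex.Gamma s‖ ≤ ‖Complex.Gamma (s + n)‖ := by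
  induction n with
  | zero => simp
  | succ n ih =>
    refine ih.trans ?_
    have h1 : 1 ≤ ‖s + n‖ := by
      refine le_trans ?_ (Complex.abs_im_le_norm _)
      simpa using hs
    have h0 : s + n ≠ 0 := by
      intro h
      rw [h] at h1
      norm_num at h1
    have : s + ((n + 1 : ℕ) : ℂ) = (s + n) + 1 := by push_cast; ring
    rw [this, Complex.Gamma_add_one _ h0, norm_mul]
    exact le_mul_of_one_le_left (norm_nonneg _) h1

theorem norm_Gamma_le_exp {s : ℂ} {t : ℝ} (ht : 4 ≤ t) (hs : 1 ≤ |s.im|)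
    (h1 : 1 / 2 - t / 2 ≤ s.re) (h2 : s.re ≤ 1 / 2 + t / 2) :
    ‖Complex.Gamma s‖ ≤ Real.exp (8 * t * Real.log t) := by
  set N := ⌈t⌉₊ with hN
  have hN1 : t ≤ N := Nat.le_ceil t
  have hN2 : (N:ℝ) < t + 1 := Nat.ceil_lt_add_one (by linarith)
  set K := ⌈2 * t + 1⌉₊ with hK
  have hK1 : 2 * t + 1 ≤ K := Nat.le_ceil _
  have hK2 : (K:ℝ) < 2 * t + 1 + 1 := Nat.ceil_lt_add_one (by linarith)
  have hlog : 0 < Real.log t := Real.log_pos (by linarith)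
  calc ‖Complex.Gamma s‖ ≤ ‖Complex.Gamma (s + N)‖ := norm_Gamma_le_norm_Gamma_add_nat hs N
    _ ≤ Real.Gamma (s + N).re := norm_Gamma_le_Gamma_re (by simp; linarith)
    _ ≤ Real.Gamma (K + 1) := by
        apply Real.Gamma_strictMonoOn_Ici.monotoneOn
        · simp; linarith
        · simp; linarith
        · simp; linarith
    _ = (K.factorial : ℝ) := Real.Gamma_nat_eq_factorial K
    _ ≤ (K:ℝ) ^ K := by exact_mod_cast Nat.factorial_le_pow K
    _ = Real.exp (K * Real.log K) := by
        rw [mul_comm, Real.exp_mul, Real.exp_log (by linarith), Real.rpow_natCast]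
    _ ≤ Real.exp (8 * t * Real.log t) := by
        apply Real.exp_le_exp.mpr
        have h3 : Real.log K ≤ 2 * Real.log t := by
          have : 2 * Real.log t = Real.log (t ^ 2) := by rw [Real.log_pow]; norm_num
          rw [this]
          apply Real.log_le_log (by linarith)
          nlinarith
        have h4 : (0:ℝ) ≤ Real.log K := Real.log_nonneg (by linarith)
        calc (K:ℝ) * Real.log K ≤ (4 * t) * (2 * Real.log t) := by
              apply mul_le_mul _ h3 h4 (by linarith)
              linarith
          _ = _ := by ring

/-- The factor in the functional equation `ζ (1 - s) = zetaFactor s * ζ s`. -/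
def zetaFactor (s : ℂ) : ℂ :=
  2 * (2 * Real.pi : ℂ) ^ (-s) * Complex.Gamma s * Complex.cos (Real.pi * s / 2)

theorem ne_neg_nat_of_im_ne_zero {s : ℂ} (hs : s.im ≠ 0) (n : ℕ) : s ≠ -n := by
  rintro rfl
  simp at hs

theorem riemannZeta_one_sub_eq {s : ℂ} (hs : s.im ≠ 0) :
    riemannZeta (1 - s) = zetaFactor s * riemannZeta s := by
  rw [zetaFactor]
  exact riemannZeta_one_sub (ne_neg_nat_of_im_ne_zero hs) (by rintro rfl; simp at hs)

theorem zetaFactor_mul_zetaFactor_one_sub {s : ℂ} (hs : s.im ≠ 0) :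
    zetaFactor s * zetaFactor (1 - s) = 1 := by
  have hpi : (2 * Real.pi : ℂ) ≠ 0 := by
    simp [Real.pi_ne_zero]
  have hsin : Complex.sin (Real.pi * s) ≠ 0 := by
    rw [Complex.sin_ne_zero_iff]
    intro k hk
    have : s = k := by
      have hp : (Real.pi : ℂ) ≠ 0 := by simp [Real.pi_ne_zero]
      apply mul_left_cancel₀ hp
      rw [hk]; ring
    rw [this] at hs
    simp at hs
  have h1 := Complex.Gamma_mul_Gamma_one_sub s
  have h2 : Complex.cos (Real.pi * (1 - s) / 2) = Complex.sin (Real.pi * s / 2) := by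
    rw [← Complex.cos_pi_div_two_sub]
    congr 1
    ring
  have h3 : Complex.sin (Real.pi * s) =
      2 * Complex.sin (Real.pi * s / 2) * Complex.cos (Real.pi * s / 2) := by
    rw [← Complex.sin_two_mul]
    congr 1
    ring
  have h4 : (2 * Real.pi : ℂ) ^ (-s) * (2 * Real.pi : ℂ) ^ (-(1 - s)) = (2 * Real.pi : ℂ)⁻¹ := by
    rw [← Complex.cpow_add _ _ hpi, ← Complex.cpow_neg_one]
    congr 1
    ring
  rw [zetaFactor, zetaFactor, h2]
  calc _ = 4 * ((2 * Real.pi : ℂ) ^ (-s) * (2 * Real.pi : ℂ) ^ (-(1 - s))) *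
        (Complex.Gamma s * Complex.Gamma (1 - s)) *
        (Complex.sin (Real.pi * s / 2) * Complex.cos (Real.pi * s / 2)) := by ring
    _ = 1 := by
      rw [h4, h1]
      have hp : (Real.pi : ℂ) ≠ 0 := by simp [Real.pi_ne_zero]
      field_simp
      rw [h3]
      ring

theorem zetaFactor_conj (s : ℂ) :
    zetaFactor ((starRingEnd ℂ) s) = (starRingEnd ℂ) (zetaFactor s) := by
  have h2 : (starRingEnd ℂ) 2 = 2 := Complex.conj_ofNat 2
  have hcos : Complex.cos (Real.pi * (starRingEnd ℂ) s / 2) =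
      (starRingEnd ℂ) (Complex.cos (Real.pi * s / 2)) := by
    rw [← Complex.cos_conj, map_div₀, map_mul, h2, Complex.conj_ofReal]
  have hpow : (2 * Real.pi : ℂ) ^ (-(starRingEnd ℂ) s) =
      (starRingEnd ℂ) ((2 * Real.pi : ℂ) ^ (-s)) := by
    have h : (2 * Real.pi : ℂ) = ((2 * Real.pi : ℝ) : ℂ) := by push_cast; rfl
    have harg : ((2 * Real.pi : ℝ) : ℂ).arg ≠ Real.pi := by
      rw [Complex.arg_ofReal_of_nonneg (by positivity)]
      exact Real.pi_ne_zero.symm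
    rw [h, ← map_neg, Complex.cpow_conj _ _ harg, Complex.conj_ofReal]
  rw [zetaFactor, zetaFactor, hcos, hpow, Complex.Gamma_conj, map_mul, map_mul, map_mul, h2]

theorem zetaFactor_ne_zero {s : ℂ} (hs : s.im ≠ 0) : zetaFactor s ≠ 0 :=
  left_ne_zero_of_mul_eq_one (zetaFactor_mul_zetaFactor_one_sub hs)

theorem differentiableAt_zetaFactor {s : ℂ} (hs : s.im ≠ 0) :
    DifferentiableAt ℂ zetaFactor s := by
  have hpi : (2 * Real.pi : ℂ) ≠ 0 := by simp [Real.pi_ne_zero]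
  have h1 : DifferentiableAt ℂ Complex.Gamma s :=
    Complex.differentiableAt_Gamma s (ne_neg_nat_of_im_ne_zero hs)
  have h2 : DifferentiableAt ℂ (fun s : ℂ => (2 * Real.pi : ℂ) ^ (-s)) s :=
    DifferentiableAt.const_cpow (by fun_prop) (Or.inl hpi)
  unfold zetaFactor
  fun_prop

theorem norm_zetaFactor_half (t : ℝ) (ht : t ≠ 0) :
    ‖zetaFactor (1 / 2 + t * Complex.I)‖ = 1 := by
  have him : (1 / 2 + t * Complex.I : ℂ).im = t := by simp
  have h := zetaFactor_mul_zetaFactor_one_sub (s := 1 / 2 + t * Complex.I) (by rwa [him])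
  have h1 : (1 - (1 / 2 + t * Complex.I) : ℂ) = (starRingEnd ℂ) (1 / 2 + t * Complex.I) := by
    apply Complex.ext
    · simp; norm_num
    · simp
  rw [h1, zetaFactor_conj, Complex.mul_conj] at h
  have h2 : Complex.normSq (zetaFactor (1 / 2 + t * Complex.I)) = 1 := by exact_mod_cast h
  rw [Complex.normSq_eq_norm_sq] at h2
  exact (pow_eq_one_iff_of_nonneg (norm_nonneg _) two_ne_zero).mp h2

theorem norm_cos_le (z : ℂ) : ‖Complex.cos z‖ ≤ Real.exp |z.im| := by
  rw [Complex.cos, norm_div, Complex.norm_ofNat]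
  have h := norm_add_le (Complex.exp (z * Complex.I)) (Complex.exp (-z * Complex.I))
  rw [Complex.norm_exp, Complex.norm_exp] at h
  have h1 : Real.exp (z * Complex.I).re ≤ Real.exp |z.im| := by
    apply Real.exp_le_exp.mpr
    simpa using neg_le_abs z.im
  have h2 : Real.exp (-z * Complex.I).re ≤ Real.exp |z.im| := by
    apply Real.exp_le_exp.mpr
    simpa using le_abs_self z.im
  rw [div_le_iff₀ (by norm_num)]
  linarith

theorem norm_zetaFactor_le_exp {s : ℂ} {t : ℝ} (ht : 4 ≤ t) (hs : 1 ≤ |s.im|)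
    (hs2 : |s.im| ≤ 3 / 2 * t) (h1 : 1 / 2 - t / 2 ≤ s.re) (h2 : s.re ≤ 1 / 2 + t / 2) :
    ‖zetaFactor s‖ ≤ Real.exp (14 * t * Real.log t) := by
  have hlog : 1 ≤ Real.log t := by
    rw [Real.le_log_iff_exp_le (by linarith)]
    linarith [Real.exp_one_lt_d9]
  have hpi := Real.pi_pos
  have e1 : ‖(2 * Real.pi : ℂ) ^ (-s)‖ ≤ Real.exp (2 * t) := by
    have h : (2 * Real.pi : ℂ) = ((2 * Real.pi : ℝ) : ℂ) := by push_cast; rfl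
    rw [h, Complex.norm_cpow_eq_rpow_re_of_pos (by positivity)]
    have h3 : (2 * Real.pi) ≤ Real.exp 2 := by
      have : Real.exp 2 = Real.exp 1 * Real.exp 1 := by rw [← Real.exp_add]; norm_num
      rw [this]
      nlinarith [Real.exp_one_gt_d9, Real.pi_lt_d2]
    calc (2 * Real.pi) ^ (-s).re ≤ (2 * Real.pi) ^ t := by
          apply Real.rpow_le_rpow_of_exponent_le
          · linarith [Real.pi_gt_three]
          · rw [Complex.neg_re]; linarith
      _ ≤ (Real.exp 2) ^ t := Real.rpow_le_rpow (by positivity) h3 (by linarith)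
      _ = Real.exp (2 * t) := (Real.exp_mul 2 t).symm
  have e2 : ‖Complex.cos (Real.pi * s / 2)‖ ≤ Real.exp (3 * t) := by
    refine (norm_cos_le _).trans ?_
    apply Real.exp_le_exp.mpr
    have : (Real.pi * s / 2 : ℂ).im = Real.pi / 2 * s.im := by
      have : (Real.pi * s / 2 : ℂ) = ((Real.pi / 2 : ℝ) : ℂ) * s := by push_cast; ring
      rw [this, Complex.im_ofReal_mul]
    rw [this, abs_mul, abs_of_pos (by positivity)]
    nlinarith [Real.pi_lt_d2, abs_nonneg s.im]
  have e3 := norm_Gamma_le_exp ht hs h1 h2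
  have e0 : (2:ℝ) ≤ Real.exp 1 := by linarith [Real.exp_one_gt_d9]
  rw [zetaFactor, norm_mul, norm_mul, norm_mul, Complex.norm_ofNat]
  calc _ ≤ Real.exp 1 * Real.exp (2 * t) * Real.exp (8 * t * Real.log t) * Real.exp (3 * t) := by
        gcongr
    _ = Real.exp (1 + 2 * t + 8 * t * Real.log t + 3 * t) := by
        rw [Real.exp_add, Real.exp_add, Real.exp_add]
    _ ≤ _ := by
        apply Real.exp_le_exp.mpr
        nlinarith

/-- The factor in the functional equation `ζ s = zetaCoFactor s * ζ (1 - s)`. -/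
def zetaCoFactor (s : ℂ) : ℂ := zetaFactor (1 - s)

theorem riemannZeta_eq_zetaCoFactor_mul {s : ℂ} (hs : s.im ≠ 0) :
    riemannZeta s = zetaCoFactor s * riemannZeta (1 - s) := by
  have := riemannZeta_one_sub_eq (s := 1 - s) (by simpa using hs)
  rwa [sub_sub_cancel] at this

theorem differentiableAt_zetaCoFactor {s : ℂ} (hs : s.im ≠ 0) :
    DifferentiableAt ℂ zetaCoFactor s := by
  have h1 : DifferentiableAt ℂ zetaFactor (1 - s) :=
    differentiableAt_zetaFactor (by simpa using hs)
  have h2 : DifferentiableAt ℂ (fun s : ℂ => 1 - s) s := by fun_prop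
  exact h1.comp s h2

theorem zetaCoFactor_ne_zero {s : ℂ} (hs : s.im ≠ 0) : zetaCoFactor s ≠ 0 :=
  zetaFactor_ne_zero (by simpa using hs)

theorem norm_zetaCoFactor_half (t : ℝ) (ht : t ≠ 0) :
    ‖zetaCoFactor (1 / 2 + t * Complex.I)‖ = 1 := by
  have := norm_zetaFactor_half (-t) (by simpa using ht)
  rw [zetaCoFactor, ← this]
  congr 2
  push_cast
  ring

theorem zetaCoFactor_ball {t : ℝ} (ht : 4 ≤ t) {z : ℂ}
    (hz : z ∈ Metric.ball (1 / 2 + t * Complex.I) (t / 2)) :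
    z.im ≠ 0 ∧ ‖zetaCoFactor z‖ ≤
      Real.exp (14 * t * Real.log t) * ‖zetaCoFactor (1 / 2 + t * Complex.I)‖ := by
  rw [Metric.mem_ball, dist_eq_norm] at hz
  have hre := (Complex.abs_re_le_norm _).trans hz.le
  have him := (Complex.abs_im_le_norm _).trans hz.le
  rw [abs_le] at hre him
  simp at hre him
  have hi : 1 ≤ z.im := by linarith
  refine ⟨by linarith, ?_⟩
  rw [norm_zetaCoFactor_half t (by linarith), mul_one]
  have habs : |(1 - z).im| = z.im := by
    rw [Complex.sub_im, Complex.one_im, zero_sub, abs_neg, abs_of_pos (by linarith)]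
  apply norm_zetaFactor_le_exp ht
  · rwa [habs]
  · rw [habs]; linarith
  · simp; linarith
  · simp; linarith

theorem norm_sub_half_le {s : ℂ} (h1 : |s.re - 1 / 2| ≤ 38) :
    ‖s - (1 / 2 + s.im * Complex.I)‖ ≤ 38 := by
  have : s - (1 / 2 + s.im * Complex.I) = ((s.re - 1 / 2 : ℝ) : ℂ) := by
    apply Complex.ext <;> simp
  rwa [this, Complex.norm_real]

theorem norm_logDeriv_zetaCoFactor_le {s : ℂ} (hs : 700 ≤ s.im) (h1 : |s.re - 1 / 2| ≤ 38) :
    ‖logDeriv zetaCoFactor s‖ ≤ 224 * Real.log s.im ∧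
      ‖deriv (logDeriv zetaCoFactor) s‖ ≤ 3584 * Real.log s.im / s.im := by
  have hn := norm_sub_half_le h1
  set t := s.im
  have hlog : 0 < Real.log t := Real.log_pos (by linarith)
  have hM : 0 < 14 * t * Real.log t := by positivity
  have hd : DifferentiableOn ℂ zetaCoFactor (Metric.ball (1 / 2 + t * Complex.I) (t / 2)) :=
    fun z hz => (differentiableAt_zetaCoFactor
      (zetaCoFactor_ball (by linarith) hz).1).differentiableWithinAt
  have h0 : ∀ z ∈ Metric.ball (1 / 2 + t * Complex.I) (t / 2), zetaCoFactor z ≠ 0 :=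
    fun z hz => zetaCoFactor_ne_zero (zetaCoFactor_ball (by linarith) hz).1
  have hb : ∀ z ∈ Metric.ball (1 / 2 + t * Complex.I) (t / 2), ‖zetaCoFactor z‖ ≤
      Real.exp (14 * t * Real.log t) * ‖zetaCoFactor (1 / 2 + t * Complex.I)‖ :=
    fun z hz => (zetaCoFactor_ball (by linarith) hz).2
  constructor
  · refine (norm_logDeriv_le (by linarith) hM hd h0 hb (by linarith)).trans (le_of_eq ?_)
    field_simp
    norm_num
  · refine (norm_deriv_logDeriv_le (by linarith) hM hd h0 hb (by linarith)).trans (le_of_eq ?_)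
    field_simp
    norm_num

theorem norm_zetaCoFactor_le {s : ℂ} (hs : 700 ≤ s.im) (h1 : |s.re - 1 / 2| ≤ 38) :
    ‖zetaCoFactor s‖ ≤ s.im ^ 8512 := by
  have hn := norm_sub_half_le h1
  set t := s.im with ht
  set c : ℂ := 1 / 2 + t * Complex.I with hc
  have hlog : 0 < Real.log t := Real.log_pos (by linarith)
  have hM : 0 < 14 * t * Real.log t := by positivity
  have hd : DifferentiableOn ℂ zetaCoFactor (Metric.ball c (t / 2)) :=
    fun z hz => (differentiableAt_zetaCoFactor
      (zetaCoFactor_ball (by linarith) hz).1).differentiableWithinAt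
  have h0 : ∀ z ∈ Metric.ball c (t / 2), zetaCoFactor z ≠ 0 :=
    fun z hz => zetaCoFactor_ne_zero (zetaCoFactor_ball (by linarith) hz).1
  have hb : ∀ z ∈ Metric.ball c (t / 2), ‖zetaCoFactor z‖ ≤
      Real.exp (14 * t * Real.log t) * ‖zetaCoFactor c‖ :=
    fun z hz => (zetaCoFactor_ball (by linarith) hz).2
  obtain ⟨G, hG, hG0, hGe, -⟩ := exists_holomorphic_log (by linarith) hM hd h0 hb
  have hmem : ∀ z ∈ Metric.closedBall c 38, z ∈ Metric.ball c (t / 2) := by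
    intro z hz
    rw [Metric.mem_closedBall] at hz
    rw [Metric.mem_ball]
    linarith
  have hsc : s ∈ Metric.closedBall c 38 := by rwa [Metric.mem_closedBall, dist_eq_norm]
  have hGs : ‖G s - G c‖ ≤ 224 * Real.log t * ‖s - c‖ := by
    apply (convex_closedBall c 38).norm_image_sub_le_of_norm_hasDerivWithin_le
      (f' := logDeriv zetaCoFactor) (fun z hz => (hG z (hmem z hz)).hasDerivWithinAt) _
      (Metric.mem_closedBall_self (by norm_num)) hsc
    intro z hz
    rw [Metric.mem_closedBall, dist_eq_norm] at hz
    refine (norm_logDeriv_le (by linarith) hM hd h0 hb (by linarith)).trans (le_of_eq ?_)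
    field_simp
    norm_num
  rw [hG0, sub_zero] at hGs
  rw [hGe s (hmem s hsc), norm_mul, norm_zetaCoFactor_half t (by linarith), one_mul,
    Complex.norm_exp]
  calc Real.exp (G s).re ≤ Real.exp (8512 * Real.log t) := by
        apply Real.exp_le_exp.mpr
        refine (Complex.re_le_norm _).trans (hGs.trans ?_)
        nlinarith
    _ = t ^ 8512 := by
        rw [mul_comm, Real.exp_mul, Real.exp_log (by linarith)]
        exact_mod_cast Real.rpow_natCast t 8512

/-- The fractional part on `(1, ∞)`, extended by zero. -/
def fractTail : ℝ → ℂ := Set.indicator (Set.Ioi 1) fun u => ((Int.fract u : ℝ) : ℂ)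

theorem norm_fractTail_le (u : ℝ) : ‖fractTail u‖ ≤ 1 := by
  unfold fractTail
  by_cases h : u ∈ Set.Ioi (1:ℝ)
  · rw [Set.indicator_of_mem h, Complex.norm_real, Real.norm_eq_abs, abs_of_nonneg (Int.fract_nonneg u)]
    exact (Int.fract_lt_one u).le
  · rw [Set.indicator_of_notMem h]
    simp

theorem measurable_fractTail : Measurable fractTail := by
  unfold fractTail
  apply Measurable.indicator _ measurableSet_Ioi
  exact Complex.measurable_ofReal.comp measurable_fract

theorem differentiableAt_mellin_fractTail {s : ℂ} (hs : s.re < 0) :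
    DifferentiableAt ℂ (mellin fractTail) s := by
  apply mellin_differentiableAt_of_isBigO_rpow (a := 0) (b := s.re - 1)
  · apply MeasureTheory.LocallyIntegrable.locallyIntegrableOn
    apply MeasureTheory.LocallyIntegrable.mono (g := fractTail)
      (f := fun _ : ℝ => (1:ℝ)) (MeasureTheory.locallyIntegrable_const 1)
      measurable_fractTail.aestronglyMeasurable
    filter_upwards with u
    simpa using norm_fractTail_le u
  · apply Asymptotics.IsBigO.of_bound 1
    filter_upwards with u
    simpa using norm_fractTail_le u
  · exact hs
  · apply Filter.EventuallyEq.trans_isBigO (f₂ := fun _ => 0)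
    · filter_upwards [Ioo_mem_nhdsGT (show (0:ℝ) < 1 by norm_num)] with u hu
      apply Set.indicator_of_notMem
      simpa using hu.2.le
    · exact Asymptotics.isBigO_zero _ _
  · linarith

theorem mellin_fractTail_eq (s : ℂ) :
    mellin fractTail (-s) =
      ∫ u in Set.Ioi (1:ℝ), (u:ℂ) ^ (-(s + 1)) * ((Int.fract u : ℝ) : ℂ) := by
  have h : ∀ u : ℝ, (u:ℂ) ^ (-s - 1) • fractTail u =
      Set.indicator (Set.Ioi 1) (fun u : ℝ => (u:ℂ) ^ (-(s + 1)) * ((Int.fract u : ℝ) : ℂ)) u := by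
    intro u
    unfold fractTail
    by_cases h : u ∈ Set.Ioi (1:ℝ)
    · rw [Set.indicator_of_mem h, Set.indicator_of_mem h, smul_eq_mul]
      congr 2
      ring
    · rw [Set.indicator_of_notMem h, Set.indicator_of_notMem h, smul_zero]
  rw [mellin]
  simp_rw [h]
  rw [MeasureTheory.setIntegral_indicator measurableSet_Ioi,
    Set.inter_eq_right.mpr (Set.Ioi_subset_Ioi zero_le_one)]

theorem norm_mellin_fractTail_le {s : ℂ} (hs : 0 < s.re) :
    ‖mellin fractTail (-s)‖ ≤ 1 / s.re := by
  rw [mellin_fractTail_eq]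
  have h_int : MeasureTheory.IntegrableOn (fun u : ℝ => u ^ (-s.re - 1)) (Set.Ioi 1) :=
    integrableOn_Ioi_rpow_of_lt (by linarith) zero_lt_one
  have hval := integral_Ioi_rpow_of_lt (a := -s.re - 1) (by linarith) zero_lt_one
  refine (MeasureTheory.norm_integral_le_of_norm_le h_int ?_).trans (le_of_eq ?_)
  · rw [MeasureTheory.ae_restrict_iff' measurableSet_Ioi]
    filter_upwards with u hu
    have hu0 : (0:ℝ) < u := zero_lt_one.trans hu
    rw [norm_mul, Complex.norm_cpow_eq_rpow_re_of_pos hu0, Complex.norm_real, Real.norm_eq_abs,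
      abs_of_nonneg (Int.fract_nonneg u)]
    have : (-(s + 1)).re = -s.re - 1 := by simp; ring
    rw [this]
    exact mul_le_of_le_one_right (Real.rpow_nonneg hu0.le _) (Int.fract_lt_one u).le
  · rw [hval]
    simp

theorem riemannZeta_eq_mellin_of_one_lt {s : ℂ} (hs : 1 < s.re) :
    riemannZeta s = s / (s - 1) - s * mellin fractTail (-s) := by
  have hsum : LSeriesSummable 1 s := LSeriesSummable_one_iff.mpr hs
  have h := LSeries_eq_mul_integral (f := 1) (r := 1) zero_le_one hs hsum (by
    apply Asymptotics.IsBigO.of_bound 1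
    filter_upwards with n
    simp)
  rw [LSeries_one_eq_riemannZeta hs] at h
  rw [h, mellin_fractTail_eq]
  have hI1 : MeasureTheory.IntegrableOn (fun u : ℝ => (u:ℂ) ^ (-s)) (Set.Ioi 1) :=
    integrableOn_Ioi_cpow_of_lt (by simpa using hs) zero_lt_one
  have hI2 : MeasureTheory.IntegrableOn
      (fun u : ℝ => (u:ℂ) ^ (-(s + 1)) * ((Int.fract u : ℝ) : ℂ)) (Set.Ioi 1) := by
    have hJ : MeasureTheory.IntegrableOn (fun u : ℝ => (u:ℂ) ^ (-(s + 1))) (Set.Ioi 1) :=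
      integrableOn_Ioi_cpow_of_lt (by simp; linarith) zero_lt_one
    apply MeasureTheory.Integrable.mono hJ
    · exact hJ.aestronglyMeasurable.mul
        (Complex.measurable_ofReal.comp measurable_fract).aestronglyMeasurable
    · filter_upwards with u
      rw [norm_mul, Complex.norm_real, Real.norm_eq_abs, abs_of_nonneg (Int.fract_nonneg u)]
      exact mul_le_of_le_one_right (norm_nonneg _) (Int.fract_lt_one u).le
  have hcong : ∫ u in Set.Ioi (1:ℝ), (∑ k ∈ Finset.Icc 1 ⌊u⌋₊, (1 : ℕ → ℂ) k) * (u:ℂ) ^ (-(s + 1)) =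
      (∫ u in Set.Ioi (1:ℝ), (u:ℂ) ^ (-s)) -
      ∫ u in Set.Ioi (1:ℝ), (u:ℂ) ^ (-(s + 1)) * ((Int.fract u : ℝ) : ℂ) := by
    rw [← MeasureTheory.integral_sub hI1 hI2]
    apply MeasureTheory.setIntegral_congr_fun measurableSet_Ioi
    intro u hu
    have hu0 : (0:ℝ) < u := zero_lt_one.trans hu
    have hu1 : (u:ℂ) ≠ 0 := by exact_mod_cast hu0.ne'
    have h1 : (u:ℂ) ^ (-s) = (u:ℂ) ^ (-(s + 1)) * u := by
      nth_rw 3 [← Complex.cpow_one (u:ℂ)]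
      rw [← Complex.cpow_add _ _ hu1]
      congr 1
      ring
    have h2 : ((Int.fract u : ℝ) : ℂ) = u - ⌊u⌋₊ := by
      have : Int.fract u = u - ⌊u⌋₊ := by
        rw [natCast_floor_eq_intCast_floor hu0.le]
        rfl
      rw [this]
      push_cast
      rfl
    simp only [h1, h2]
    simp
    ring
  rw [hcong, integral_Ioi_cpow_of_lt (by simpa using hs) zero_lt_one]
  have : s - 1 ≠ 0 := by
    intro h0
    have : s = 1 := by linear_combination h0
    rw [this] at hs
    simp at hs
  have h3 : -s + 1 ≠ 0 := by
    intro h0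
    apply this
    linear_combination -h0
  simp
  rw [mul_sub]
  congr 1
  have h4 : (-s + 1) = -(s - 1) := by ring
  rw [h4, neg_div_neg_eq, mul_one_div]

theorem riemannZeta_eq_mellin {s : ℂ} (hs : 0 < s.re) (hi : 0 < s.im) :
    riemannZeta s = s / (s - 1) - s * mellin fractTail (-s) := by
  set U : Set ℂ := {z | 0 < z.re} ∩ {z | 0 < z.im} with hU
  have hUo : IsOpen U := (isOpen_lt continuous_const Complex.continuous_re).inter
    (isOpen_lt continuous_const Complex.continuous_im)
  have hUc : Convex ℝ U := (convex_halfSpace_re_gt 0).inter (convex_halfSpace_im_gt 0)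
  have hne : ∀ z ∈ U, z ≠ 1 := by
    rintro z hz rfl
    simp [hU] at hz
  have h1 : AnalyticOnNhd ℂ riemannZeta U := by
    apply DifferentiableOn.analyticOnNhd _ hUo
    intro z hz
    exact (differentiableAt_riemannZeta (hne z hz)).differentiableWithinAt
  have h2 : AnalyticOnNhd ℂ (fun s => s / (s - 1) - s * mellin fractTail (-s)) U := by
    apply DifferentiableOn.analyticOnNhd _ hUo
    intro z hz
    have hz1 : z - 1 ≠ 0 := sub_ne_zero.mpr (hne z hz)
    have h3 : DifferentiableAt ℂ (fun s => mellin fractTail (-s)) z := by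
      have h4 : DifferentiableAt ℂ (mellin fractTail) (-z) :=
        differentiableAt_mellin_fractTail (by simpa using hz.1)
      exact h4.comp z (by fun_prop)
    apply DifferentiableAt.differentiableWithinAt
    have h5 : DifferentiableAt ℂ (fun s : ℂ => s / (s - 1)) z := by fun_prop (disch := assumption)
    fun_prop
  have hz0 : (2 + Complex.I : ℂ) ∈ U := by simp [hU]
  apply h1.eqOn_of_preconnected_of_eventuallyEq h2 hUc.isPreconnected hz0 _ ⟨hs, hi⟩
  have : {z : ℂ | 1 < z.re} ∈ nhds (2 + Complex.I : ℂ) :=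
    (isOpen_lt continuous_const Complex.continuous_re).mem_nhds (by simp)
  filter_upwards [this] with z hz
  exact riemannZeta_eq_mellin_of_one_lt hz

theorem norm_riemannZeta_le_of_half_le {s : ℂ} (hs : 1 / 2 ≤ s.re) (hi : 1 ≤ s.im) :
    ‖riemannZeta s‖ ≤ 3 * ‖s‖ := by
  rw [riemannZeta_eq_mellin (by linarith) (by linarith)]
  have h1 : 1 ≤ ‖s - 1‖ := by
    refine le_trans ?_ (Complex.abs_im_le_norm _)
    simp
    exact hi.trans (le_abs_self _)
  have h2 : ‖mellin fractTail (-s)‖ ≤ 2 := by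
    refine (norm_mellin_fractTail_le (by linarith)).trans ?_
    rw [div_le_iff₀ (by linarith)]
    linarith
  calc _ ≤ ‖s / (s - 1)‖ + ‖s * mellin fractTail (-s)‖ := norm_sub_le _ _
    _ = ‖s‖ / ‖s - 1‖ + ‖s‖ * ‖mellin fractTail (-s)‖ := by rw [norm_div, norm_mul]
    _ ≤ ‖s‖ + ‖s‖ * 2 := by
      gcongr
      exact div_le_self (norm_nonneg _) h1
    _ = _ := by ring

theorem norm_riemannZeta_conj (s : ℂ) : ‖riemannZeta ((starRingEnd ℂ) s)‖ = ‖riemannZeta s‖ := by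
  rw [riemannZeta_conj, Complex.norm_conj]

/-- Polynomial growth of `ζ` in vertical strips. -/
theorem norm_riemannZeta_le_pow {s : ℂ} (hs : 700 ≤ s.im) (h1 : |s.re - 1 / 2| ≤ 38) :
    ‖riemannZeta s‖ ≤ s.im ^ 8514 := by
  have key : ∀ z : ℂ, z.im = s.im → 1 / 2 ≤ z.re → |z.re - 1 / 2| ≤ 38 →
      ‖riemannZeta z‖ ≤ s.im ^ 2 := by
    intro z hz hz1 hz2
    have h2 := Complex.norm_le_abs_re_add_abs_im z
    have h3 : |z.re| ≤ 39 := by rw [abs_le] at *; constructor <;> linarith [hz2.1, hz2.2]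
    rw [hz, abs_of_pos (show 0 < s.im by linarith)] at h2
    refine (norm_riemannZeta_le_of_half_le hz1 (by linarith)).trans ?_
    nlinarith
  have hp : (1:ℝ) ≤ s.im := by linarith
  rcases le_total (1 / 2) s.re with h | h
  · refine (key s rfl h h1).trans ?_
    exact pow_le_pow_right₀ hp (by norm_num)
  · rw [riemannZeta_eq_zetaCoFactor_mul (by linarith), norm_mul, ← norm_riemannZeta_conj (1 - s)]
    have h2 := key ((starRingEnd ℂ) (1 - s)) (by simp) (by simp; linarith) (by
      rw [← abs_neg]
      convert h1 using 2
      simp; ring)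
    calc _ ≤ s.im ^ 8512 * s.im ^ 2 := by
          apply mul_le_mul (norm_zetaCoFactor_le hs h1) h2 (norm_nonneg _) (by positivity)
      _ = _ := by rw [← pow_add]

theorem one_third_le_norm_riemannZeta {s : ℂ} (hs : s.re = 2) : 1 / 3 ≤ ‖riemannZeta s‖ := by
  have h := zeta_eq_tsum_one_div_nat_add_one_cpow (s := s) (by linarith)
  have hz := hasSum_zeta_two
  have hn : ∀ n : ℕ, ‖1 / ((n:ℂ) + 1) ^ s‖ = 1 / ((n + 1 : ℕ) : ℝ) ^ 2 := by
    intro n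
    have : ((n:ℂ) + 1) = (((n + 1 : ℕ) : ℝ) : ℂ) := by push_cast; rfl
    rw [norm_div, this, Complex.norm_cpow_eq_rpow_re_of_pos (by positivity), hs]
    simp
  have hz1 := (hasSum_nat_add_iff' 1).mpr hz
  simp only [Finset.range_one, Finset.sum_singleton] at hz1
  have hz2 := (hasSum_nat_add_iff' 1).mpr hz1
  have hsum : Summable fun n : ℕ => 1 / ((n:ℂ) + 1) ^ s := by
    apply Summable.of_norm
    simp_rw [hn]
    exact hz1.summable
  rw [hsum.tsum_eq_zero_add] at h
  have h1 : ‖∑' n : ℕ, 1 / (((n + 1 : ℕ) : ℂ) + 1) ^ s‖ ≤ Real.pi ^ 2 / 6 - 1 := by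
    apply tsum_of_norm_bounded (f := _) (g := fun n : ℕ => 1 / ((n + 1 + 1 : ℕ) : ℝ) ^ 2)
    · have he : Real.pi ^ 2 / 6 - 1 / ((0:ℕ):ℝ) ^ 2 -
          ∑ i ∈ Finset.range 1, 1 / ((i + 1 : ℕ) : ℝ) ^ 2 = Real.pi ^ 2 / 6 - 1 := by
        norm_num
      rw [he] at hz2
      exact hz2
    · intro n
      exact (hn (n + 1)).le
  have h2 : (1:ℂ) = riemannZeta s - ∑' n : ℕ, 1 / (((n + 1 : ℕ) : ℂ) + 1) ^ s := by
    rw [h]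
    simp
  have h3 : (1:ℝ) ≤ ‖riemannZeta s‖ + (Real.pi ^ 2 / 6 - 1) := by
    calc (1:ℝ) = ‖(1:ℂ)‖ := by simp
      _ ≤ _ := by
        rw [h2]
        exact (norm_sub_le _ _).trans (by gcongr)
  have h4 : Real.pi ^ 2 ≤ 3.15 ^ 2 := by
    have := Real.pi_lt_d2
    have := Real.pi_pos
    gcongr
  norm_num at h4
  linarith

theorem term_vonMangoldt_eq (s : ℂ) (n : ℕ) :
    LSeries.term (fun n => (ArithmeticFunction.vonMangoldt n : ℂ)) s n =
      (ArithmeticFunction.vonMangoldt n : ℂ) * (n:ℂ) ^ (-s) := by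
  rcases eq_or_ne n 0 with rfl | hn
  · simp
  · rw [LSeries.term_of_ne_zero hn, Complex.cpow_neg, div_eq_mul_inv]

theorem hasSum_vonMangoldt {s : ℂ} (hs : 1 < s.re) :
    HasSum (fun n : ℕ => (ArithmeticFunction.vonMangoldt n : ℂ) * (n:ℂ) ^ (-s))
      (-logDeriv riemannZeta s) := by
  have h1 := (ArithmeticFunction.LSeriesSummable_vonMangoldt hs).hasSum
  have h2 := ArithmeticFunction.LSeries_vonMangoldt_eq_deriv_riemannZeta_div hs
  rw [LSeries] at h2
  rw [h2] at h1
  rw [logDeriv_apply, ← neg_div]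
  convert h1 using 1
  funext n
  exact (term_vonMangoldt_eq s n).symm

theorem hasSum_vonMangoldt_real {c : ℝ} (hc : 1 < c) :
    HasSum (fun n : ℕ => ArithmeticFunction.vonMangoldt n * (n:ℝ) ^ (-c))
      (-logDeriv riemannZeta c).re := by
  have h := Complex.hasSum_re (hasSum_vonMangoldt (s := c) (by simpa using hc))
  convert h using 1
  funext n
  have : (n:ℂ) ^ (-c : ℂ) = (((n:ℝ) ^ (-c) : ℝ) : ℂ) := by
    rw [Complex.ofReal_cpow (Nat.cast_nonneg n)]
    push_cast
    rfl
  rw [this, ← Complex.ofReal_mul, Complex.ofReal_re]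

/-- The Dirichlet series of `Λ` near the pole of `ζ`. -/
theorem exists_tsum_vonMangoldt_le : ∃ C : ℝ, 0 < C ∧ ∀ c : ℝ, 1 < c → c ≤ 2 →
    ∑' n : ℕ, ArithmeticFunction.vonMangoldt n * (n:ℝ) ^ (-c) ≤ C / (c - 1) := by
  have h0 : ∀ c : ℝ, 1 ≤ c → riemannZeta₁ c ≠ 0 := by
    intro c hc h
    rcases hc.eq_or_lt with rfl | hc
    · simp at h
    · have h1 : (c:ℂ) ≠ 1 := by exact_mod_cast hc.ne'
      apply riemannZeta_ne_zero_of_one_le_re (s := c) (by simpa using hc.le)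
      rw [riemannZeta_eq_inv_sub_mul h1, h, mul_zero]
  have hcont : ContinuousOn (fun c : ℝ => deriv riemannZeta₁ c / riemannZeta₁ c) (Set.Icc 1 2) := by
    have h1 : Continuous riemannZeta₁ := differentiable_riemannZeta₁.continuous
    have h2 : Continuous (deriv riemannZeta₁) := differentiable_riemannZeta₁.deriv.continuous
    apply ContinuousOn.div
    · exact (h2.comp Complex.continuous_ofReal).continuousOn
    · exact (h1.comp Complex.continuous_ofReal).continuousOn
    · intro c hc
      exact h0 c hc.1
  obtain ⟨B, hB⟩ := isCompact_Icc.exists_bound_of_continuousOn hcont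
  refine ⟨1 + |B|, by positivity, ?_⟩
  intro c hc hc2
  rw [(hasSum_vonMangoldt_real hc).tsum_eq]
  have h1 : (c:ℂ) ≠ 1 := by exact_mod_cast hc.ne'
  have h2 : (c:ℂ) - 1 ≠ 0 := sub_ne_zero.mpr h1
  have h3 := h0 c hc.le
  have h4 : -logDeriv riemannZeta c = ((c - 1 : ℝ) : ℂ)⁻¹ -
      deriv riemannZeta₁ c / riemannZeta₁ c := by
    rw [logDeriv_apply, deriv_riemannZeta_eq_neg_inv_sub_sq_mul_add h1,
      riemannZeta_eq_inv_sub_mul h1]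
    push_cast
    field_simp
    ring
  rw [h4]
  have hc1 : 0 < c - 1 := by linarith
  calc _ ≤ ‖((c - 1 : ℝ) : ℂ)⁻¹ - deriv riemannZeta₁ c / riemannZeta₁ c‖ := Complex.re_le_norm _
    _ ≤ ‖((c - 1 : ℝ) : ℂ)⁻¹‖ + ‖deriv riemannZeta₁ c / riemannZeta₁ c‖ := norm_sub_le _ _
    _ ≤ 1 / (c - 1) + |B| := by
      gcongr
      · rw [norm_inv, Complex.norm_real, Real.norm_eq_abs, abs_of_pos hc1, one_div]
      · exact (hB c ⟨hc.le, hc2⟩).trans (le_abs_self B)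
    _ ≤ (1 + |B|) / (c - 1) := by
      rw [add_div]
      gcongr
      rw [le_div_iff₀ hc1]
      have := abs_nonneg B
      nlinarith

/-- Dividing out finitely many zeros of a holomorphic function. -/
theorem exists_eq_prod_pow_mul {f : ℂ → ℂ} {U : Set ℂ} (hU : IsOpen U)
    (hf : DifferentiableOn ℂ f U) (Z : Finset ℂ) (hZ : ∀ ρ ∈ Z, ρ ∈ U) (m : ℂ → ℕ)
    (hm : ∀ ρ ∈ Z, analyticOrderAt f ρ = m ρ) :
    ∃ g : ℂ → ℂ, DifferentiableOn ℂ g U ∧ (∀ ρ ∈ Z, g ρ ≠ 0) ∧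
      ∀ z ∈ U, f z = (∏ ρ ∈ Z, (z - ρ) ^ m ρ) * g z := by
  classical
  have hloc : ∀ ρ ∈ Z, ∃ g : ℂ → ℂ, AnalyticAt ℂ g ρ ∧ g ρ ≠ 0 ∧
      ∀ᶠ z in nhds ρ, f z = (z - ρ) ^ m ρ • g z := by
    intro ρ hρ
    have han : AnalyticAt ℂ f ρ := hf.analyticAt (hU.mem_nhds (hZ ρ hρ))
    exact han.analyticOrderAt_eq_natCast.mp (hm ρ hρ)
  choose! g₀ hg₀ using hloc
  set P : Finset ℂ → ℂ → ℂ := fun S z => ∏ ρ ∈ S, (z - ρ) ^ m ρ with hP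
  have hPne : ∀ S : Finset ℂ, ∀ z, z ∉ S → P S z ≠ 0 := by
    intro S z hz
    apply Finset.prod_ne_zero_iff.mpr
    intro ρ hρ
    apply pow_ne_zero
    apply sub_ne_zero.mpr
    rintro rfl
    exact hz hρ
  have hPd : ∀ S : Finset ℂ, Differentiable ℂ (P S) := by
    intro S
    simp only [hP]
    fun_prop
  set g : ℂ → ℂ := fun z => if z ∈ Z then g₀ z z / P (Z.erase z) z else f z / P Z z with hg
  have hgat : ∀ ρ ∈ Z, g =ᶠ[nhds ρ] fun z => g₀ ρ z / P (Z.erase ρ) z := by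
    intro ρ hρ
    have h1 : (((Z.erase ρ : Finset ℂ) : Set ℂ))ᶜ ∈ nhds ρ :=
      (Z.erase ρ).finite_toSet.isClosed.isOpen_compl.mem_nhds (by simp)
    filter_upwards [(hg₀ ρ hρ).2.2, h1] with z hz hz1
    by_cases hzρ : z = ρ
    · rw [hg]
      simp only
      rw [if_pos (hzρ ▸ hρ), hzρ]
    · have hzZ : z ∉ Z := by
        intro h
        exact hz1 (by simp [hzρ, h])
      rw [hg]
      simp only
      rw [if_neg hzZ, hz]
      have h2 : P Z z = (z - ρ) ^ m ρ * P (Z.erase ρ) z := by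
        simp only [hP]
        exact (Finset.mul_prod_erase Z (fun ρ => (z - ρ) ^ m ρ) hρ).symm
      rw [h2, smul_eq_mul, mul_div_mul_left]
      exact pow_ne_zero _ (sub_ne_zero.mpr hzρ)
  refine ⟨g, ?_, ?_, ?_⟩
  · intro z hz
    apply DifferentiableAt.differentiableWithinAt
    by_cases hzZ : z ∈ Z
    · apply DifferentiableAt.congr_of_eventuallyEq _ (hgat z hzZ)
      exact (hg₀ z hzZ).1.differentiableAt.div (hPd _ z) (hPne _ _ (by simp))
    · have h1 : ((Z : Set ℂ))ᶜ ∈ nhds z :=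
        Z.finite_toSet.isClosed.isOpen_compl.mem_nhds (by simpa using hzZ)
      have h2 : g =ᶠ[nhds z] fun z => f z / P Z z := by
        filter_upwards [h1] with w hw
        rw [hg]
        simp only
        rw [if_neg (by simpa using hw)]
      apply DifferentiableAt.congr_of_eventuallyEq _ h2
      exact (hf.differentiableAt (hU.mem_nhds hz)).div (hPd _ z) (hPne _ _ hzZ)
  · intro ρ hρ
    simp only [hg, if_pos hρ]
    exact div_ne_zero (hg₀ ρ hρ).2.1 (hPne _ _ (by simp))
  · intro z hz
    by_cases hzZ : z ∈ Z
    · have h3 := ((hg₀ z hzZ).2.2).self_of_nhds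
      have h2 : P Z z = (z - z) ^ m z * P (Z.erase z) z := by
        simp only [hP]
        exact (Finset.mul_prod_erase Z (fun ρ => (z - ρ) ^ m ρ) hzZ).symm
      change f z = P Z z * g z
      rw [h3, h2]
      simp only [hg, if_pos hzZ, smul_eq_mul]
      have := hPne (Z.erase z) z (by simp)
      field_simp
    · change f z = P Z z * g z
      simp only [hg, if_neg hzZ]
      have := hPne Z z hzZ
      field_simp

theorem logDeriv_eq_sum_add {f g : ℂ → ℂ} {U : Set ℂ} (hU : IsOpen U)
    (hg : DifferentiableOn ℂ g U) (Z : Finset ℂ) (m : ℂ → ℕ)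
    (hfg : ∀ z ∈ U, f z = (∏ ρ ∈ Z, (z - ρ) ^ m ρ) * g z) {z : ℂ} (hz : z ∈ U) (hzZ : z ∉ Z)
    (hgz : g z ≠ 0) :
    logDeriv f z = (∑ ρ ∈ Z, (m ρ : ℂ) / (z - ρ)) + logDeriv g z := by
  have hne : ∀ ρ ∈ Z, z - ρ ≠ 0 := by
    intro ρ hρ
    apply sub_ne_zero.mpr
    rintro rfl
    exact hzZ hρ
  have h1 : logDeriv f z = logDeriv (fun z => (∏ ρ ∈ Z, (z - ρ) ^ m ρ) * g z) z := by
    have : f =ᶠ[nhds z] fun z => (∏ ρ ∈ Z, (z - ρ) ^ m ρ) * g z := by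
      filter_upwards [hU.mem_nhds hz] with w hw using hfg w hw
    rw [logDeriv_apply, logDeriv_apply, this.deriv_eq, this.self_of_nhds]
  rw [h1, logDeriv_mul]
  · congr 1
    rw [logDeriv_prod]
    · apply Finset.sum_congr rfl
      intro ρ hρ
      have : logDeriv (fun z : ℂ => (z - ρ) ^ m ρ) z = m ρ * logDeriv (fun z : ℂ => z - ρ) z :=
        logDeriv_fun_pow (by fun_prop) _
      rw [this, logDeriv_apply]
      simp [div_eq_mul_inv]
    · intro ρ hρ
      exact pow_ne_zero _ (hne ρ hρ)
    · intro ρ hρ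
      fun_prop
  · exact Finset.prod_ne_zero_iff.mpr fun ρ hρ => pow_ne_zero _ (hne ρ hρ)
  · exact hgz
  · fun_prop
  · exact hg.differentiableAt (hU.mem_nhds hz)

theorem analyticAt_riemannZeta {s : ℂ} (hs : s ≠ 1) : AnalyticAt ℂ riemannZeta s := by
  have : DifferentiableOn ℂ riemannZeta {1}ᶜ := fun z hz =>
    (differentiableAt_riemannZeta hz).differentiableWithinAt
  exact this.analyticAt (isOpen_compl_singleton.mem_nhds hs)

theorem analyticOrderAt_riemannZeta {ρ : ℂ} (hρ : ρ ≠ 1) :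
    analyticOrderAt riemannZeta ρ = zetaZeroOrder ρ := by
  have han := analyticAt_riemannZeta hρ
  have hfin : analyticOrderAt riemannZeta ρ ≠ ⊤ := by
    intro h
    rw [analyticOrderAt_eq_top] at h
    have hK : IsCompact (Metric.closedBall ρ 1) := isCompact_closedBall ρ 1
    have hf := IsCompact.inter_riemannZetaZeros_finite hK
    have hmem : Metric.closedBall ρ 1 ∩ riemannZetaZeros ∈ nhds ρ := by
      filter_upwards [h, Metric.closedBall_mem_nhds ρ one_pos] with z hz hz1
      exact ⟨hz1, mem_riemannZetaZeros.mpr hz⟩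
    exact (infinite_of_mem_nhds ρ hmem) hf
  obtain ⟨n, hn⟩ := ENat.ne_top_iff_exists.mp hfin
  rw [← hn]
  have h1 := (analyticOrderAt_eq_nat_iff_iteratedDeriv_eq_zero han).mp hn.symm
  congr 1
  rw [zetaZeroOrder]
  symm
  apply le_antisymm
  · exact Nat.sInf_le h1.2
  · apply le_csInf ⟨n, h1.2⟩
    intro k hk
    by_contra hlt
    exact hk (h1.1 k (by omega))

theorem finite_riemannZeta_zeros {S : Set ℂ} {K : Set ℂ} (hK : IsCompact K) (hS : S ⊆ K)
    (hz : ∀ z ∈ S, riemannZeta z = 0) : S.Finite :=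
  (IsCompact.inter_riemannZetaZeros_finite hK).subset
    fun z hz' => ⟨hS hz', mem_riemannZetaZeros.mpr (hz z hz')⟩

theorem zetaZeros_near {T : ℝ} (hT : 800 ≤ T) :
    ∃ Z : Finset ℂ, (∀ ρ ∈ Z, riemannZeta ρ = 0 ∧ ‖ρ - (2 + T * Complex.I)‖ ≤ 12) ∧
      (∑ ρ ∈ Z, (zetaZeroOrder ρ : ℝ)) ≤ 34060 * Real.log T ∧
      ∀ z : ℂ, ‖z - (2 + T * Complex.I)‖ ≤ 3 → riemannZeta z ≠ 0 →
        ‖logDeriv riemannZeta z - ∑ ρ ∈ Z, (zetaZeroOrder ρ : ℂ) / (z - ρ)‖ ≤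
          34060 * Real.log T := by
  set c : ℂ := 2 + T * Complex.I with hc
  set S : Set ℂ := Metric.closedBall c 12 ∩ {z | riemannZeta z = 0} with hS
  have hSfin : S.Finite := finite_riemannZeta_zeros (isCompact_closedBall c 12)
    Set.inter_subset_left (fun z hz => hz.2)
  set Z := hSfin.toFinset with hZdef
  have hZmem : ∀ z, z ∈ Z ↔ ‖z - c‖ ≤ 12 ∧ riemannZeta z = 0 := by
    intro z
    rw [hZdef, Set.Finite.mem_toFinset, hS]
    simp [dist_eq_norm]
  set U : Set ℂ := Metric.ball c (36 + 1 / 4) with hUdef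
  have hU1 : ∀ z : ℂ, ‖z - c‖ < 36 + 1 / 4 → 700 ≤ z.im ∧ z.im ≤ 2 * T ∧ -35 ≤ z.re := by
    intro z hz
    have h1 := (Complex.abs_re_le_norm _).trans hz.le
    have h2 := (Complex.abs_im_le_norm _).trans hz.le
    rw [abs_le] at h1 h2
    simp [hc] at h1 h2
    refine ⟨?_, ?_, ?_⟩ <;> linarith
  have hUne : ∀ z : ℂ, ‖z - c‖ < 36 + 1 / 4 → z ≠ 1 := by
    rintro z hz rfl
    have := (hU1 1 hz).1
    norm_num at this
  obtain ⟨g, hgd, hgZ, hfg⟩ := exists_eq_prod_pow_mul (f := riemannZeta) (U := U)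
    Metric.isOpen_ball
    (fun z hz => (differentiableAt_riemannZeta
      (hUne z (by simpa [hUdef, dist_eq_norm] using hz))).differentiableWithinAt) Z
    (fun ρ hρ => by
      rw [hUdef, Metric.mem_ball, dist_eq_norm]
      linarith [((hZmem ρ).mp hρ).1]) zetaZeroOrder
    (fun ρ hρ => analyticOrderAt_riemannZeta (hUne ρ (by linarith [((hZmem ρ).mp hρ).1])))
  have hmemU : ∀ z : ℂ, ‖z - c‖ < 36 + 1 / 4 → z ∈ U := fun z hz => by
    rwa [hUdef, Metric.mem_ball, dist_eq_norm]
  have hg0 : ∀ z : ℂ, ‖z - c‖ ≤ 12 → g z ≠ 0 := by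
    intro z hz h0
    by_cases hzZ : z ∈ Z
    · exact hgZ z hzZ h0
    · apply hzZ
      rw [hZmem]
      refine ⟨hz, ?_⟩
      rw [hfg z (hmemU z (by linarith)), h0, mul_zero]
  set N : ℕ := ∑ ρ ∈ Z, zetaZeroOrder ρ with hN
  set B : ℝ := (2 * T) ^ 8514 with hB
  have hBpos : 0 < B := by positivity
  have hprod : ∀ z : ℂ, ‖∏ ρ ∈ Z, (z - ρ) ^ zetaZeroOrder ρ‖ =
      ∏ ρ ∈ Z, ‖z - ρ‖ ^ zetaZeroOrder ρ := by
    intro z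
    rw [norm_prod]
    simp_rw [norm_pow]
  have hsphere : ∀ z : ℂ, ‖z - c‖ = 36 → ‖g z‖ ≤ B / 24 ^ N := by
    intro z hz
    have h1 := hU1 z (by linarith)
    have h2 : ‖riemannZeta z‖ ≤ B := by
      have h3 := (Complex.abs_re_le_norm _).trans hz.le
      rw [abs_le] at h3
      simp [hc] at h3
      refine (norm_riemannZeta_le_pow h1.1 (by rw [abs_le]; constructor <;> linarith)).trans ?_
      rw [hB]
      exact pow_le_pow_left₀ (by linarith) h1.2.1 _
    rw [hfg z (hmemU z (by linarith)), norm_mul, hprod] at h2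
    rw [le_div_iff₀ (by positivity), mul_comm]
    refine le_trans ?_ h2
    gcongr
    rw [hN, ← Finset.prod_pow_eq_pow_sum]
    apply Finset.prod_le_prod
    · intro ρ hρ; positivity
    · intro ρ hρ
      gcongr
      have h4 := ((hZmem ρ).mp hρ).1
      have h5 : ‖z - c‖ ≤ ‖z - ρ‖ + ‖ρ - c‖ := by
        have := norm_add_le (z - ρ) (ρ - c)
        simpa using this
      linarith
  have hball : ∀ z : ℂ, ‖z - c‖ ≤ 36 → ‖g z‖ ≤ B / 24 ^ N := by
    intro z hz
    have hd : DiffContOnCl ℂ g (Metric.ball c 36) := by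
      apply DifferentiableOn.diffContOnCl
      apply hgd.mono
      rw [closure_ball _ (by norm_num)]
      exact Metric.closedBall_subset_ball (by norm_num)
    apply Complex.norm_le_of_forall_mem_frontier_norm_le Metric.isBounded_ball hd
    · intro w hw
      rw [frontier_ball _ (by norm_num), mem_sphere_iff_norm] at hw
      exact hsphere w hw
    · rwa [closure_ball _ (by norm_num), Metric.mem_closedBall, dist_eq_norm]
  have hcc : 1 / 3 ≤ 12 ^ N * ‖g c‖ := by
    have h1 := one_third_le_norm_riemannZeta (s := c) (by simp [hc])
    rw [hfg c (hmemU c (by simp; norm_num)), norm_mul, hprod] at h1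
    refine h1.trans ?_
    gcongr
    rw [hN, ← Finset.prod_pow_eq_pow_sum]
    apply Finset.prod_le_prod
    · intro ρ hρ; positivity
    · intro ρ hρ
      gcongr
      rw [norm_sub_rev]
      exact ((hZmem ρ).mp hρ).1
  have hTlog : 0 < Real.log T := Real.log_pos (by linarith)
  have hM : 3 * B ≤ Real.exp (17030 * Real.log T) := by
    have : Real.exp (17030 * Real.log T) = T ^ 17030 := by
      rw [mul_comm, Real.exp_mul, Real.exp_log (by linarith)]
      exact_mod_cast Real.rpow_natCast T 17030
    rw [this]
    calc 3 * B ≤ T ^ 1 * (T ^ 2) ^ 8514 := by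
          rw [hB]
          gcongr
          · linarith
          · nlinarith
      _ = T ^ 17029 := by rw [← pow_mul, ← pow_add]
      _ ≤ T ^ 17030 := pow_le_pow_right₀ (by linarith) (by norm_num)
  have hpow : (2:ℝ) ^ N ≤ 3 * B := by
    have h1 := hball c (by simp)
    rw [le_div_iff₀ (by positivity)] at h1
    have h2 : (24:ℝ) ^ N = 2 ^ N * 12 ^ N := by rw [← mul_pow]; norm_num
    rw [h2] at h1
    have h3 : (0:ℝ) < 2 ^ N := by positivity
    clear_value B
    clear hB hM
    nlinarith
  refine ⟨Z, fun ρ hρ => ⟨((hZmem ρ).mp hρ).2, ((hZmem ρ).mp hρ).1⟩, ?_, ?_⟩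
  · have h1 := Real.log_le_log (by positivity) (hpow.trans hM)
    rw [Real.log_pow, Real.log_exp] at h1
    have h2 : (∑ ρ ∈ Z, (zetaZeroOrder ρ : ℝ)) = N := by rw [hN]; push_cast; rfl
    rw [h2]
    have h3 := Real.log_two_gt_d9
    have h4 : (0:ℝ) ≤ N := Nat.cast_nonneg N
    nlinarith
  · intro z hz hz0
    have hzZ : z ∉ Z := fun h => hz0 ((hZmem z).mp h).2
    rw [logDeriv_eq_sum_add (U := U) Metric.isOpen_ball hgd Z zetaZeroOrder hfg
      (hmemU z (by linarith)) hzZ (hg0 z (by linarith)), add_sub_cancel_left]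
    have hgb : ∀ w ∈ Metric.ball c 12, ‖g w‖ ≤ Real.exp (17030 * Real.log T) * ‖g c‖ := by
      intro w hw
      rw [Metric.mem_ball, dist_eq_norm] at hw
      have h1 := hball w (by linarith)
      have h2 : (12:ℝ) ^ N ≤ 24 ^ N := pow_le_pow_left₀ (by norm_num) (by norm_num) _
      have h3 : (0:ℝ) < 12 ^ N := by positivity
      calc ‖g w‖ ≤ B / 24 ^ N := h1
        _ ≤ B / 12 ^ N := by gcongr
        _ ≤ 3 * B * ‖g c‖ := by
          rw [div_le_iff₀ h3]
          clear_value B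
          clear hB hM hpow
          nlinarith
        _ ≤ _ := by gcongr
    have := norm_logDeriv_le (f := g) (c := c) (R := 12) (M := 17030 * Real.log T)
      (by norm_num) (by positivity)
      (hgd.mono (Metric.ball_subset_ball (by norm_num)))
      (fun w hw => hg0 w (by
        rw [Metric.mem_ball, dist_eq_norm] at hw
        exact hw.le)) hgb (z := z) (by linarith)
    refine this.trans ?_
    linarith

/-- The integral of `f` along the boundary of the rectangle `[a, b] × [y₁, y₂]`. -/
def rectIntegral (f : ℂ → ℂ) (a b y₁ y₂ : ℝ) : ℂ :=
  (∫ x in a..b, f (x + y₁ * Complex.I)) - (∫ x in a..b, f (x + y₂ * Complex.I)) +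
    Complex.I * (∫ y in y₁..y₂, f (b + y * Complex.I)) -
    Complex.I * (∫ y in y₁..y₂, f (a + y * Complex.I))

/-- The boundary of the rectangle `[a, b] × [y₁, y₂]`. -/
def rectEdges (a b y₁ y₂ : ℝ) : Set ℂ :=
  {z | (a ≤ z.re ∧ z.re ≤ b ∧ y₁ ≤ z.im ∧ z.im ≤ y₂) ∧
    (z.re = a ∨ z.re = b ∨ z.im = y₁ ∨ z.im = y₂)}

theorem mem_rectEdges_horizontal {a b y₁ y₂ : ℝ} (hab : a ≤ b) (hy : y₁ ≤ y₂)
    {x : ℝ} (hx : x ∈ Set.uIcc a b) {y : ℝ} (h : y = y₁ ∨ y = y₂) :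
    (x + y * Complex.I : ℂ) ∈ rectEdges a b y₁ y₂ := by
  rw [Set.uIcc_of_le hab] at hx
  simp only [rectEdges, Set.mem_ofPred_eq]
  rcases h with rfl | rfl <;> simp [hx.1, hx.2, hy]

theorem mem_rectEdges_vertical {a b y₁ y₂ : ℝ} (hab : a ≤ b) (hy : y₁ ≤ y₂)
    {y : ℝ} (hx : y ∈ Set.uIcc y₁ y₂) {x : ℝ} (h : x = a ∨ x = b) :
    (x + y * Complex.I : ℂ) ∈ rectEdges a b y₁ y₂ := by
  rw [Set.uIcc_of_le hy] at hx
  simp only [rectEdges, Set.mem_ofPred_eq]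
  rcases h with rfl | rfl <;> simp [hx.1, hx.2, hab]

theorem intervalIntegrable_horizontal {a b y₁ y₂ : ℝ} (hab : a ≤ b) (hy : y₁ ≤ y₂)
    {f : ℂ → ℂ} (hf : ContinuousOn f (rectEdges a b y₁ y₂))
    {y : ℝ} (h : y = y₁ ∨ y = y₂) :
    IntervalIntegrable (fun x : ℝ => f (x + y * Complex.I)) MeasureTheory.volume a b := by
  apply ContinuousOn.intervalIntegrable
  exact hf.comp (by fun_prop) fun x hx => mem_rectEdges_horizontal hab hy hx h

theorem intervalIntegrable_vertical {a b y₁ y₂ : ℝ} (hab : a ≤ b) (hy : y₁ ≤ y₂)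
    {f : ℂ → ℂ} (hf : ContinuousOn f (rectEdges a b y₁ y₂))
    {x : ℝ} (h : x = a ∨ x = b) :
    IntervalIntegrable (fun y : ℝ => f (x + y * Complex.I)) MeasureTheory.volume y₁ y₂ := by
  apply ContinuousOn.intervalIntegrable
  exact hf.comp (by fun_prop) fun y hx => mem_rectEdges_vertical hab hy hx h

theorem rectIntegral_add {a b y₁ y₂ : ℝ} (hab : a ≤ b) (hy : y₁ ≤ y₂)
    {f g : ℂ → ℂ} (hf : ContinuousOn f (rectEdges a b y₁ y₂))
    (hg : ContinuousOn g (rectEdges a b y₁ y₂)) :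
    rectIntegral (fun z => f z + g z) a b y₁ y₂ =
      rectIntegral f a b y₁ y₂ + rectIntegral g a b y₁ y₂ := by
  unfold rectIntegral
  rw [intervalIntegral.integral_add (intervalIntegrable_horizontal hab hy hf (Or.inl rfl))
      (intervalIntegrable_horizontal hab hy hg (Or.inl rfl)),
    intervalIntegral.integral_add (intervalIntegrable_horizontal hab hy hf (Or.inr rfl))
      (intervalIntegrable_horizontal hab hy hg (Or.inr rfl)),
    intervalIntegral.integral_add (intervalIntegrable_vertical hab hy hf (Or.inl rfl))
      (intervalIntegrable_vertical hab hy hg (Or.inl rfl)),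
    intervalIntegral.integral_add (intervalIntegrable_vertical hab hy hf (Or.inr rfl))
      (intervalIntegrable_vertical hab hy hg (Or.inr rfl))]
  ring

theorem rectIntegral_congr {a b y₁ y₂ : ℝ} (hab : a ≤ b) (hy : y₁ ≤ y₂)
    {f g : ℂ → ℂ} (hfg : ∀ z ∈ rectEdges a b y₁ y₂, f z = g z) :
    rectIntegral f a b y₁ y₂ = rectIntegral g a b y₁ y₂ := by
  unfold rectIntegral
  rw [intervalIntegral.integral_congr (g := fun x : ℝ => g (x + y₁ * Complex.I))
      (fun x hx => hfg _ (mem_rectEdges_horizontal hab hy hx (Or.inl rfl))),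
    intervalIntegral.integral_congr (g := fun x : ℝ => g (x + y₂ * Complex.I))
      (fun x hx => hfg _ (mem_rectEdges_horizontal hab hy hx (Or.inr rfl))),
    intervalIntegral.integral_congr (g := fun y : ℝ => g (b + y * Complex.I))
      (fun x hx => hfg _ (mem_rectEdges_vertical hab hy hx (Or.inr rfl))),
    intervalIntegral.integral_congr (g := fun y : ℝ => g (a + y * Complex.I))
      (fun x hx => hfg _ (mem_rectEdges_vertical hab hy hx (Or.inl rfl)))]

theorem rectIntegral_sum {a b y₁ y₂ : ℝ} (hab : a ≤ b) (hy : y₁ ≤ y₂)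
    {ι : Type*} (s : Finset ι) {f : ι → ℂ → ℂ}
    (hf : ∀ i ∈ s, ContinuousOn (f i) (rectEdges a b y₁ y₂)) :
    rectIntegral (fun z => ∑ i ∈ s, f i z) a b y₁ y₂ = ∑ i ∈ s, rectIntegral (f i) a b y₁ y₂ := by
  classical
  induction s using Finset.induction_on with
  | empty => simp [rectIntegral]
  | insert i s hi ih =>
    simp_rw [Finset.sum_insert hi]
    rw [rectIntegral_add hab hy (hf i (Finset.mem_insert_self i s))
      (continuousOn_finsetSum s fun j hj => hf j (Finset.mem_insert_of_mem hj)),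
      ih fun j hj => hf j (Finset.mem_insert_of_mem hj)]

theorem rectIntegral_eq_zero {a b y₁ y₂ : ℝ} (hab : a ≤ b) (hy : y₁ ≤ y₂)
    {f : ℂ → ℂ} {U : Set ℂ} (hf : DifferentiableOn ℂ f U)
    (hU : ∀ z : ℂ, a ≤ z.re → z.re ≤ b → y₁ ≤ z.im → z.im ≤ y₂ → z ∈ U) :
    rectIntegral f a b y₁ y₂ = 0 := by
  have h := Complex.integral_boundary_rect_eq_zero_of_differentiableOn f
    (a + y₁ * Complex.I) (b + y₂ * Complex.I) (hf.mono (by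
      intro z hz
      rw [Complex.mem_reProdIm] at hz
      simp only [Complex.add_re, Complex.ofReal_re, Complex.mul_re, Complex.I_re, mul_zero,
        Complex.ofReal_im, Complex.I_im, mul_one, sub_self, add_zero, Complex.add_im,
        Complex.mul_im, zero_add, Set.uIcc_of_le hab, Set.uIcc_of_le hy] at hz
      exact hU z hz.1.1 hz.1.2 hz.2.1 hz.2.2))
  simpa [rectIntegral] using h

theorem rectIntegral_const_mul (k : ℂ) (f : ℂ → ℂ) (a b y₁ y₂ : ℝ) :
    rectIntegral (fun z => k * f z) a b y₁ y₂ = k * rectIntegral f a b y₁ y₂ := by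
  unfold rectIntegral
  simp only [intervalIntegral.integral_const_mul]
  ring

theorem integral_horizontal_inv {a b y : ℝ} {L : ℂ → ℂ}
    (hL : ∀ x : ℝ, x ∈ Set.uIcc a b → HasDerivAt L ((x + y * Complex.I)⁻¹) (x + y * Complex.I))
    (h0 : ∀ x : ℝ, x ∈ Set.uIcc a b → (x + y * Complex.I : ℂ) ≠ 0) :
    ∫ x in a..b, ((x:ℂ) + y * Complex.I)⁻¹ = L (b + y * Complex.I) - L (a + y * Complex.I) := by
  have h := intervalIntegral.integral_eq_sub_of_hasDerivAt
    (f := fun x : ℝ => L (x + y * Complex.I)) (f' := fun x : ℝ => ((x:ℂ) + y * Complex.I)⁻¹)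
    (a := a) (b := b) ?_ ?_
  · exact h
  · intro x hx
    have h1 : HasDerivAt (fun x : ℝ => (x + y * Complex.I : ℂ)) 1 x :=
      (Complex.ofRealCLM.hasDerivAt (x := x)).add_const _
    have h3 := (hL x hx).comp x h1
    rw [mul_one] at h3
    exact h3
  · apply ContinuousOn.intervalIntegrable
    exact ContinuousOn.inv₀ (by fun_prop) h0

theorem integral_vertical_inv {a y₁ y₂ : ℝ} {L : ℂ → ℂ}
    (hL : ∀ y : ℝ, y ∈ Set.uIcc y₁ y₂ → HasDerivAt L ((a + y * Complex.I)⁻¹) (a + y * Complex.I))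
    (h0 : ∀ y : ℝ, y ∈ Set.uIcc y₁ y₂ → (a + y * Complex.I : ℂ) ≠ 0) :
    Complex.I * ∫ y in y₁..y₂, ((a:ℂ) + y * Complex.I)⁻¹ =
      L (a + y₂ * Complex.I) - L (a + y₁ * Complex.I) := by
  rw [← intervalIntegral.integral_const_mul]
  have h := intervalIntegral.integral_eq_sub_of_hasDerivAt
    (f := fun y : ℝ => L (a + y * Complex.I))
    (f' := fun y : ℝ => Complex.I * ((a:ℂ) + y * Complex.I)⁻¹)
    (a := y₁) (b := y₂) ?_ ?_
  · exact h
  · intro y hy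
    have h1 : HasDerivAt (fun y : ℝ => (a + y * Complex.I : ℂ)) Complex.I y := by
      have h2 := ((Complex.ofRealCLM.hasDerivAt (x := y)).mul_const Complex.I).const_add (a:ℂ)
      simpa using h2
    have h3 := (hL y hy).comp y h1
    rw [mul_comm] at h3
    exact h3
  · apply ContinuousOn.intervalIntegrable
    exact continuousOn_const.mul (ContinuousOn.inv₀ (by fun_prop) h0)

theorem hasDerivAt_log_neg {z : ℂ} (hz : z.re < 0) :
    HasDerivAt (fun z => Complex.log (-z)) z⁻¹ z := by
  have h1 : -z ∈ Complex.slitPlane := by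
    rw [Complex.mem_slitPlane_iff]
    left
    simpa using hz
  have h2 := (Complex.hasDerivAt_log h1).comp z (hasDerivAt_neg z)
  refine h2.congr_deriv ?_
  rw [inv_neg]
  ring

theorem rectIntegral_inv {a b y₁ y₂ : ℝ} (ha : a < 0) (hb : 0 < b) (hy₁ : y₁ < 0) (hy₂ : 0 < y₂) :
    rectIntegral (fun z => z⁻¹) a b y₁ y₂ = 2 * Real.pi * Complex.I := by
  have him : ∀ x y : ℝ, (x + y * Complex.I : ℂ).im = y := by simp
  have hre : ∀ x y : ℝ, (x + y * Complex.I : ℂ).re = x := by simp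
  have hne : ∀ x y : ℝ, (x ≠ 0 ∨ y ≠ 0) → (x + y * Complex.I : ℂ) ≠ 0 := by
    intro x y h h0
    have h1 := congrArg Complex.re h0
    have h2 := congrArg Complex.im h0
    rw [hre] at h1
    rw [him] at h2
    simp at h1 h2
    tauto
  have hlog : ∀ x y : ℝ, (0 < x ∨ y ≠ 0) →
      HasDerivAt Complex.log ((x + y * Complex.I : ℂ)⁻¹) (x + y * Complex.I) := by
    intro x y h
    apply Complex.hasDerivAt_log
    rw [Complex.mem_slitPlane_iff, hre, him]
    exact h
  unfold rectIntegral
  rw [integral_horizontal_inv (L := Complex.log) (fun x _ => hlog x y₁ (Or.inr hy₁.ne))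
      (fun x _ => hne _ _ (Or.inr hy₁.ne)),
    integral_horizontal_inv (L := Complex.log) (fun x _ => hlog x y₂ (Or.inr hy₂.ne'))
      (fun x _ => hne _ _ (Or.inr hy₂.ne')),
    integral_vertical_inv (L := Complex.log) (fun y _ => hlog b y (Or.inl hb))
      (fun y _ => hne _ _ (Or.inl hb.ne')),
    integral_vertical_inv (L := fun z => Complex.log (-z))
      (fun y _ => hasDerivAt_log_neg (by rw [hre]; exact ha)) (fun y _ => hne _ _ (Or.inl ha.ne))]
  have h1 : Complex.log (-(a + y₂ * Complex.I)) = Complex.log (a + y₂ * Complex.I) -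
      Real.pi * Complex.I := by
    rw [Complex.log, Complex.log, norm_neg, Complex.arg_neg_eq_arg_sub_pi_of_im_pos (by rwa [him])]
    push_cast
    ring
  have h2 : Complex.log (-(a + y₁ * Complex.I)) = Complex.log (a + y₁ * Complex.I) +
      Real.pi * Complex.I := by
    rw [Complex.log, Complex.log, norm_neg, Complex.arg_neg_eq_arg_add_pi_of_im_neg (by rwa [him])]
    push_cast
    ring
  rw [h1, h2]
  ring

theorem rectIntegral_inv_sub {a b y₁ y₂ : ℝ} {ρ : ℂ} (ha : a < ρ.re) (hb : ρ.re < b)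
    (hy₁ : y₁ < ρ.im) (hy₂ : ρ.im < y₂) :
    rectIntegral (fun z => (z - ρ)⁻¹) a b y₁ y₂ = 2 * Real.pi * Complex.I := by
  rw [← rectIntegral_inv (a := a - ρ.re) (b := b - ρ.re) (y₁ := y₁ - ρ.im) (y₂ := y₂ - ρ.im)
    (by linarith) (by linarith) (by linarith) (by linarith)]
  unfold rectIntegral
  have key : ∀ x y : ℝ, (x + y * Complex.I - ρ : ℂ) =
      ((x - ρ.re : ℝ) : ℂ) + ((y - ρ.im : ℝ) : ℂ) * Complex.I := by
    intro x y
    nth_rw 1 [← Complex.re_add_im ρ]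
    push_cast
    ring
  simp only [key]
  rw [intervalIntegral.integral_comp_sub_right
      (fun x : ℝ => ((x:ℂ) + ((y₁ - ρ.im : ℝ) : ℂ) * Complex.I)⁻¹),
    intervalIntegral.integral_comp_sub_right
      (fun x : ℝ => ((x:ℂ) + ((y₂ - ρ.im : ℝ) : ℂ) * Complex.I)⁻¹),
    intervalIntegral.integral_comp_sub_right
      (fun y : ℝ => (((b - ρ.re : ℝ) : ℂ) + (y : ℂ) * Complex.I)⁻¹),
    intervalIntegral.integral_comp_sub_right
      (fun y : ℝ => (((a - ρ.re : ℝ) : ℂ) + (y : ℂ) * Complex.I)⁻¹)]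

/-- Cauchy's integral formula for a rectangle. -/
theorem rectIntegral_div_sub {F : ℂ → ℂ} (hF : Differentiable ℂ F) {a b y₁ y₂ : ℝ} {ρ : ℂ}
    (ha : a < ρ.re) (hb : ρ.re < b) (hy₁ : y₁ < ρ.im) (hy₂ : ρ.im < y₂) :
    rectIntegral (fun z => F z / (z - ρ)) a b y₁ y₂ = 2 * Real.pi * Complex.I * F ρ := by
  have hab : a ≤ b := by linarith
  have hy : y₁ ≤ y₂ := by linarith
  have hne : ∀ z ∈ rectEdges a b y₁ y₂, z ≠ ρ := by
    rintro z ⟨-, h⟩ rfl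
    rcases h with h | h | h | h <;> linarith
  have hd : Differentiable ℂ (dslope F ρ) := by
    intro z
    have := (Complex.differentiableOn_dslope (s := Set.univ) (c := ρ) (f := F) Filter.univ_mem).mpr
      hF.differentiableOn
    exact this.differentiableAt Filter.univ_mem
  have h1 : rectIntegral (fun z => F z / (z - ρ)) a b y₁ y₂ =
      rectIntegral (fun z => dslope F ρ z + F ρ * (z - ρ)⁻¹) a b y₁ y₂ := by
    apply rectIntegral_congr hab hy
    intro z hz
    have h2 := sub_ne_zero.mpr (hne z hz)
    rw [dslope_of_ne _ (hne z hz), slope_def_field]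
    field_simp
    ring
  rw [h1, rectIntegral_add hab hy hd.continuous.continuousOn, rectIntegral_const_mul,
    rectIntegral_inv_sub ha hb hy₁ hy₂,
    rectIntegral_eq_zero hab hy (U := Set.univ) hd.differentiableOn (fun _ _ _ _ _ => trivial)]
  · ring
  · apply continuousOn_const.mul
    apply ContinuousOn.inv₀ (by fun_prop)
    intro z hz
    exact sub_ne_zero.mpr (hne z hz)

theorem re_mem_Ioo_of_riemannZeta_eq_zero {s : ℂ} (hs : s.im ≠ 0) (h : riemannZeta s = 0) :
    0 < s.re ∧ s.re < 1 := by
  constructor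
  · by_contra! h0
    rw [riemannZeta_eq_zetaCoFactor_mul hs] at h
    rcases mul_eq_zero.mp h with h1 | h1
    · exact zetaCoFactor_ne_zero hs h1
    · refine riemannZeta_ne_zero_of_one_le_re ?_ h1
      simp only [Complex.sub_re, Complex.one_re]
      linarith
  · by_contra! h1
    exact riemannZeta_ne_zero_of_one_le_re h1 h

theorem finite_riemannZeta_zeros_im_Icc {u v : ℝ} (hu : 0 < u) :
    {ρ : ℂ | riemannZeta ρ = 0 ∧ u ≤ ρ.im ∧ ρ.im ≤ v}.Finite := by
  apply finite_riemannZeta_zeros (K := Set.Icc (0:ℝ) 1 ×ℂ Set.Icc u v)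
    (isCompact_Icc.reProdIm isCompact_Icc)
  · rintro ρ ⟨h0, h1, h2⟩
    have h3 := re_mem_Ioo_of_riemannZeta_eq_zero (by intro h; linarith : ρ.im ≠ 0) h0
    exact ⟨⟨h3.1.le, h3.2.le⟩, h1, h2⟩
  · exact fun z hz => hz.1

/-- The residue theorem for `F ζ' / ζ` on rectangles whose horizontal sides are slightly outside
`[T, 2T]`. -/
theorem exists_rectIntegral_eq_zetaZeroSum {T : ℝ} (hT : 2 ≤ T) :
    ∃ T₁ T₂ : ℝ, T - 1 ≤ T₁ ∧ T₁ < T ∧ 2 * T < T₂ ∧ T₂ ≤ 2 * T + 1 ∧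
      (∀ s : ℂ, s.im = T₁ ∨ s.im = T₂ → riemannZeta s ≠ 0) ∧
      ∀ F : ℂ → ℂ, Differentiable ℂ F → ∀ a b : ℝ, -1 < a → a ≤ 0 → 1 ≤ b → b < 3 →
        rectIntegral (fun z => F z * logDeriv riemannZeta z) a b T₁ T₂ =
          2 * Real.pi * Complex.I * zetaZeroSum T F := by
  have hfin := finite_riemannZeta_zeros_im_Icc (u := T - 1) (v := 2 * T + 1) (by linarith)
  have hA : (Complex.im '' {ρ : ℂ | riemannZeta ρ = 0 ∧ T - 1 ≤ ρ.im ∧ ρ.im ≤ 2 * T + 1} \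
      Set.Icc T (2 * T)).Finite := (hfin.image _).sdiff
  obtain ⟨e₁, he₁, h₁⟩ := Metric.isOpen_iff.mp hA.isClosed.isOpen_compl T (by
    intro h; exact h.2 ⟨le_rfl, by linarith⟩)
  obtain ⟨e₂, he₂, h₂⟩ := Metric.isOpen_iff.mp hA.isClosed.isOpen_compl (2 * T) (by
    intro h; exact h.2 ⟨by linarith, le_rfl⟩)
  obtain ⟨e, he0, hee₁, hee₂, he1⟩ : ∃ e : ℝ, 0 < e ∧ e ≤ e₁ ∧ e ≤ e₂ ∧ e ≤ 1 :=
    ⟨min e₁ (min e₂ 1), by positivity, min_le_left _ _,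
      (min_le_right _ _).trans (min_le_left _ _), (min_le_right _ _).trans (min_le_right _ _)⟩
  have hzero : ∀ s : ℂ, riemannZeta s = 0 → T - e < s.im → s.im < 2 * T + e →
      T ≤ s.im ∧ s.im ≤ 2 * T := by
    intro s hs hs1 hs2
    by_contra hcon
    have hmem : s.im ∈ Complex.im '' {ρ : ℂ | riemannZeta ρ = 0 ∧ T - 1 ≤ ρ.im ∧
        ρ.im ≤ 2 * T + 1} \ Set.Icc T (2 * T) :=
      ⟨⟨s, ⟨hs, by linarith, by linarith⟩, rfl⟩, hcon⟩
    rcases lt_or_ge s.im T with h | h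
    · refine h₁ ?_ hmem
      rw [Metric.mem_ball, Real.dist_eq, abs_lt]
      constructor <;> linarith
    · have h' : 2 * T < s.im := by
        by_contra! h'
        exact hcon ⟨h, h'⟩
      refine h₂ ?_ hmem
      rw [Metric.mem_ball, Real.dist_eq, abs_lt]
      constructor <;> linarith
  obtain ⟨Z, hZ⟩ : ∃ Z : Finset ℂ, ∀ ρ, ρ ∈ Z ↔
      riemannZeta ρ = 0 ∧ T ≤ ρ.im ∧ ρ.im ≤ 2 * T := by
    refine ⟨(finite_riemannZeta_zeros_im_Icc (u := T) (v := 2 * T) (by linarith)).toFinset, ?_⟩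
    intro ρ
    rw [Set.Finite.mem_toFinset]
    rfl
  refine ⟨T - e / 2, 2 * T + e / 2, by linarith, by linarith, by linarith, by linarith, ?_, ?_⟩
  · rintro s hs h0
    rcases hs with hs | hs
    · have := hzero s h0 (by linarith) (by linarith)
      linarith [this.1]
    · have := hzero s h0 (by linarith) (by linarith)
      linarith [this.2]
  intro F hF a b ha ha' hb hb'
  set U : Set ℂ := Set.Ioo (-1) 3 ×ℂ Set.Ioo (T - e) (2 * T + e) with hUdef
  have hU : IsOpen U := isOpen_Ioo.reProdIm isOpen_Ioo
  have hU1 : ∀ z ∈ U, z ≠ 1 := by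
    rintro z hz rfl
    have := hz.2.1
    simp at this
    linarith
  have hZre : ∀ ρ ∈ Z, 0 < ρ.re ∧ ρ.re < 1 := fun ρ hρ =>
    re_mem_Ioo_of_riemannZeta_eq_zero (by have := ((hZ ρ).mp hρ).2.1; intro h; linarith)
      ((hZ ρ).mp hρ).1
  have hZU : ∀ ρ ∈ Z, ρ ∈ U := by
    intro ρ hρ
    have h1 := hZre ρ hρ
    have h2 := (hZ ρ).mp hρ
    exact ⟨⟨by linarith, by linarith⟩, by linarith [h2.2.1], by linarith [h2.2.2]⟩
  obtain ⟨g, hg, hgZ, hfg⟩ := exists_eq_prod_pow_mul hU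
    (fun z hz => (differentiableAt_riemannZeta (hU1 z hz)).differentiableWithinAt)
    Z hZU zetaZeroOrder (fun ρ hρ => analyticOrderAt_riemannZeta (hU1 ρ (hZU ρ hρ)))
  have hg0 : ∀ z ∈ U, g z ≠ 0 := by
    intro z hz h0
    by_cases hzZ : z ∈ Z
    · exact hgZ z hzZ h0
    · apply hzZ
      have hz0 : riemannZeta z = 0 := by rw [hfg z hz, h0, mul_zero]
      exact (hZ z).mpr ⟨hz0, hzero z hz0 hz.2.1 hz.2.2⟩
  have hab : a ≤ b := by linarith
  have hy : T - e / 2 ≤ 2 * T + e / 2 := by linarith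
  have hedgeU : ∀ z : ℂ, a ≤ z.re → z.re ≤ b → T - e / 2 ≤ z.im → z.im ≤ 2 * T + e / 2 →
      z ∈ U := fun z h1 h2 h3 h4 => ⟨⟨by linarith, by linarith⟩, by linarith, by linarith⟩
  have hedgeZ : ∀ z ∈ rectEdges a b (T - e / 2) (2 * T + e / 2), ∀ ρ ∈ Z, z ≠ ρ := by
    rintro z ⟨-, h⟩ ρ hρ rfl
    have h1 := hZre z hρ
    have h2 := ((hZ z).mp hρ).2
    rcases h with h | h | h | h <;> linarith
  have hlg : DifferentiableOn ℂ (fun z => F z * logDeriv g z) U :=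
    hF.differentiableOn.mul ((hg.deriv hU).div hg hg0)
  have hcont : ∀ ρ ∈ Z, ContinuousOn (fun z => (zetaZeroOrder ρ : ℂ) * (F z / (z - ρ)))
      (rectEdges a b (T - e / 2) (2 * T + e / 2)) := by
    intro ρ hρ
    apply continuousOn_const.mul
    apply hF.continuous.continuousOn.div (by fun_prop)
    intro z hz
    exact sub_ne_zero.mpr (hedgeZ z hz ρ hρ)
  have key : rectIntegral (fun z => F z * logDeriv riemannZeta z) a b (T - e / 2) (2 * T + e / 2) =
      rectIntegral (fun z => (∑ ρ ∈ Z, (zetaZeroOrder ρ : ℂ) * (F z / (z - ρ))) +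
        F z * logDeriv g z) a b (T - e / 2) (2 * T + e / 2) := by
    apply rectIntegral_congr hab hy
    intro z hz
    have hzU := hedgeU z hz.1.1 hz.1.2.1 hz.1.2.2.1 hz.1.2.2.2
    rw [logDeriv_eq_sum_add hU hg Z zetaZeroOrder hfg hzU
      (fun h => hedgeZ z hz z h rfl) (hg0 z hzU), mul_add, Finset.mul_sum]
    congr 1
    apply Finset.sum_congr rfl
    intro ρ _
    ring
  rw [key, rectIntegral_add hab hy (continuousOn_finsetSum _ hcont)
      (hlg.continuousOn.mono fun z hz => hedgeU z hz.1.1 hz.1.2.1 hz.1.2.2.1 hz.1.2.2.2),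
    rectIntegral_sum hab hy Z hcont, rectIntegral_eq_zero hab hy hlg hedgeU, add_zero]
  have hsum : zetaZeroSum T F = ∑ ρ ∈ Z, (zetaZeroOrder ρ : ℂ) * F ρ := by
    have hset : {ρ : ℂ | riemannZeta ρ = 0 ∧ 0 < ρ.re ∧ ρ.re < 1 ∧ T ≤ ρ.im ∧ ρ.im ≤ 2 * T} =
        (Z : Set ℂ) := by
      ext ρ
      rw [Finset.mem_coe, hZ ρ]
      constructor
      · rintro ⟨h1, -, -, h2⟩
        exact ⟨h1, h2⟩
      · intro h
        have := hZre ρ ((hZ ρ).mpr h)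
        exact ⟨h.1, this.1, this.2, h.2⟩
    rw [zetaZeroSum, hset, finsum_mem_coe_finset]
  rw [hsum, Finset.mul_sum]
  apply Finset.sum_congr rfl
  intro ρ hρ
  have h1 := hZre ρ hρ
  have h2 := ((hZ ρ).mp hρ).2
  rw [rectIntegral_const_mul, rectIntegral_div_sub hF (by linarith) (by linarith) (by linarith)
    (by linarith)]
  ring

theorem one_lt_log_three_mul {x : ℝ} (hx : 1 < x) : 1 < Real.log (3 * x) := by
  rw [Real.lt_log_iff_exp_lt (by linarith)]
  have := Real.exp_one_lt_d9
  linarith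

theorem norm_cpow_le_three_mul {x : ℝ} (hx : 1 < x) {s : ℂ}
    (hs : s.re ≤ 1 + 1 / Real.log (3 * x)) : ‖(x : ℂ) ^ s‖ ≤ 3 * x := by
  have hL := one_lt_log_three_mul hx
  have hx0 : 0 < x := by linarith
  rw [Complex.norm_cpow_eq_rpow_re_of_pos hx0]
  calc x ^ s.re ≤ x ^ (1 + 1 / Real.log (3 * x)) := Real.rpow_le_rpow_of_exponent_le hx.le hs
    _ = x * x ^ (1 / Real.log (3 * x)) := by rw [Real.rpow_add hx0, Real.rpow_one]
    _ ≤ x * Real.exp 1 := by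
        gcongr
        rw [Real.rpow_def_of_pos hx0, Real.exp_le_exp, mul_one_div, div_le_one (by linarith)]
        exact Real.log_le_log hx0 (by linarith)
    _ ≤ 3 * x := by
        have := Real.exp_one_lt_d9
        nlinarith

theorem norm_integral_le_mul_log {g : ℝ → ℂ} {δ M : ℝ} (hδ : 0 < δ)
    (h : ∀ u : ℝ, 0 < u → u ≤ 2 → δ * ‖g u‖ ≤ M ∧ u * ‖g u‖ ≤ M) :
    ‖∫ u in (0:ℝ)..2, g u‖ ≤ 2 * M * Real.log (1 + 2 / δ) := by
  have h1 : ‖∫ u in (0:ℝ)..2, g u‖ ≤ ∫ u in (0:ℝ)..2, 2 * M * (u + δ)⁻¹ := by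
    apply intervalIntegral.norm_integral_le_of_norm_le (by norm_num)
    · filter_upwards with u hu
      have := h u hu.1 hu.2
      have hu0 := hu.1
      rw [← div_eq_mul_inv, le_div_iff₀ (by linarith)]
      linarith
    · apply ContinuousOn.intervalIntegrable
      apply continuousOn_const.mul
      apply ContinuousOn.inv₀ (by fun_prop)
      intro u hu
      rw [Set.uIcc_of_le (by norm_num)] at hu
      have := hu.1
      positivity
  refine h1.trans_eq ?_
  rw [intervalIntegral.integral_const_mul, intervalIntegral.integral_comp_add_right
    (fun u => u⁻¹), integral_inv_of_pos (by linarith) (by linarith), zero_add]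
  congr 2
  field_simp
  ring

theorem exists_norm_integral_cpow_div_sub_le : ∃ C : ℝ, 0 < C ∧ ∀ x : ℝ, 1 < x → ∀ (ρ : ℂ) (y : ℝ),
    0 < ρ.re → ρ.re < 1 → ρ.im ≠ y →
    ‖∫ u in (-(1 / Real.log (3 * x)))..(1 + 1 / Real.log (3 * x)),
      (x : ℂ) ^ (u + y * Complex.I : ℂ) / (u + y * Complex.I - ρ)‖ ≤
        C * (x * Real.log (Real.log (3 * x))) := by
  obtain ⟨k, hk⟩ : ∃ k : ℝ, k = 1 / Real.log (Real.log 3) := ⟨_, rfl⟩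
  have hk0 : 0 < k := by
    have := loglog_three_pos
    rw [hk]; positivity
  refine ⟨5 * k + 12 * (2 * k + 1), by positivity, ?_⟩
  intro x hx ρ y h0 h1 hy
  have hL := one_lt_log_three_mul hx
  obtain ⟨δ, hδ⟩ : ∃ δ : ℝ, δ = 1 / Real.log (3 * x) := ⟨_, rfl⟩
  have hδ0 : 0 < δ := by rw [hδ]; positivity
  have hδ1 : δ < 1 := by rw [hδ, div_lt_one (by linarith)]; exact hL
  have hx0 : (x : ℂ) ≠ 0 := by
    have : x ≠ 0 := by linarith
    exact_mod_cast this
  have hll := one_le_mul_loglog hx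
  rw [← hk] at hll
  have hlog : Real.log (1 + 2 / δ) ≤ (2 * k + 1) * Real.log (Real.log (3 * x)) := by
    have e1 : 1 + 2 / δ ≤ 3 * Real.log (3 * x) := by
      rw [hδ, div_div_eq_mul_div]
      linarith
    have e2 : Real.log 3 ≤ 2 := by
      rw [Real.log_le_iff_le_exp (by norm_num)]
      have := Real.add_one_le_exp (2:ℝ)
      linarith
    calc Real.log (1 + 2 / δ) ≤ Real.log (3 * Real.log (3 * x)) :=
          Real.log_le_log (by positivity) e1
      _ = Real.log 3 + Real.log (Real.log (3 * x)) :=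
          Real.log_mul (by norm_num) (by linarith)
      _ ≤ _ := by linarith
  rw [← hδ]
  obtain ⟨f, hf⟩ : ∃ f : ℂ → ℂ, f = fun z => (x : ℂ) ^ z / (z - ρ) := ⟨_, rfl⟩
  have hfd : DifferentiableOn ℂ f {z | z ≠ ρ} := by
    rw [hf]
    intro z hz
    apply DifferentiableAt.differentiableWithinAt
    apply DifferentiableAt.div
    · exact (differentiableAt_id).const_cpow (Or.inl hx0)
    · fun_prop
    · exact sub_ne_zero.mpr hz
  have hre : ∀ u v : ℝ, (u + v * Complex.I - ρ : ℂ).re = u - ρ.re := by intro u v; simp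
  have him : ∀ u v : ℝ, (u + v * Complex.I - ρ : ℂ).im = v - ρ.im := by intro u v; simp
  have hbd : ∀ u v r : ℝ, 0 ≤ r → u ≤ 1 + δ → (r ≤ |u - ρ.re| ∨ r ≤ |v - ρ.im|) →
      r * ‖f (u + v * Complex.I)‖ ≤ 3 * x := by
    intro u v r hr hu h
    have hF : ‖(x:ℂ) ^ (u + v * Complex.I : ℂ)‖ ≤ 3 * x := by
      apply norm_cpow_le_three_mul hx
      simpa [hδ] using hu
    have hn : r ≤ ‖(u + v * Complex.I - ρ : ℂ)‖ := by
      rcases h with h | h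
      · rw [← hre u v] at h
        exact h.trans (Complex.abs_re_le_norm _)
      · rw [← him u v] at h
        exact h.trans (Complex.abs_im_le_norm _)
    rw [hf]
    simp only [norm_div]
    rcases hr.eq_or_lt with rfl | hr
    · rw [zero_mul]; linarith
    · rw [← mul_div_assoc, div_le_iff₀ (by linarith), mul_comm]
      have := norm_nonneg ((x:ℂ) ^ (u + v * Complex.I : ℂ))
      gcongr
  have hfar : ∀ v : ℝ, 2 ≤ |v - ρ.im| →
      ‖∫ u in (-δ)..(1 + δ), f (u + v * Complex.I)‖ ≤ 5 * x := by
    intro v hv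
    have := intervalIntegral.norm_integral_le_of_norm_le_const (a := -δ) (b := 1 + δ)
      (f := fun u : ℝ => f (u + v * Complex.I)) (C := 3 / 2 * x) (by
        intro u hu
        rw [Set.uIoc_of_le (by linarith)] at hu
        have := hbd u v 2 (by norm_num) hu.2 (Or.inr hv)
        linarith)
    refine this.trans ?_
    rw [abs_of_pos (by linarith)]
    nlinarith
  have hside : ∀ (w : ℝ), (w = -δ ∨ w = 1 + δ) → ∀ v : ℝ → ℝ,
      (∀ u, 0 < u → u ≤ 2 → u ≤ |v u - ρ.im|) →
      ‖∫ u in (0:ℝ)..2, f (w + v u * Complex.I)‖ ≤ 6 * x * Real.log (1 + 2 / δ) := by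
    intro w hw v hv
    have hw1 : w ≤ 1 + δ := by rcases hw with rfl | rfl <;> linarith
    have hw2 : δ ≤ |w - ρ.re| := by
      rcases hw with rfl | rfl
      · rw [abs_of_neg (by linarith)]; linarith
      · rw [abs_of_pos (by linarith)]; linarith
    have := norm_integral_le_mul_log (g := fun u => f (w + v u * Complex.I)) (M := 3 * x) hδ0
      (fun u hu0 hu2 => ⟨hbd w (v u) δ hδ0.le hw1 (Or.inl hw2),
        hbd w (v u) u hu0.le hw1 (Or.inr (hv u hu0 hu2))⟩)
    linarith
  have hfin : ∀ A B D E : ℂ, ‖A‖ ≤ 5 * x → ‖B‖ ≤ 6 * x * Real.log (1 + 2 / δ) →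
      ‖D‖ ≤ 6 * x * Real.log (1 + 2 / δ) → (E = A - Complex.I * B + Complex.I * D ∨
      E = A + Complex.I * B - Complex.I * D) →
      ‖E‖ ≤ (5 * k + 12 * (2 * k + 1)) * (x * Real.log (Real.log (3 * x))) := by
    intro A B D E hA hB hD hE
    have hI : ∀ z : ℂ, ‖Complex.I * z‖ = ‖z‖ := by intro z; simp
    have h3 : ‖E‖ ≤ ‖A‖ + ‖B‖ + ‖D‖ := by
      rcases hE with rfl | rfl
      · calc _ ≤ ‖A - Complex.I * B‖ + ‖Complex.I * D‖ := norm_add_le _ _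
          _ ≤ ‖A‖ + ‖Complex.I * B‖ + ‖Complex.I * D‖ := by gcongr; exact norm_sub_le _ _
          _ = _ := by rw [hI, hI]
      · calc _ ≤ ‖A + Complex.I * B‖ + ‖Complex.I * D‖ := norm_sub_le _ _
          _ ≤ ‖A‖ + ‖Complex.I * B‖ + ‖Complex.I * D‖ := by gcongr; exact norm_add_le _ _
          _ = _ := by rw [hI, hI]
    have h4 : x * Real.log (1 + 2 / δ) ≤ x * ((2 * k + 1) * Real.log (Real.log (3 * x))) := by
      gcongr
    have h5 : x * 1 ≤ x * (k * Real.log (Real.log (3 * x))) := by gcongr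
    linarith
  have hgoal : (∫ u in (-δ)..(1 + δ), (x : ℂ) ^ (u + y * Complex.I : ℂ) / (u + y * Complex.I - ρ))
      = ∫ u in (-δ)..(1 + δ), f (u + y * Complex.I) := by rw [hf]
  rw [hgoal]
  rcases lt_or_gt_of_ne hy with hy | hy
  · have hz := rectIntegral_eq_zero (a := -δ) (b := 1 + δ) (y₁ := y) (y₂ := y + 2) (by linarith)
      (by linarith) hfd (by rintro z - - h3 - rfl; linarith)
    have hv : ∀ w : ℝ, ∫ v in y..(y + 2), f (w + v * Complex.I) =
        ∫ u in (0:ℝ)..2, f (w + ((y + u : ℝ) : ℂ) * Complex.I) := by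
      intro w
      rw [intervalIntegral.integral_comp_add_left (fun v : ℝ => f (w + v * Complex.I)), add_zero]
    have hvi : ∀ u : ℝ, 0 < u → u ≤ 2 → u ≤ |y + u - ρ.im| := by
      intro u hu _
      rw [abs_of_pos (by linarith)]; linarith
    unfold rectIntegral at hz
    rw [hv, hv] at hz
    refine hfin _ _ _ _ (hfar (y + 2) (by rw [abs_of_pos (by linarith)]; linarith))
      (hside _ (Or.inr rfl) (fun u => y + u) hvi) (hside _ (Or.inl rfl) (fun u => y + u) hvi)
      (Or.inl ?_)
    linear_combination hz
  · have hz := rectIntegral_eq_zero (a := -δ) (b := 1 + δ) (y₁ := y - 2) (y₂ := y) (by linarith)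
      (by linarith) hfd (by rintro z - - - h3 rfl; linarith)
    have hv : ∀ w : ℝ, ∫ v in (y - 2)..y, f (w + v * Complex.I) =
        ∫ u in (0:ℝ)..2, f (w + ((y - u : ℝ) : ℂ) * Complex.I) := by
      intro w
      rw [intervalIntegral.integral_comp_sub_left (fun v : ℝ => f (w + v * Complex.I)), sub_zero]
    have hvi : ∀ u : ℝ, 0 < u → u ≤ 2 → u ≤ |y - u - ρ.im| := by
      intro u hu _
      rw [abs_of_neg (by linarith)]; linarith
    unfold rectIntegral at hz
    rw [hv, hv] at hz
    refine hfin _ _ _ _ (hfar (y - 2) (by rw [abs_of_neg (by linarith)]; linarith))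
      (hside _ (Or.inr rfl) (fun u => y - u) hvi) (hside _ (Or.inl rfl) (fun u => y - u) hvi)
      (Or.inr ?_)
    linear_combination -hz

/-- The integral of `x^s ζ'/ζ(s)` along a horizontal segment crossing the critical strip. -/
theorem exists_norm_integral_horizontal_le : ∃ C : ℝ, 0 < C ∧ ∀ x : ℝ, 1 < x → ∀ y : ℝ, 800 ≤ y →
    (∀ s : ℂ, s.im = y → riemannZeta s ≠ 0) →
    ‖∫ u in (-(1 / Real.log (3 * x)))..(1 + 1 / Real.log (3 * x)),
      (x : ℂ) ^ (u + y * Complex.I : ℂ) * logDeriv riemannZeta (u + y * Complex.I)‖ ≤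
        C * (x * Real.log y * Real.log (Real.log (3 * x))) := by
  obtain ⟨C, hC, hCx⟩ := exists_norm_integral_cpow_div_sub_le
  obtain ⟨k, hk⟩ : ∃ k : ℝ, k = 1 / Real.log (Real.log 3) := ⟨_, rfl⟩
  have hk0 : 0 < k := by
    have := loglog_three_pos
    rw [hk]; positivity
  refine ⟨34060 * (9 * k + C), by positivity, ?_⟩
  intro x hx y hy hzero
  have hL := one_lt_log_three_mul hx
  have hll := one_le_mul_loglog hx
  rw [← hk] at hll
  have hK0 : 0 ≤ Real.log (Real.log (3 * x)) := Real.log_nonneg hL.le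
  have hCx' := hCx x hx
  obtain ⟨δ, hδ⟩ : ∃ δ : ℝ, δ = 1 / Real.log (3 * x) := ⟨_, rfl⟩
  have hδ0 : 0 < δ := by rw [hδ]; positivity
  have hδ1 : δ < 1 := by rw [hδ, div_lt_one (by linarith)]; exact hL
  have hF : ∀ u : ℝ, u ≤ 1 + δ → ‖(x:ℂ) ^ (u + y * Complex.I : ℂ)‖ ≤ 3 * x := by
    intro u hu
    apply norm_cpow_le_three_mul hx
    simpa [hδ] using hu
  rw [← hδ] at hCx' ⊢
  have hx0 : (x : ℂ) ≠ 0 := by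
    have : x ≠ 0 := by linarith
    exact_mod_cast this
  have hly : 0 ≤ Real.log y := Real.log_nonneg (by linarith)
  obtain ⟨Z, hZ, hZs, hZb⟩ := zetaZeros_near hy
  have hZ' : ∀ ρ ∈ Z, 0 < ρ.re ∧ ρ.re < 1 ∧ ρ.im ≠ y := by
    intro ρ hρ
    have h1 := hZ ρ hρ
    have h2 := (Complex.abs_im_le_norm _).trans h1.2
    simp at h2
    rw [abs_le] at h2
    have h3 := re_mem_Ioo_of_riemannZeta_eq_zero (s := ρ) (by intro h; linarith) h1.1
    exact ⟨h3.1, h3.2, fun h => hzero ρ h h1.1⟩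
  have hne : ∀ (u : ℝ), ∀ ρ ∈ Z, (u + y * Complex.I - ρ : ℂ) ≠ 0 := by
    intro u ρ hρ h
    have := congrArg Complex.im h
    simp at this
    exact (hZ' ρ hρ).2.2 (by linarith)
  have hcF : Continuous fun u : ℝ => (x:ℂ) ^ (u + y * Complex.I : ℂ) :=
    Continuous.const_cpow (by fun_prop) (Or.inl hx0)
  have hct : ∀ ρ ∈ Z, Continuous fun u : ℝ => (zetaZeroOrder ρ : ℂ) *
      ((x:ℂ) ^ (u + y * Complex.I : ℂ) / (u + y * Complex.I - ρ)) := by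
    intro ρ hρ
    exact continuous_const.mul (hcF.div (by fun_prop) (fun u => hne u ρ hρ))
  have him : ∀ u : ℝ, (u + y * Complex.I : ℂ).im = y := by intro u; simp
  have hcz : Continuous fun u : ℝ => logDeriv riemannZeta (u + y * Complex.I) := by
    rw [continuous_iff_continuousAt]
    intro u
    have hs1 : (u + y * Complex.I : ℂ) ≠ 1 := by
      intro h
      have := congrArg Complex.im h
      rw [him] at this
      simp at this
      linarith
    have h1 := analyticAt_riemannZeta hs1
    have h2 : ContinuousAt (logDeriv riemannZeta) (u + y * Complex.I) :=
      (h1.deriv.continuousAt).div h1.continuousAt (hzero _ (him u))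
    exact ContinuousAt.comp (f := fun u : ℝ => (u + y * Complex.I : ℂ)) h2
      (Continuous.continuousAt (by fun_prop))
  have hcFz : Continuous fun u : ℝ =>
      (x:ℂ) ^ (u + y * Complex.I : ℂ) * logDeriv riemannZeta (u + y * Complex.I) := hcF.mul hcz
  have hsub : (∫ u in (-δ)..(1 + δ),
      (x : ℂ) ^ (u + y * Complex.I : ℂ) * logDeriv riemannZeta (u + y * Complex.I)) -
      ∑ ρ ∈ Z, (zetaZeroOrder ρ : ℂ) * ∫ u in (-δ)..(1 + δ),
        (x : ℂ) ^ (u + y * Complex.I : ℂ) / (u + y * Complex.I - ρ) =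
      ∫ u in (-δ)..(1 + δ), (x : ℂ) ^ (u + y * Complex.I : ℂ) *
        (logDeriv riemannZeta (u + y * Complex.I) -
          ∑ ρ ∈ Z, (zetaZeroOrder ρ : ℂ) / (u + y * Complex.I - ρ)) := by
    simp_rw [← intervalIntegral.integral_const_mul]
    rw [← intervalIntegral.integral_finsetSum fun ρ hρ => (hct ρ hρ).intervalIntegrable _ _,
      ← intervalIntegral.integral_sub (hcFz.intervalIntegrable _ _)
        ((continuous_finsetSum _ hct).intervalIntegrable _ _)]
    apply intervalIntegral.integral_congr
    intro u _
    simp only [mul_sub, Finset.mul_sum]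
    congr 1
    apply Finset.sum_congr rfl
    intro ρ _
    ring
  have hA : ‖∫ u in (-δ)..(1 + δ), (x : ℂ) ^ (u + y * Complex.I : ℂ) *
        (logDeriv riemannZeta (u + y * Complex.I) -
          ∑ ρ ∈ Z, (zetaZeroOrder ρ : ℂ) / (u + y * Complex.I - ρ))‖ ≤
      3 * x * (34060 * Real.log y) * 3 := by
    have h1 := intervalIntegral.norm_integral_le_of_norm_le_const (a := -δ) (b := 1 + δ)
      (f := fun u : ℝ => (x : ℂ) ^ (u + y * Complex.I : ℂ) *
        (logDeriv riemannZeta (u + y * Complex.I) -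
          ∑ ρ ∈ Z, (zetaZeroOrder ρ : ℂ) / (u + y * Complex.I - ρ)))
      (C := 3 * x * (34060 * Real.log y)) (by
        intro u hu
        rw [Set.uIoc_of_le (by linarith)] at hu
        rw [norm_mul]
        have h2 : ‖(u + y * Complex.I - (2 + y * Complex.I) : ℂ)‖ ≤ 3 := by
          have : (u + y * Complex.I - (2 + y * Complex.I) : ℂ) = ((u - 2 : ℝ) : ℂ) := by
            push_cast; ring
          rw [this, Complex.norm_real, Real.norm_eq_abs, abs_le]
          constructor <;> linarith [hu.1, hu.2]
        gcongr
        · exact hF u hu.2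
        · exact hZb _ h2 (hzero _ (him u)))
    refine h1.trans ?_
    have : |1 + δ - -δ| ≤ 3 := by rw [abs_of_pos (by linarith)]; linarith
    gcongr
  have hB : ‖∑ ρ ∈ Z, (zetaZeroOrder ρ : ℂ) * ∫ u in (-δ)..(1 + δ),
        (x : ℂ) ^ (u + y * Complex.I : ℂ) / (u + y * Complex.I - ρ)‖ ≤
      34060 * Real.log y * (C * (x * Real.log (Real.log (3 * x)))) := by
    calc _ ≤ ∑ ρ ∈ Z, (zetaZeroOrder ρ : ℝ) * (C * (x * Real.log (Real.log (3 * x)))) := by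
          apply norm_sum_le_of_le
          intro ρ hρ
          rw [norm_mul, Complex.norm_natCast]
          have h3 := hZ' ρ hρ
          gcongr
          exact hCx' ρ y h3.1 h3.2.1 h3.2.2
      _ = (∑ ρ ∈ Z, (zetaZeroOrder ρ : ℝ)) * (C * (x * Real.log (Real.log (3 * x)))) := by
          rw [Finset.sum_mul]
      _ ≤ _ := by gcongr
  have hfinal := norm_add_le_of_le hA hB
  rw [← hsub, sub_add_cancel] at hfinal
  refine hfinal.trans ?_
  have h5 : x * Real.log y * 1 ≤ x * Real.log y * (k * Real.log (Real.log (3 * x))) := by gcongr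
  linarith

theorem norm_integral_exp_mul_I_le {θ : ℝ} (hθ : θ ≠ 0) (a b : ℝ) :
    ‖∫ y in a..b, Complex.exp (θ * Complex.I * y)‖ ≤ 2 / |θ| := by
  have h0 : (θ * Complex.I : ℂ) ≠ 0 := by
    simpa using hθ
  have h1 : ∀ t : ℝ, ‖Complex.exp (θ * Complex.I * t)‖ = 1 := by
    intro t
    have : (θ * Complex.I * t : ℂ) = ((θ * t : ℝ) : ℂ) * Complex.I := by push_cast; ring
    rw [this, Complex.norm_exp_ofReal_mul_I]
  rw [integral_exp_mul_complex h0, norm_div, norm_mul, Complex.norm_real, Complex.norm_I, mul_one,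
    Real.norm_eq_abs]
  gcongr
  refine (norm_sub_le _ _).trans ?_
  rw [h1, h1]
  norm_num

theorem cpow_mul_cpow_eq {x m : ℝ} (hx : 0 < x) (hm : 0 < m) (α β ε y : ℝ) :
    (x : ℂ) ^ (α + y * Complex.I : ℂ) * (m : ℂ) ^ (-(β + ((ε * y : ℝ) : ℂ) * Complex.I)) =
      ((x ^ α * m ^ (-β) : ℝ) : ℂ) *
        Complex.exp (((Real.log x - ε * Real.log m : ℝ) : ℂ) * Complex.I * y) := by
  have hx' : (x : ℂ) ≠ 0 := by exact_mod_cast hx.ne'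
  have hm' : (m : ℂ) ≠ 0 := by exact_mod_cast hm.ne'
  rw [Complex.cpow_def_of_ne_zero hx', Complex.cpow_def_of_ne_zero hm',
    Real.rpow_def_of_pos hx, Real.rpow_def_of_pos hm, ← Complex.ofReal_log hx.le,
    ← Complex.ofReal_log hm.le]
  push_cast
  rw [← Complex.exp_add, ← Complex.exp_add, ← Complex.exp_add]
  congr 1
  ring

theorem norm_integral_cpow_mul_cpow_le {x m : ℝ} (hx : 0 < x) (hm : 0 < m) (α β ε a b : ℝ)
    (hθ : Real.log x - ε * Real.log m ≠ 0) :
    ‖∫ y in a..b, (x : ℂ) ^ (α + y * Complex.I : ℂ) *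
      (m : ℂ) ^ (-(β + ((ε * y : ℝ) : ℂ) * Complex.I))‖ ≤
      x ^ α * m ^ (-β) * (2 / |Real.log x - ε * Real.log m|) := by
  simp_rw [cpow_mul_cpow_eq hx hm]
  rw [intervalIntegral.integral_const_mul, norm_mul, Complex.norm_real, Real.norm_of_nonneg
    (by positivity)]
  gcongr
  exact norm_integral_exp_mul_I_le hθ a b

theorem norm_integral_cpow_mul_cpow_le_length {x m : ℝ} (hx : 0 < x) (hm : 0 < m)
    (α β ε : ℝ) {a b : ℝ} (hab : a ≤ b) :
    ‖∫ y in a..b, (x : ℂ) ^ (α + y * Complex.I : ℂ) *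
      (m : ℂ) ^ (-(β + ((ε * y : ℝ) : ℂ) * Complex.I))‖ ≤
      x ^ α * m ^ (-β) * (b - a) := by
  have := intervalIntegral.norm_integral_le_of_norm_le_const (a := a) (b := b)
    (f := fun y : ℝ => (x : ℂ) ^ (α + y * Complex.I : ℂ) *
      (m : ℂ) ^ (-(β + ((ε * y : ℝ) : ℂ) * Complex.I))) (C := x ^ α * m ^ (-β)) (by
      intro y _
      rw [cpow_mul_cpow_eq hx hm, norm_mul, Complex.norm_real, Real.norm_of_nonneg
        (by positivity)]
      have h1 : (((Real.log x - ε * Real.log m : ℝ) : ℂ) * Complex.I * y : ℂ) =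
        (((Real.log x - ε * Real.log m) * y : ℝ) : ℂ) * Complex.I := by push_cast; ring
      rw [h1, Complex.norm_exp_ofReal_mul_I, mul_one])
  rwa [abs_of_nonneg (by linarith)] at this

theorem hasSum_integral_vonMangoldt {c : ℝ} (hc : 1 < c) {G : ℝ → ℂ} (hG : Continuous G) {K : ℝ}
    (hK : ∀ y, ‖G y‖ ≤ K) {w : ℝ → ℝ} (hw : Continuous w) (a b : ℝ) :
    HasSum (fun n : ℕ => (ArithmeticFunction.vonMangoldt n : ℂ) *
        ∫ y in a..b, G y * (n : ℂ) ^ (-(c + w y * Complex.I : ℂ)))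
      (-∫ y in a..b, G y * logDeriv riemannZeta (c + w y * Complex.I)) := by
  have hs : ∀ y : ℝ, 1 < (c + w y * Complex.I : ℂ).re := by intro y; simpa using hc
  have hcont : ∀ n : ℕ, Continuous fun y : ℝ => G y * ((ArithmeticFunction.vonMangoldt n : ℂ) *
      (n : ℂ) ^ (-(c + w y * Complex.I : ℂ))) := by
    intro n
    rcases Nat.eq_zero_or_pos n with rfl | hn
    · simp only [ArithmeticFunction.map_zero, Complex.ofReal_zero, zero_mul, mul_zero]
      exact continuous_const
    · have hn' : (n : ℂ) ≠ 0 := by exact_mod_cast hn.ne'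
      exact hG.mul (continuous_const.mul (Continuous.const_cpow (by fun_prop) (Or.inl hn')))
  have hsum := hasSum_vonMangoldt_real hc
  have key := intervalIntegral.hasSum_integral_of_dominated_convergence (a := a) (b := b)
    (μ := MeasureTheory.volume)
    (F := fun (n : ℕ) (y : ℝ) => G y * ((ArithmeticFunction.vonMangoldt n : ℂ) *
      (n : ℂ) ^ (-(c + w y * Complex.I : ℂ))))
    (f := fun y => G y * (-logDeriv riemannZeta (c + w y * Complex.I)))
    (fun n _ => K * (ArithmeticFunction.vonMangoldt n * (n : ℝ) ^ (-c)))
    (fun n => (hcont n).aestronglyMeasurable)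
    (fun n => by
      filter_upwards with y _
      rw [norm_mul, norm_mul, Complex.norm_real, Real.norm_of_nonneg
        ArithmeticFunction.vonMangoldt_nonneg]
      rcases Nat.eq_zero_or_pos n with rfl | hn
      · simp
      · rw [Complex.norm_natCast_cpow_of_pos hn]
        have : (-(c + w y * Complex.I : ℂ)).re = -c := by simp
        rw [this]
        have h0 : 0 ≤ ArithmeticFunction.vonMangoldt n * (n : ℝ) ^ (-c) :=
          mul_nonneg ArithmeticFunction.vonMangoldt_nonneg (by positivity)
        exact mul_le_mul_of_nonneg_right (hK y) h0)
    (by filter_upwards with y _; exact hsum.summable.mul_left K)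
    (by
      apply Continuous.intervalIntegrable
      exact continuous_const)
    (by
      filter_upwards with y _
      exact (hasSum_vonMangoldt (hs y)).mul_left (G y))
  have h1 : (∫ y in a..b, G y * (-logDeriv riemannZeta (c + w y * Complex.I))) =
      -∫ y in a..b, G y * logDeriv riemannZeta (c + w y * Complex.I) := by
    rw [← intervalIntegral.integral_neg]
    apply intervalIntegral.integral_congr
    intro y _
    ring
  rw [h1] at key
  refine key.congr_fun ?_
  intro n
  rw [← intervalIntegral.integral_const_mul]
  apply intervalIntegral.integral_congr
  intro y _
  ring

theorem primePowerDist_nonneg (x : ℝ) : 0 ≤ primePowerDist x := by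
  apply Real.sInf_nonneg
  rintro d ⟨q, -, -, rfl⟩
  exact abs_nonneg _

theorem primePowerDist_le {x : ℝ} {q : ℕ} (hq : IsPrimePow q) (hqx : (q : ℝ) ≠ x) :
    primePowerDist x ≤ |x - q| := by
  apply csInf_le
  · refine ⟨0, ?_⟩
    rintro d ⟨q, -, -, rfl⟩
    exact abs_nonneg _
  · exact ⟨q, hq, hqx, rfl⟩

theorem primePowerDist_pos {x : ℝ} (hx : 0 ≤ x) (h : ∀ n : ℕ, (n : ℝ) ≠ x) :
    0 < primePowerDist x := by
  have h1 : (⌊x⌋₊ : ℝ) < x := lt_of_le_of_ne (Nat.floor_le hx) (h _)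
  have h2 : x < ⌊x⌋₊ + 1 := Nat.lt_floor_add_one x
  have h3 : 0 < min (x - ⌊x⌋₊) (⌊x⌋₊ + 1 - x) := lt_min (by linarith) (by linarith)
  refine h3.trans_le (le_csInf ⟨_, 2, Nat.prime_two.isPrimePow, h 2, rfl⟩ ?_)
  rintro d ⟨q, -, -, rfl⟩
  rcases Nat.lt_or_ge ⌊x⌋₊ q with hq | hq
  · have : (⌊x⌋₊ : ℝ) + 1 ≤ q := by exact_mod_cast hq
    refine (min_le_right _ _).trans ?_
    rw [abs_of_neg (by linarith)]
    linarith
  · have : (q : ℝ) ≤ ⌊x⌋₊ := by exact_mod_cast hq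
    refine (min_le_left _ _).trans ?_
    rw [abs_of_pos (by linarith)]
    linarith

theorem LambdaR_nonneg (x : ℝ) : 0 ≤ LambdaR x := by
  unfold LambdaR
  split_ifs
  · exact ArithmeticFunction.vonMangoldt_nonneg
  · exact le_rfl

theorem LambdaR_le_log {x : ℝ} (hx : 1 ≤ x) : LambdaR x ≤ Real.log x := by
  unfold LambdaR
  split_ifs with h
  · have := ArithmeticFunction.vonMangoldt_le_log (n := ⌊x⌋₊)
    rwa [h] at this
  · exact Real.log_nonneg hx

theorem log_sub_log_ne_zero {x m : ℝ} (hx : 0 < x) (hm : 0 < m) (hne : m ≠ x) :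
    Real.log x - 1 * Real.log m ≠ 0 := by
  rw [one_mul]
  intro h
  exact hne (Real.log_injOn_pos hm hx (by linarith))

theorem two_div_abs_log_sub_log_le {x m M : ℝ} (hx : 0 < x) (hm : 0 < m) (hne : m ≠ x)
    (hxM : x ≤ M) (hmM : m ≤ M) :
    2 / |Real.log x - 1 * Real.log m| ≤ 2 * (M / |m - x|) := by
  have key : ∀ u v : ℝ, 0 < u → u < v → v ≤ M → |u - v| / M ≤ |Real.log v - Real.log u| := by
    intro u v hu huv hvM
    have h1 := Real.log_le_sub_one_of_pos (div_pos hu (hu.trans huv))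
    rw [Real.log_div hu.ne' (hu.trans huv).ne'] at h1
    have h2 : (v - u) / M ≤ (v - u) / v :=
      div_le_div_of_nonneg_left (by linarith) (hu.trans huv) hvM
    have h3 : (v - u) / v = 1 - u / v := by
      rw [sub_div, div_self (hu.trans huv).ne']
    rw [abs_sub_comm u v, abs_of_pos (by linarith : 0 < v - u)]
    refine le_trans ?_ (le_abs_self _)
    linarith
  have h : |m - x| / M ≤ |Real.log x - 1 * Real.log m| := by
    rw [one_mul]
    rcases lt_or_gt_of_ne hne with h | h
    · exact key m x hm h hxM
    · have := key x m hx h hmM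
      rwa [abs_sub_comm x m, abs_sub_comm (Real.log m)] at this
  have h0 : 0 < |m - x| := abs_pos.mpr (sub_ne_zero.mpr hne)
  have hM : 0 < M := hx.trans_le hxM
  calc 2 / |Real.log x - 1 * Real.log m| ≤ 2 / (|m - x| / M) := by gcongr
    _ = 2 * (M / |m - x|) := by field_simp

theorem rpow_mul_rpow_neg_le {x m k c : ℝ} (hx : 0 < x) (hm : 0 < m) (hk : 1 ≤ k) (hxm : x ≤ k * m)
    (hc0 : 0 ≤ c) (hc : c ≤ 2) : x ^ c * m ^ (-c) ≤ k ^ 2 := by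
  rw [Real.rpow_neg hm.le, ← div_eq_mul_inv, ← Real.div_rpow hx.le hm.le]
  calc (x / m) ^ c ≤ k ^ c := by
        apply Real.rpow_le_rpow (by positivity) _ hc0
        rwa [div_le_iff₀ hm]
    _ ≤ k ^ (2:ℝ) := Real.rpow_le_rpow_of_exponent_le hk hc
    _ = k ^ 2 := by norm_cast

theorem rpow_le_three_mul {x : ℝ} (hx : 1 < x) : x ^ (1 + 1 / Real.log (3 * x)) ≤ 3 * x := by
  have h := norm_cpow_le_three_mul hx (s := ((1 + 1 / Real.log (3 * x) : ℝ) : ℂ))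
    (by rw [Complex.ofReal_re])
  rwa [Complex.norm_cpow_eq_rpow_re_of_pos (by linarith), Complex.ofReal_re] at h

/-- The contribution of a single integer within distance `1` of `x`. -/
theorem vonMangoldt_mul_le_of_abs_sub_lt_one {x c T D : ℝ} {n : ℕ} {I : ℂ} (hx : 1 < x) (hT : 0 ≤ T)
    (hc0 : 0 ≤ c) (hc : c ≤ 2) (hn : (n : ℝ) ≠ x) (hnx : |(n : ℝ) - x| < 1) (hD : D ≤ 2 * T)
    (hI1 : ‖I‖ ≤ x ^ c * (n : ℝ) ^ (-c) * D)
    (hI2 : ∀ M, x ≤ M → n ≤ M → ‖I‖ ≤ x ^ c * (n : ℝ) ^ (-c) * (2 * (M / |n - x|))) :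
    ArithmeticFunction.vonMangoldt n * ‖I‖ ≤
      40 * x + 36 * (Real.log x * min T (x / primePowerDist x)) := by
  have hlx := Real.log_pos hx
  have hpd := primePowerDist_nonneg x
  have hmin : 0 ≤ min T (x / primePowerDist x) := le_min hT (by positivity)
  rcases eq_or_ne (ArithmeticFunction.vonMangoldt n) 0 with h0 | h0
  · rw [h0, zero_mul]
    positivity
  have hpp : IsPrimePow n := ArithmeticFunction.vonMangoldt_ne_zero_iff.mp h0
  have hn2 : 2 ≤ n := hpp.two_le
  have hn2' : (2:ℝ) ≤ n := by exact_mod_cast hn2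
  rw [abs_lt] at hnx
  have hle : x ^ c * (n : ℝ) ^ (-c) ≤ (3 / 2) ^ 2 :=
    rpow_mul_rpow_neg_le (by linarith) (by linarith) (by norm_num) (by linarith) hc0 hc
  have hΛ0 : 0 ≤ ArithmeticFunction.vonMangoldt n := ArithmeticFunction.vonMangoldt_nonneg
  have hΛ : ArithmeticFunction.vonMangoldt n ≤ Real.log n := ArithmeticFunction.vonMangoldt_le_log
  have habs : 0 < |(n:ℝ) - x| := abs_pos.mpr (sub_ne_zero.mpr hn)
  have hI3 := hI2 (2 * x) (by linarith) (by linarith)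
  rcases lt_or_ge x (3 / 2) with h | h
  · have hn3 : n < 3 := by
      have : (n:ℝ) < 3 := by linarith
      exact_mod_cast this
    have hn_eq : n = 2 := by omega
    have h4 : ArithmeticFunction.vonMangoldt n ≤ 1 := by
      refine hΛ.trans ?_
      rw [hn_eq]
      push_cast
      have := Real.log_two_lt_d9
      linarith
    have h5 : 1 / 2 ≤ |(n:ℝ) - x| := by
      rw [hn_eq]
      push_cast
      rw [abs_of_pos (by linarith)]
      linarith
    have h6 : 2 * x / |(n:ℝ) - x| ≤ 4 * x := by
      rw [div_le_iff₀ habs]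
      nlinarith
    have h7 : ‖I‖ ≤ (3 / 2) ^ 2 * (2 * (4 * x)) := hI3.trans (by gcongr)
    have h8 : ArithmeticFunction.vonMangoldt n * ‖I‖ ≤ 1 * ((3 / 2) ^ 2 * (2 * (4 * x))) := by
      gcongr
    have : 0 ≤ Real.log x * min T (x / primePowerDist x) := by positivity
    linarith
  · have hnat : ∀ k : ℕ, (k : ℝ) ≠ x := by
      rintro k rfl
      have h1 : (n:ℝ) < k + 1 := by linarith
      have h2 : (k:ℝ) < n + 1 := by linarith
      have h3 : n < k + 1 := by exact_mod_cast h1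
      have h4 : k < n + 1 := by exact_mod_cast h2
      exact hn (by congr 1; omega)
    have hpos := primePowerDist_pos (by linarith) hnat
    have hple := primePowerDist_le hpp hn
    rw [abs_sub_comm] at hple
    have h4 : ArithmeticFunction.vonMangoldt n ≤ 3 * Real.log x := by
      refine hΛ.trans ?_
      have : 3 * Real.log x = Real.log (x ^ 3) := by
        rw [Real.log_pow]; norm_num
      rw [this]
      apply Real.log_le_log (by linarith)
      nlinarith [mul_pos (by linarith : 0 < x) (by linarith : 0 < x)]
    have h5 : ‖I‖ ≤ 12 * min T (x / primePowerDist x) := by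
      rw [mul_min_of_nonneg _ _ (by norm_num)]
      apply le_min
      · refine hI1.trans ?_
        calc x ^ c * (n : ℝ) ^ (-c) * D ≤ x ^ c * (n : ℝ) ^ (-c) * (2 * T) := by gcongr
          _ ≤ (3 / 2) ^ 2 * (2 * T) := by gcongr
          _ ≤ 12 * T := by linarith
      · refine hI3.trans ?_
        calc x ^ c * (n : ℝ) ^ (-c) * (2 * (2 * x / |(n:ℝ) - x|)) ≤
            (3 / 2) ^ 2 * (2 * (2 * x / primePowerDist x)) := by gcongr
          _ = 9 * (x / primePowerDist x) := by ring
          _ ≤ 12 * (x / primePowerDist x) := by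
              have : 0 ≤ x / primePowerDist x := by positivity
              linarith
    calc ArithmeticFunction.vonMangoldt n * ‖I‖ ≤
        3 * Real.log x * (12 * min T (x / primePowerDist x)) := by gcongr
      _ ≤ _ := by linarith

/-- The integral of `x^s ζ'/ζ(s)` along a vertical segment to the right of the critical strip. -/
theorem exists_norm_integral_right_le : ∃ C : ℝ, 0 < C ∧ ∀ x : ℝ, 1 < x → ∀ T T₁ T₂ : ℝ, 0 ≤ T →
    T₁ ≤ T₂ → T₂ - T₁ ≤ 2 * T →
    ‖(∫ y in T₁..T₂, (x : ℂ) ^ (((1 + 1 / Real.log (3 * x) : ℝ) : ℂ) + y * Complex.I) *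
        logDeriv riemannZeta (((1 + 1 / Real.log (3 * x) : ℝ) : ℂ) + y * Complex.I)) +
        (T₂ - T₁) * (LambdaR x : ℝ)‖ ≤
      C * (x * Real.log (3 * x) * Real.log (Real.log (3 * x))) +
        72 * (Real.log x * min T (x / primePowerDist x)) := by
  obtain ⟨C₁, hC₁, hnear⟩ := exists_sum_vonMangoldt_near_le
  obtain ⟨C₂, hC₂, htsum⟩ := exists_tsum_vonMangoldt_le
  obtain ⟨k, hk⟩ : ∃ k : ℝ, k = 1 / Real.log (Real.log 3) := ⟨_, rfl⟩
  have hk0 : 0 < k := by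
    have := loglog_three_pos
    rw [hk]; positivity
  refine ⟨5 * C₁ + (30 * C₂ + 80) * k, by positivity, ?_⟩
  intro x hx T T₁ T₂ hT h12 hT12
  have hL := one_lt_log_three_mul hx
  have hll := one_le_mul_loglog hx
  rw [← hk] at hll
  have hx0 : 0 < x := by linarith
  have hpd := primePowerDist_nonneg x
  obtain ⟨L, hLdef⟩ : ∃ L : ℝ, L = Real.log (3 * x) := ⟨_, rfl⟩
  obtain ⟨c, hc⟩ : ∃ c : ℝ, c = 1 + 1 / Real.log (3 * x) := ⟨_, rfl⟩
  have hxc : x ^ c ≤ 3 * x := by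
    rw [hc]
    exact rpow_le_three_mul hx
  have hc1 : 1 < c := by
    have : 0 < 1 / Real.log (3 * x) := by positivity
    linarith
  have hc2 : c ≤ 2 := by
    have : 1 / Real.log (3 * x) < 1 := by rw [div_lt_one (by linarith)]; exact hL
    linarith
  have htsum' := htsum c hc1 hc2
  have hc3 : C₂ / (c - 1) = C₂ * Real.log (3 * x) := by
    rw [hc]
    field_simp
    ring
  rw [hc3] at htsum'
  rw [← hc]
  obtain ⟨I, hI⟩ : ∃ I : ℕ → ℂ, I = fun n : ℕ => ∫ y in T₁..T₂, (x : ℂ) ^ (c + y * Complex.I : ℂ) *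
      (n : ℂ) ^ (-(c + ((1 * y : ℝ) : ℂ) * Complex.I : ℂ)) := ⟨_, rfl⟩
  have hIn : ∀ n : ℕ, I n = ∫ y in T₁..T₂, (x : ℂ) ^ (c + y * Complex.I : ℂ) *
      (((n : ℝ) : ℂ)) ^ (-(c + ((1 * y : ℝ) : ℂ) * Complex.I : ℂ)) := by
    intro n
    rw [hI]
    simp only [Complex.ofReal_natCast]
  have hI1 : ∀ n : ℕ, 0 < n → ‖I n‖ ≤ x ^ c * (n : ℝ) ^ (-c) * (T₂ - T₁) := by
    intro n hn
    rw [hIn]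
    exact norm_integral_cpow_mul_cpow_le_length hx0 (by exact_mod_cast hn) _ _ _ h12
  have hI2 : ∀ n : ℕ, 0 < n → (n : ℝ) ≠ x → ∀ M, x ≤ M → n ≤ M →
      ‖I n‖ ≤ x ^ c * (n : ℝ) ^ (-c) * (2 * (M / |n - x|)) := by
    intro n hn hne M hxM hnM
    have hn' : (0:ℝ) < n := by exact_mod_cast hn
    rw [hIn]
    refine (norm_integral_cpow_mul_cpow_le hx0 hn' _ _ _ _ _
      (log_sub_log_ne_zero hx0 hn' hne)).trans ?_
    gcongr
    exact two_div_abs_log_sub_log_le hx0 hn' hne hxM hnM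
  have hI3 : ∀ n : ℕ, (n : ℝ) = x → I n = ((T₂ - T₁ : ℝ) : ℂ) := by
    intro n hn
    rw [hIn, hn]
    simp_rw [cpow_mul_cpow_eq hx0 hx0]
    rw [← Real.rpow_add hx0]
    simp
  have hG : Continuous fun y : ℝ => (x : ℂ) ^ (c + y * Complex.I : ℂ) :=
    Continuous.const_cpow (by fun_prop) (Or.inl (by exact_mod_cast hx0.ne'))
  have hGK : ∀ y : ℝ, ‖(x : ℂ) ^ (c + y * Complex.I : ℂ)‖ ≤ 3 * x := by
    intro y
    rw [Complex.norm_cpow_eq_rpow_re_of_pos hx0]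
    simpa using hxc
  have hS := hasSum_integral_vonMangoldt hc1 hG hGK (w := fun y => 1 * y) (by fun_prop) T₁ T₂
  obtain ⟨J, hJ⟩ : ∃ J : ℂ, J = ∫ y in T₁..T₂, (x : ℂ) ^ (c + y * Complex.I : ℂ) *
      logDeriv riemannZeta (c + y * Complex.I) := ⟨_, rfl⟩
  have hS' : HasSum (fun n : ℕ => (ArithmeticFunction.vonMangoldt n : ℂ) * I n) (-J) := by
    rw [hI, hJ]
    simpa only [one_mul] using hS
  rw [← hJ]
  obtain ⟨t, ht⟩ : ∃ t : ℕ → ℂ, t = fun n => (ArithmeticFunction.vonMangoldt n : ℂ) * I n -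
      (if n = ⌊x⌋₊ then ((T₂ - T₁) * (LambdaR x : ℝ) : ℂ) else 0) := ⟨_, rfl⟩
  have htS : HasSum t (-J - (T₂ - T₁) * (LambdaR x : ℝ)) := by
    rw [ht]
    exact hS'.sub (hasSum_ite_eq _ _)
  have ht1 : ∀ n : ℕ, (n : ℝ) = x → t n = 0 := by
    intro n hn
    have hfl : ⌊x⌋₊ = n := by rw [← hn, Nat.floor_natCast]
    have hΛ : LambdaR x = ArithmeticFunction.vonMangoldt n := by
      unfold LambdaR
      rw [hfl, if_pos hn]
    rw [ht]
    simp only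
    rw [if_pos hfl.symm, hI3 n hn, hΛ]
    push_cast
    ring
  have ht2 : ∀ n : ℕ, (n : ℝ) ≠ x → ‖t n‖ = ArithmeticFunction.vonMangoldt n * ‖I n‖ := by
    intro n hn
    have : (if n = ⌊x⌋₊ then ((T₂ - T₁) * (LambdaR x : ℝ) : ℂ) else 0) = 0 := by
      split_ifs with h
      · have : LambdaR x = 0 := by
          unfold LambdaR
          rw [← h, if_neg hn]
        rw [this]
        simp
      · rfl
    rw [ht]
    simp only
    rw [this, sub_zero, norm_mul, Complex.norm_real, Real.norm_of_nonneg
      ArithmeticFunction.vonMangoldt_nonneg]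
  have ht0 : t 0 = 0 := by
    rw [← norm_eq_zero, ht2 0 (by simpa using hx0.ne)]
    simp
  set B : Finset ℕ := (Finset.range (⌈2 * x⌉₊ + 2)).filter
    fun n => (n : ℝ) ≠ x ∧ (|(n : ℝ) - x| < 1 ∨ |(n : ℝ) - x| ≤ x / 4) with hB
  have hbound : ∀ n : ℕ, ‖t n‖ ≤ 30 * x * (ArithmeticFunction.vonMangoldt n * (n : ℝ) ^ (-c)) +
      (if n ∈ B then ‖t n‖ else 0) := by
    intro n
    have h0 : 0 ≤ ArithmeticFunction.vonMangoldt n * (n : ℝ) ^ (-c) :=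
      mul_nonneg ArithmeticFunction.vonMangoldt_nonneg (by positivity)
    split_ifs with hnB
    · have : 0 ≤ 30 * x * (ArithmeticFunction.vonMangoldt n * (n : ℝ) ^ (-c)) := by positivity
      linarith
    · rcases eq_or_ne (n : ℝ) x with hnx | hnx
      · rw [ht1 n hnx, norm_zero]
        positivity
      · rcases Nat.eq_zero_or_pos n with rfl | hn
        · rw [ht0]
          simp
        have hn' : (0:ℝ) < n := by exact_mod_cast hn
        have hfar : x / 4 ≤ |(n : ℝ) - x| := by
          by_contra! hcon
          apply hnB
          rw [hB, Finset.mem_filter, Finset.mem_range]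
          refine ⟨?_, hnx, Or.inr hcon.le⟩
          have h1 := (abs_lt.mp hcon).2
          have h2 := Nat.le_ceil (2 * x)
          have h3 : (n : ℝ) < (⌈2 * x⌉₊ : ℝ) + 2 := by linarith
          exact_mod_cast h3
        have habs := le_abs_self ((n : ℝ) - x)
        have h1 := hI2 n hn hnx (5 * |(n : ℝ) - x|) (by linarith) (by linarith)
        have habs0 : 0 < |(n : ℝ) - x| := by linarith
        rw [mul_div_assoc, div_self habs0.ne'] at h1
        rw [ht2 n hnx, add_zero]
        have hΛ0 : 0 ≤ ArithmeticFunction.vonMangoldt n := ArithmeticFunction.vonMangoldt_nonneg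
        calc ArithmeticFunction.vonMangoldt n * ‖I n‖ ≤
            ArithmeticFunction.vonMangoldt n * (3 * x * (n : ℝ) ^ (-c) * (2 * (5 * 1))) := by
              gcongr
              exact h1.trans (by gcongr)
          _ = _ := by ring
  have hg := ((hasSum_vonMangoldt_real hc1).summable.hasSum.mul_left (30 * x)).add
    (hasSum_sum_of_ne_finset_zero (s := B) (f := fun n => if n ∈ B then ‖t n‖ else 0)
      (fun n hn => if_neg hn))
  have hmain := tsum_of_norm_bounded hg hbound
  rw [htS.tsum_eq] at hmain
  have hBsum : ∑ n ∈ B, (if n ∈ B then ‖t n‖ else 0) = ∑ n ∈ B, ‖t n‖ :=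
    Finset.sum_congr rfl fun n hn => if_pos hn
  rw [hBsum, ← Finset.sum_filter_add_sum_filter_not B (fun n : ℕ => 1 ≤ |(n : ℝ) - x|)] at hmain
  have hS1 : ∑ n ∈ B.filter (fun n : ℕ => 1 ≤ |(n : ℝ) - x|), ‖t n‖ ≤
      5 * x * (C₁ * (Real.log (3 * x) * Real.log (Real.log (3 * x)))) := by
    have hmem : ∀ n ∈ B.filter (fun n : ℕ => 1 ≤ |(n : ℝ) - x|),
        1 ≤ |(n : ℝ) - x| ∧ |(n : ℝ) - x| ≤ x / 4 := by
      intro n hn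
      rw [hB, Finset.mem_filter, Finset.mem_filter] at hn
      refine ⟨hn.2, ?_⟩
      rcases hn.1.2.2 with h | h
      · linarith [hn.2]
      · exact h
    refine le_trans ?_ (mul_le_mul_of_nonneg_left (hnear x hx _ hmem) (by positivity))
    rw [Finset.mul_sum]
    apply Finset.sum_le_sum
    intro n hn
    have h1 := hmem n hn
    have hnx : (n : ℝ) ≠ x := by
      intro h
      rw [h, sub_self, abs_zero] at h1
      linarith [h1.1]
    have h2 := abs_le.mp h1.2
    have hn' : (0:ℝ) < n := by linarith
    have hn0 : 0 < n := by exact_mod_cast hn'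
    rw [ht2 n hnx]
    have hΛ0 : 0 ≤ ArithmeticFunction.vonMangoldt n := ArithmeticFunction.vonMangoldt_nonneg
    have h3 : x ^ c * (n : ℝ) ^ (-c) ≤ (4 / 3) ^ 2 :=
      rpow_mul_rpow_neg_le hx0 hn' (by norm_num) (by linarith) (by linarith) hc2
    have habs0 : 0 < |(n : ℝ) - x| := by linarith
    calc ArithmeticFunction.vonMangoldt n * ‖I n‖ ≤
        ArithmeticFunction.vonMangoldt n * ((4 / 3) ^ 2 * (2 * (5 / 4 * x / |(n:ℝ) - x|))) := by
          gcongr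
          refine (hI2 n hn0 hnx (5 / 4 * x) (by linarith) (by linarith)).trans ?_
          gcongr
      _ = 40 / 9 * x * (ArithmeticFunction.vonMangoldt n / |(n:ℝ) - x|) := by ring
      _ ≤ 5 * x * (ArithmeticFunction.vonMangoldt n / |(n:ℝ) - x|) := by
          gcongr
          norm_num
  have hS2 : ∑ n ∈ B.filter (fun n : ℕ => ¬ 1 ≤ |(n : ℝ) - x|), ‖t n‖ ≤
      2 * (40 * x + 36 * (Real.log x * min T (x / primePowerDist x))) := by
    have hsub : B.filter (fun n : ℕ => ¬ 1 ≤ |(n : ℝ) - x|) ⊆ {⌊x⌋₊, ⌊x⌋₊ + 1} := by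
      intro n hn
      rw [Finset.mem_filter, not_le, abs_lt] at hn
      have h1 : (⌊x⌋₊ : ℝ) ≤ x := Nat.floor_le hx0.le
      have h2 : x < ⌊x⌋₊ + 1 := Nat.lt_floor_add_one x
      have h3 : (n : ℝ) < ⌊x⌋₊ + 2 := by linarith [hn.2.2]
      have h4 : (⌊x⌋₊ : ℝ) < n + 1 := by linarith [hn.2.1]
      have h5 : n < ⌊x⌋₊ + 2 := by exact_mod_cast h3
      have h6 : ⌊x⌋₊ < n + 1 := by exact_mod_cast h4
      rw [Finset.mem_insert, Finset.mem_singleton]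
      omega
    have hW : 0 ≤ 40 * x + 36 * (Real.log x * min T (x / primePowerDist x)) := by
      have h1 := Real.log_pos hx
      have h2 : 0 ≤ min T (x / primePowerDist x) := le_min hT (by positivity)
      positivity
    have hcard : ((B.filter (fun n : ℕ => ¬ 1 ≤ |(n : ℝ) - x|)).card : ℝ) ≤ 2 := by
      have h1 := (Finset.card_le_card hsub).trans Finset.card_le_two
      exact_mod_cast h1
    refine (Finset.sum_le_card_nsmul _ _
      (40 * x + 36 * (Real.log x * min T (x / primePowerDist x))) ?_).trans ?_
    · intro n hn
      rw [Finset.mem_filter, not_le, hB, Finset.mem_filter] at hn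
      have hnx := hn.1.2.1
      rw [ht2 n hnx]
      have hn' : (0:ℝ) < n := by linarith [(abs_lt.mp hn.2).1]
      have hn0 : 0 < n := by exact_mod_cast hn'
      exact vonMangoldt_mul_le_of_abs_sub_lt_one hx hT (by linarith) hc2 hnx hn.2 hT12
        (hI1 n hn0) (hI2 n hn0 hnx)
    · rw [nsmul_eq_mul]
      gcongr
  have hneg : J + (T₂ - T₁) * (LambdaR x : ℝ) = -(-J - (T₂ - T₁) * (LambdaR x : ℝ)) := by ring
  rw [hneg, norm_neg]
  refine hmain.trans ?_
  have hK0 : 0 ≤ Real.log (Real.log (3 * x)) := Real.log_nonneg hL.le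
  have e1 : 30 * x * ∑' n : ℕ, ArithmeticFunction.vonMangoldt n * (n : ℝ) ^ (-c) ≤
      30 * x * (C₂ * Real.log (3 * x)) := by gcongr
  have e2 : (30 * C₂ + 80) * (x * Real.log (3 * x)) * 1 ≤
      (30 * C₂ + 80) * (x * Real.log (3 * x)) * (k * Real.log (Real.log (3 * x))) := by gcongr
  have e3 : x * 1 ≤ x * Real.log (3 * x) := by gcongr
  linarith

theorem logDeriv_riemannZeta_eq_sub {s : ℂ} (hs : s.im ≠ 0) (h0 : s.re < 0) :
    logDeriv riemannZeta s = logDeriv zetaCoFactor s - logDeriv riemannZeta (1 - s) := by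
  have hopen : IsOpen {z : ℂ | z.im ≠ 0} := isOpen_ne_fun Complex.continuous_im continuous_const
  have hev : riemannZeta =ᶠ[nhds s] fun z => zetaCoFactor z * (riemannZeta ∘ fun w => 1 - w) z := by
    filter_upwards [hopen.mem_nhds hs] with z hz
    exact riemannZeta_eq_zetaCoFactor_mul hz
  have h1 : (1 - s) ≠ 1 := by
    intro h
    have := congrArg Complex.re h
    simp at this
    linarith
  have hζ : riemannZeta (1 - s) ≠ 0 := by
    apply riemannZeta_ne_zero_of_one_le_re
    simp only [Complex.sub_re, Complex.one_re]
    linarith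
  have hd : DifferentiableAt ℂ (fun w : ℂ => 1 - w) s := by fun_prop
  have hdz : DifferentiableAt ℂ riemannZeta (1 - s) := differentiableAt_riemannZeta h1
  have e1 : logDeriv riemannZeta s =
      logDeriv (fun z => zetaCoFactor z * (riemannZeta ∘ fun w => 1 - w) z) s := by
    rw [logDeriv_apply, logDeriv_apply, hev.deriv_eq, hev.eq_of_nhds]
  rw [e1, logDeriv_mul s (zetaCoFactor_ne_zero hs) hζ (differentiableAt_zetaCoFactor hs)
    (DifferentiableAt.comp s hdz hd), logDeriv_comp hdz hd]
  have e2 : deriv (fun w : ℂ => 1 - w) s = -1 := by simp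
  rw [e2]
  ring

theorem exists_norm_integral_reflected_le : ∃ C : ℝ, 0 < C ∧ ∀ x : ℝ, 1 < x → ∀ T₁ T₂ : ℝ,
    ‖∫ y in T₁..T₂, (x : ℂ) ^ (((-(1 / Real.log (3 * x)) : ℝ) : ℂ) + y * Complex.I) *
        logDeriv riemannZeta (((1 + 1 / Real.log (3 * x) : ℝ) : ℂ) +
          ((-1 * y : ℝ) : ℂ) * Complex.I)‖ ≤ C * Real.log (3 * x) := by
  obtain ⟨C₂, hC₂, htsum⟩ := exists_tsum_vonMangoldt_le
  refine ⟨3 * C₂, by positivity, ?_⟩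
  intro x hx T₁ T₂
  have hL := one_lt_log_three_mul hx
  have hx0 : 0 < x := by linarith
  have hδ0 : 0 < 1 / Real.log (3 * x) := by positivity
  obtain ⟨c, hc⟩ : ∃ c : ℝ, c = 1 + 1 / Real.log (3 * x) := ⟨_, rfl⟩
  have hc1 : 1 < c := by linarith
  have hc2 : c ≤ 2 := by
    have : 1 / Real.log (3 * x) < 1 := by rw [div_lt_one (by linarith)]; exact hL
    linarith
  have htsum' := htsum c hc1 hc2
  have hc3 : C₂ / (c - 1) = C₂ * Real.log (3 * x) := by
    rw [hc]
    field_simp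
    ring
  rw [hc3] at htsum'
  rw [← hc]
  have hG : Continuous fun y : ℝ =>
      (x : ℂ) ^ (((-(1 / Real.log (3 * x)) : ℝ) : ℂ) + y * Complex.I) :=
    Continuous.const_cpow (by fun_prop) (Or.inl (by exact_mod_cast hx0.ne'))
  have hx1 : x ^ (-(1 / Real.log (3 * x))) ≤ 1 :=
    Real.rpow_le_one_of_one_le_of_nonpos hx.le (by linarith)
  have hGK : ∀ y : ℝ, ‖(x : ℂ) ^ (((-(1 / Real.log (3 * x)) : ℝ) : ℂ) + y * Complex.I)‖ ≤ 1 := by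
    intro y
    rw [Complex.norm_cpow_eq_rpow_re_of_pos hx0]
    simpa using hx1
  have hS := hasSum_integral_vonMangoldt hc1 hG hGK (w := fun y => -1 * y) (by fun_prop) T₁ T₂
  have hbound : ∀ n : ℕ, ‖(ArithmeticFunction.vonMangoldt n : ℂ) * ∫ y in T₁..T₂,
      (x : ℂ) ^ (((-(1 / Real.log (3 * x)) : ℝ) : ℂ) + y * Complex.I) *
        (n : ℂ) ^ (-(c + ((-1 * y : ℝ) : ℂ) * Complex.I : ℂ))‖ ≤
      3 * (ArithmeticFunction.vonMangoldt n * (n : ℝ) ^ (-c)) := by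
    intro n
    rcases eq_or_ne (ArithmeticFunction.vonMangoldt n) 0 with h0 | h0
    · rw [h0]
      simp
    have hn2 : 2 ≤ n := (ArithmeticFunction.vonMangoldt_ne_zero_iff.mp h0).two_le
    have hn2' : (2:ℝ) ≤ n := by exact_mod_cast hn2
    have hΛ0 : 0 ≤ ArithmeticFunction.vonMangoldt n := ArithmeticFunction.vonMangoldt_nonneg
    have hlx := Real.log_pos hx
    have hln : 0.69 ≤ Real.log n := by
      have h1 := Real.log_two_gt_d9
      have h2 := Real.log_le_log (by norm_num) hn2'
      linarith
    have hθ : 0.69 ≤ |Real.log x - -1 * Real.log n| := by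
      rw [abs_of_pos (by linarith)]
      linarith
    have h2 := norm_integral_cpow_mul_cpow_le hx0 (m := (n : ℝ)) (by linarith)
      (-(1 / Real.log (3 * x))) c (-1) T₁ T₂ (by
        intro h
        rw [h, abs_zero] at hθ
        norm_num at hθ)
    rw [Complex.ofReal_natCast] at h2
    rw [norm_mul, Complex.norm_real, Real.norm_of_nonneg hΛ0]
    calc _ ≤ ArithmeticFunction.vonMangoldt n * (x ^ (-(1 / Real.log (3 * x))) * (n:ℝ) ^ (-c) *
          (2 / |Real.log x - -1 * Real.log n|)) := by gcongr
      _ ≤ ArithmeticFunction.vonMangoldt n * (1 * (n:ℝ) ^ (-c) * (2 / 0.69)) := by gcongr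
      _ = (2 / 0.69) * (ArithmeticFunction.vonMangoldt n * (n:ℝ) ^ (-c)) := by ring
      _ ≤ _ := by
        gcongr
        norm_num
  have hmain := tsum_of_norm_bounded
    ((hasSum_vonMangoldt_real hc1).summable.hasSum.mul_left 3) hbound
  rw [hS.tsum_eq, norm_neg] at hmain
  refine hmain.trans ?_
  linarith

theorem norm_integral_cpow_mul_logDeriv_zetaCoFactor_le {x T T₁ T₂ : ℝ} (hx : 1 < x)
    (hT : 801 ≤ T) (h1 : T - 1 ≤ T₁) (h12 : T₁ ≤ T₂) (h2 : T₂ ≤ 2 * T + 1) :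
    ‖∫ y in T₁..T₂, (x : ℂ) ^ (((-(1 / Real.log (3 * x)) : ℝ) : ℂ) + y * Complex.I) *
        logDeriv zetaCoFactor (((-(1 / Real.log (3 * x)) : ℝ) : ℂ) + y * Complex.I)‖ ≤
      12000 * (Real.log (2 * T + 1) * min T (1 / Real.log x)) := by
  have hL := one_lt_log_three_mul hx
  have hx0 : 0 < x := by linarith
  have hδ0 : 0 < 1 / Real.log (3 * x) := by positivity
  have hδ1 : 1 / Real.log (3 * x) < 1 := by rw [div_lt_one (by linarith)]; exact hL
  have hx1 : x ^ (-(1 / Real.log (3 * x))) ≤ 1 :=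
    Real.rpow_le_one_of_one_le_of_nonpos hx.le (by linarith)
  obtain ⟨a, ha⟩ : ∃ a : ℝ, a = -(1 / Real.log (3 * x)) := ⟨_, rfl⟩
  rw [← ha] at hx1 ⊢
  have hlx := Real.log_pos hx
  obtain ⟨M, hM⟩ : ∃ M : ℝ, M = Real.log (2 * T + 1) := ⟨_, rfl⟩
  rw [← hM]
  have hre : ∀ y : ℝ, (a + y * Complex.I : ℂ).re = a := by intro y; simp
  have him : ∀ y : ℝ, (a + y * Complex.I : ℂ).im = y := by intro y; simp
  have hGK : ∀ y : ℝ, ‖(x : ℂ) ^ (a + y * Complex.I : ℂ)‖ ≤ 1 := by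
    intro y
    rw [Complex.norm_cpow_eq_rpow_re_of_pos hx0, hre]
    exact hx1
  have hM0 : 0 ≤ M := by
    rw [hM]
    exact Real.log_nonneg (by linarith)
  have hφ : ∀ y ∈ Set.Icc T₁ T₂, ‖logDeriv zetaCoFactor (a + y * Complex.I)‖ ≤ 224 * M ∧
      ‖deriv (logDeriv zetaCoFactor) (a + y * Complex.I)‖ ≤ 3584 * M / (T - 1) := by
    intro y hy
    have h3 := norm_logDeriv_zetaCoFactor_le (s := (a + y * Complex.I : ℂ))
      (by rw [him]; linarith [hy.1]) (by
        rw [hre, abs_le]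
        constructor <;> linarith)
    rw [him] at h3
    have hly : Real.log y ≤ M := by
      rw [hM]
      exact Real.log_le_log (by linarith [hy.1]) (by linarith [hy.2])
    have hly0 : 0 ≤ Real.log y := Real.log_nonneg (by linarith [hy.1])
    refine ⟨h3.1.trans (by gcongr), h3.2.trans ?_⟩
    have : T - 1 ≤ y := by linarith [hy.1]
    have : 0 < T - 1 := by linarith
    gcongr
  have hle : ∀ {f : ℝ → ℂ} {K : ℝ}, (∀ y ∈ Set.Icc T₁ T₂, ‖f y‖ ≤ K) →
      ‖∫ y in T₁..T₂, f y‖ ≤ K * (T₂ - T₁) := by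
    intro f K h
    have := intervalIntegral.norm_integral_le_of_norm_le_const (a := T₁) (b := T₂) (f := f) (C := K)
      (by
        intro y hy
        rw [Set.uIoc_of_le h12] at hy
        exact h y ⟨hy.1.le, hy.2⟩)
    rwa [abs_of_nonneg (by linarith)] at this
  rw [mul_min_of_nonneg _ _ hM0, mul_min_of_nonneg _ _ (by norm_num)]
  apply le_min
  · refine (hle (K := 1 * (224 * M)) ?_).trans ?_
    · intro y hy
      rw [norm_mul]
      gcongr
      · exact hGK y
      · exact (hφ y hy).1
    · have : 1 * (224 * M) * (T₂ - T₁) ≤ 1 * (224 * M) * (2 * T) := by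
        gcongr
        linarith
      have h3 : 0 ≤ M * T := by positivity
      linarith
  · have hopen : IsOpen {z : ℂ | z.im ≠ 0} := isOpen_ne_fun Complex.continuous_im continuous_const
    have hd0 : DifferentiableOn ℂ zetaCoFactor {z : ℂ | z.im ≠ 0} :=
      fun z hz => (differentiableAt_zetaCoFactor hz).differentiableWithinAt
    have hd1 : DifferentiableOn ℂ (logDeriv zetaCoFactor) {z : ℂ | z.im ≠ 0} :=
      (hd0.deriv hopen).div hd0 fun z hz => zetaCoFactor_ne_zero hz
    have hd2 := (hd1.deriv hopen).continuousOn
    have hmem : ∀ y ∈ Set.uIcc T₁ T₂, (a + y * Complex.I : ℂ) ∈ {z : ℂ | z.im ≠ 0} := by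
      intro y hy
      rw [Set.uIcc_of_le h12] at hy
      rw [Set.mem_ofPred_eq, him]
      linarith [hy.1]
    have hline : ∀ y : ℝ, HasDerivAt (fun y : ℝ => (a + y * Complex.I : ℂ)) Complex.I y := by
      intro y
      have h3 := ((Complex.ofRealCLM.hasDerivAt (x := y)).mul_const Complex.I).const_add (a:ℂ)
      simpa using h3
    have hu : ∀ y ∈ Set.uIcc T₁ T₂,
        HasDerivAt (fun y : ℝ => logDeriv zetaCoFactor (a + y * Complex.I))
          (deriv (logDeriv zetaCoFactor) (a + y * Complex.I) * Complex.I) y := by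
      intro y hy
      have h3 := (hd1.differentiableAt (hopen.mem_nhds (hmem y hy))).hasDerivAt
      exact h3.comp y (hline y)
    have hx' : (x : ℂ) ≠ 0 := by exact_mod_cast hx0.ne'
    have hlx' : (Real.log x : ℂ) ≠ 0 := by exact_mod_cast hlx.ne'
    have hv : ∀ y ∈ Set.uIcc T₁ T₂,
        HasDerivAt (fun y : ℝ => (x : ℂ) ^ (a + y * Complex.I : ℂ) / (Real.log x * Complex.I))
          ((x : ℂ) ^ (a + y * Complex.I : ℂ)) y := by
      intro y _
      have h4 : HasDerivAt (fun z : ℂ => (x : ℂ) ^ z)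
          ((x : ℂ) ^ (a + y * Complex.I : ℂ) * Complex.log x * 1) (a + y * Complex.I) :=
        (hasDerivAt_id _).const_cpow (Or.inl hx')
      have h3 := (h4.comp y (hline y)).div_const (Real.log x * Complex.I : ℂ)
      refine h3.congr_deriv ?_
      rw [← Complex.ofReal_log hx0.le]
      field_simp
    have hGc : Continuous fun y : ℝ => (x : ℂ) ^ (a + y * Complex.I : ℂ) :=
      Continuous.const_cpow (by fun_prop) (Or.inl hx')
    have hparts := intervalIntegral.integral_mul_deriv_eq_deriv_mul hu hv
      (by
        apply ContinuousOn.intervalIntegrable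
        exact (hd2.comp (by fun_prop) hmem).mul continuousOn_const)
      (hGc.intervalIntegrable _ _)
    have hcomm : (∫ y in T₁..T₂, (x : ℂ) ^ (a + y * Complex.I : ℂ) *
        logDeriv zetaCoFactor (a + y * Complex.I)) = ∫ y in T₁..T₂,
        logDeriv zetaCoFactor (a + y * Complex.I) * (x : ℂ) ^ (a + y * Complex.I : ℂ) := by
      apply intervalIntegral.integral_congr
      intro y _
      exact mul_comm _ _
    have hvn : ∀ y : ℝ, ‖(x : ℂ) ^ (a + y * Complex.I : ℂ) / (Real.log x * Complex.I)‖ ≤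
        1 / Real.log x := by
      intro y
      rw [norm_div, norm_mul, Complex.norm_I, mul_one, Complex.norm_real, Real.norm_of_nonneg hlx.le]
      gcongr
      exact hGK y
    have hT1 : 0 < T - 1 := by linarith
    have h_int := hle (f := fun y : ℝ => deriv (logDeriv zetaCoFactor) (a + y * Complex.I) *
      Complex.I * ((x : ℂ) ^ (a + y * Complex.I : ℂ) / (Real.log x * Complex.I)))
      (K := 3584 * M / (T - 1) * (1 / Real.log x)) (by
        intro y hy
        rw [norm_mul, norm_mul, Complex.norm_I, mul_one]
        gcongr
        · exact (hφ y hy).2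
        · exact hvn y)
    have hend : ∀ y ∈ Set.Icc T₁ T₂, ‖logDeriv zetaCoFactor (a + y * Complex.I) *
        ((x : ℂ) ^ (a + y * Complex.I : ℂ) / (Real.log x * Complex.I))‖ ≤
        224 * M * (1 / Real.log x) := by
      intro y hy
      rw [norm_mul]
      gcongr
      · exact (hφ y hy).1
      · exact hvn y
    rw [hcomm, hparts]
    refine (norm_sub_le _ _).trans ?_
    have h3 := (norm_sub_le _ _).trans
      (add_le_add (hend T₂ ⟨h12, le_rfl⟩) (hend T₁ ⟨le_rfl, h12⟩))
    have h4 : 3584 * M / (T - 1) * (1 / Real.log x) * (T₂ - T₁) ≤ 7168 * (M * (1 / Real.log x)) := by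
      have h5 : (T₂ - T₁) / (T - 1) ≤ 2 := by
        rw [div_le_iff₀ hT1]
        linarith
      calc _ = 3584 * (M * (1 / Real.log x)) * ((T₂ - T₁) / (T - 1)) := by ring
        _ ≤ 3584 * (M * (1 / Real.log x)) * 2 := by gcongr
        _ = _ := by ring
    have h6 : 0 ≤ M * (1 / Real.log x) := by positivity
    linarith

/-- The integral of `x^s ζ'/ζ(s)` along a vertical segment to the left of the critical strip. -/
theorem exists_norm_integral_left_le : ∃ C : ℝ, 0 < C ∧ ∀ x : ℝ, 1 < x → ∀ T T₁ T₂ : ℝ, 801 ≤ T →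
    T - 1 ≤ T₁ → T₁ ≤ T₂ → T₂ ≤ 2 * T + 1 →
    ‖∫ y in T₁..T₂, (x : ℂ) ^ (((-(1 / Real.log (3 * x)) : ℝ) : ℂ) + y * Complex.I) *
        logDeriv riemannZeta (((-(1 / Real.log (3 * x)) : ℝ) : ℂ) + y * Complex.I)‖ ≤
      C * Real.log (3 * x) + 12000 * (Real.log (2 * T + 1) * min T (1 / Real.log x)) := by
  obtain ⟨C, hC, hCx⟩ := exists_norm_integral_reflected_le
  refine ⟨C, hC, ?_⟩
  intro x hx T T₁ T₂ hT h1 h12 h2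
  have hA := hCx x hx T₁ T₂
  have hB := norm_integral_cpow_mul_logDeriv_zetaCoFactor_le hx hT h1 h12 h2
  have hL := one_lt_log_three_mul hx
  have hδ0 : 0 < 1 / Real.log (3 * x) := by positivity
  obtain ⟨δ, hδ⟩ : ∃ δ : ℝ, δ = 1 / Real.log (3 * x) := ⟨_, rfl⟩
  rw [← hδ] at hA hB hδ0 ⊢
  have hx' : (x : ℂ) ≠ 0 := by
    have : x ≠ 0 := by linarith
    exact_mod_cast this
  have hGc : Continuous fun y : ℝ => (x : ℂ) ^ (((-δ : ℝ) : ℂ) + y * Complex.I) :=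
    Continuous.const_cpow (by fun_prop) (Or.inl hx')
  have hopen : IsOpen {z : ℂ | z.im ≠ 0} := isOpen_ne_fun Complex.continuous_im continuous_const
  have hd0 : DifferentiableOn ℂ zetaCoFactor {z : ℂ | z.im ≠ 0} :=
    fun z hz => (differentiableAt_zetaCoFactor hz).differentiableWithinAt
  have hd1 : DifferentiableOn ℂ (logDeriv zetaCoFactor) {z : ℂ | z.im ≠ 0} :=
    (hd0.deriv hopen).div hd0 fun z hz => zetaCoFactor_ne_zero hz
  have him : ∀ y ∈ Set.uIcc T₁ T₂, (((-δ : ℝ) : ℂ) + y * Complex.I).im ≠ 0 := by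
    intro y hy
    rw [Set.uIcc_of_le h12] at hy
    have : (((-δ : ℝ) : ℂ) + y * Complex.I).im = y := by simp
    rw [this]
    linarith [hy.1]
  have hcA : ContinuousOn (fun y : ℝ => (x : ℂ) ^ (((-δ : ℝ) : ℂ) + y * Complex.I) *
      logDeriv zetaCoFactor (((-δ : ℝ) : ℂ) + y * Complex.I)) (Set.uIcc T₁ T₂) :=
    hGc.continuousOn.mul (hd1.continuousOn.comp (by fun_prop) him)
  have hopen' : IsOpen {z : ℂ | 1 < z.re} := isOpen_lt continuous_const Complex.continuous_re
  have hd2 : DifferentiableOn ℂ riemannZeta {z : ℂ | 1 < z.re} := by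
    intro z hz
    apply (differentiableAt_riemannZeta _).differentiableWithinAt
    rintro rfl
    simp at hz
  have hd3 : DifferentiableOn ℂ (logDeriv riemannZeta) {z : ℂ | 1 < z.re} :=
    (hd2.deriv hopen').div hd2 fun z hz => riemannZeta_ne_zero_of_one_le_re (le_of_lt hz)
  have hcB : ContinuousOn (fun y : ℝ => (x : ℂ) ^ (((-δ : ℝ) : ℂ) + y * Complex.I) *
      logDeriv riemannZeta (((1 + δ : ℝ) : ℂ) + ((-1 * y : ℝ) : ℂ) * Complex.I))
      (Set.uIcc T₁ T₂) := by
    apply hGc.continuousOn.mul (hd3.continuousOn.comp (by fun_prop) _)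
    intro y _
    simp [hδ0]
  have hsplit : (∫ y in T₁..T₂, (x : ℂ) ^ (((-δ : ℝ) : ℂ) + y * Complex.I) *
      logDeriv riemannZeta (((-δ : ℝ) : ℂ) + y * Complex.I)) =
      (∫ y in T₁..T₂, (x : ℂ) ^ (((-δ : ℝ) : ℂ) + y * Complex.I) *
        logDeriv zetaCoFactor (((-δ : ℝ) : ℂ) + y * Complex.I)) -
      ∫ y in T₁..T₂, (x : ℂ) ^ (((-δ : ℝ) : ℂ) + y * Complex.I) *
        logDeriv riemannZeta (((1 + δ : ℝ) : ℂ) + ((-1 * y : ℝ) : ℂ) * Complex.I) := by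
    rw [← intervalIntegral.integral_sub hcA.intervalIntegrable hcB.intervalIntegrable]
    apply intervalIntegral.integral_congr
    intro y hy
    simp only
    rw [logDeriv_riemannZeta_eq_sub (him y hy) (by simpa using hδ0)]
    have : (1 - (((-δ : ℝ) : ℂ) + y * Complex.I) : ℂ) =
        ((1 + δ : ℝ) : ℂ) + ((-1 * y : ℝ) : ℂ) * Complex.I := by
      push_cast
      ring
    rw [this]
    ring
  rw [hsplit]
  refine (norm_sub_le _ _).trans ?_
  linarith

theorem exists_norm_zetaZeroSum_le (V : ℝ) : ∃ N : ℝ, 0 ≤ N ∧ ∀ x : ℝ, 1 < x → ∀ T : ℝ, 2 ≤ T →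
    T ≤ V → ‖zetaZeroSum T (fun ρ => (x:ℂ)^ρ)‖ ≤ N * x := by
  have hfin := finite_riemannZeta_zeros_im_Icc (u := 2) (v := 2 * V) (by norm_num)
  refine ⟨∑ ρ ∈ hfin.toFinset, (zetaZeroOrder ρ : ℝ), by positivity, ?_⟩
  intro x hx T hT hTV
  have hsub : {ρ : ℂ | riemannZeta ρ = 0 ∧ 0 < ρ.re ∧ ρ.re < 1 ∧ T ≤ ρ.im ∧ ρ.im ≤ 2*T} ⊆
      {ρ : ℂ | riemannZeta ρ = 0 ∧ 2 ≤ ρ.im ∧ ρ.im ≤ 2 * V} := by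
    rintro ρ ⟨h1, -, -, h2, h3⟩
    exact ⟨h1, by linarith, by linarith⟩
  have hfin' := hfin.subset hsub
  have hx0 : 0 < x := by linarith
  unfold zetaZeroSum
  rw [finsum_mem_eq_finite_toFinset_sum _ hfin', Finset.sum_mul]
  calc _ ≤ ∑ ρ ∈ hfin'.toFinset, (zetaZeroOrder ρ : ℝ) * x := by
        apply norm_sum_le_of_le
        intro ρ hρ
        rw [Set.Finite.mem_toFinset] at hρ
        rw [norm_mul, Complex.norm_natCast, Complex.norm_cpow_eq_rpow_re_of_pos hx0]
        gcongr
        calc x ^ ρ.re ≤ x ^ (1:ℝ) := Real.rpow_le_rpow_of_exponent_le hx.le hρ.2.2.1.le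
          _ = x := Real.rpow_one x
    _ ≤ _ := by
        apply Finset.sum_le_sum_of_subset_of_nonneg
        · exact Set.Finite.toFinset_subset_toFinset.mpr hsub
        · intro ρ _ _
          positivity

theorem exists_norm_zetaZeroSum_add_le : ∃ C : ℝ, 0 < C ∧ ∀ x : ℝ, 1 < x → ∀ T : ℝ, 1000 ≤ T →
    ‖zetaZeroSum T (fun ρ => (x:ℂ)^ρ) + (T/(2*Real.pi)) * (LambdaR x : ℝ)‖ ≤
      C * (x * Real.log (2*x*T) * Real.log (Real.log (3*x))) +
        72 * (Real.log x * min T (x / primePowerDist x)) +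
        24000 * (Real.log (T/(2*Real.pi)) * min T (1 / Real.log x)) := by
  obtain ⟨CH, hCH, hH⟩ := exists_norm_integral_horizontal_le
  obtain ⟨CR, hCR, hR⟩ := exists_norm_integral_right_le
  obtain ⟨CL, hCL, hLf⟩ := exists_norm_integral_left_le
  obtain ⟨k, hk⟩ : ∃ k : ℝ, k = 1 / Real.log (Real.log 3) := ⟨_, rfl⟩
  have hk0 : 0 < k := by
    have := loglog_three_pos
    rw [hk]; positivity
  refine ⟨4 * CH + CR + (CL + 2) * k, by positivity, ?_⟩
  intro x hx T hT
  have hL := one_lt_log_three_mul hx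
  have hll := one_le_mul_loglog hx
  rw [← hk] at hll
  have hx0 : 0 < x := by linarith
  have hK0 : 0 ≤ Real.log (Real.log (3 * x)) := Real.log_nonneg hL.le
  have hlx := Real.log_pos hx
  have hxT : 1 * T ≤ x * T := by gcongr
  have hlogT : ∀ y : ℝ, 1 ≤ y → y ≤ 2 * T + 1 → Real.log y ≤ 2 * Real.log (2 * x * T) := by
    intro y hy hy'
    have h1 : 2 * Real.log (2 * x * T) = Real.log ((2 * x * T) ^ 2) := by
      rw [Real.log_pow]; norm_num
    rw [h1]
    apply Real.log_le_log (by linarith)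
    nlinarith
  have h3x : Real.log (3 * x) ≤ Real.log (2 * x * T) := by
    apply Real.log_le_log (by positivity)
    nlinarith
  have hlogpi : Real.log (2 * T + 1) ≤ 2 * Real.log (T / (2 * Real.pi)) := by
    have h1 : 2 * Real.log (T / (2 * Real.pi)) = Real.log ((T / (2 * Real.pi)) ^ 2) := by
      rw [Real.log_pow]; norm_num
    rw [h1]
    apply Real.log_le_log (by linarith)
    have h2 : T / 7 ≤ T / (2 * Real.pi) := by
      have := Real.pi_lt_d2
      have := Real.pi_pos
      gcongr
      linarith
    have h3 : (T / 7) ^ 2 ≤ (T / (2 * Real.pi)) ^ 2 := by gcongr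
    nlinarith
  obtain ⟨T₁, T₂, h1, h2, h3, h4, hzero, hres⟩ := exists_rectIntegral_eq_zetaZeroSum
    (by linarith : 2 ≤ T)
  have hδ0 : 0 < 1 / Real.log (3 * x) := by positivity
  have hδ1 : 1 / Real.log (3 * x) < 1 := by rw [div_lt_one (by linarith)]; exact hL
  have hdiff : Differentiable ℂ (fun ρ : ℂ => (x:ℂ)^ρ) := fun z =>
    differentiableAt_id.const_cpow (Or.inl (by exact_mod_cast hx0.ne'))
  have hres' := hres _ hdiff (-(1 / Real.log (3 * x))) (1 + 1 / Real.log (3 * x)) (by linarith)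
    (by linarith) (by linarith) (by linarith)
  have hH1 := hH x hx T₁ (by linarith) (fun s hs => hzero s (Or.inl hs))
  have hH2 := hH x hx T₂ (by linarith) (fun s hs => hzero s (Or.inr hs))
  have hR' := hR x hx T T₁ T₂ (by linarith) (by linarith) (by linarith)
  have hLf' := hLf x hx T T₁ T₂ (by linarith) h1 (by linarith) h4
  unfold rectIntegral at hres'
  have hΛ0 := LambdaR_nonneg x
  have hΛ := LambdaR_le_log hx.le
  generalize (∫ u in (-(1 / Real.log (3 * x)))..(1 + 1 / Real.log (3 * x)),
      (x : ℂ) ^ (u + T₁ * Complex.I : ℂ) * logDeriv riemannZeta (u + T₁ * Complex.I)) = A₁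
    at hres' hH1
  generalize (∫ u in (-(1 / Real.log (3 * x)))..(1 + 1 / Real.log (3 * x)),
      (x : ℂ) ^ (u + T₂ * Complex.I : ℂ) * logDeriv riemannZeta (u + T₂ * Complex.I)) = A₂
    at hres' hH2
  generalize (∫ y in T₁..T₂, (x : ℂ) ^ (((1 + 1 / Real.log (3 * x) : ℝ) : ℂ) + y * Complex.I) *
        logDeriv riemannZeta (((1 + 1 / Real.log (3 * x) : ℝ) : ℂ) + y * Complex.I)) = A₃
    at hres' hR'
  generalize (∫ y in T₁..T₂, (x : ℂ) ^ (((-(1 / Real.log (3 * x)) : ℝ) : ℂ) + y * Complex.I) *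
        logDeriv riemannZeta (((-(1 / Real.log (3 * x)) : ℝ) : ℂ) + y * Complex.I)) = A₄
    at hres' hLf'
  generalize zetaZeroSum T (fun ρ => (x:ℂ)^ρ) = S at hres' ⊢
  have hpi : (2 * Real.pi * Complex.I : ℂ) ≠ 0 := Complex.two_pi_I_ne_zero
  have hpi' : (Real.pi : ℂ) ≠ 0 := by exact_mod_cast Real.pi_ne_zero
  have hid : 2 * Real.pi * Complex.I * (S + (T/(2*Real.pi)) * (LambdaR x : ℝ)) =
      A₁ - A₂ + Complex.I * (A₃ + (T₂ - T₁) * (LambdaR x : ℝ)) - Complex.I * A₄ -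
        Complex.I * (((T₂ - T₁ - T) * LambdaR x : ℝ) : ℂ) := by
    rw [mul_add, ← hres']
    push_cast
    field_simp
    ring
  have hIn : ∀ z : ℂ, ‖Complex.I * z‖ = ‖z‖ := by intro z; simp
  have hnorm : ‖2 * Real.pi * Complex.I * (S + (T/(2*Real.pi)) * (LambdaR x : ℝ))‖ ≤
      ‖A₁‖ + ‖A₂‖ + ‖A₃ + (T₂ - T₁) * (LambdaR x : ℝ)‖ + ‖A₄‖ +
        ‖(((T₂ - T₁ - T) * LambdaR x : ℝ) : ℂ)‖ := by
    rw [hid]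
    refine (norm_sub_le _ _).trans ?_
    rw [hIn]
    gcongr
    refine (norm_sub_le _ _).trans ?_
    rw [hIn]
    gcongr
    refine (norm_add_le _ _).trans ?_
    rw [hIn]
    gcongr
    exact norm_sub_le _ _
  have hlow : ‖S + (T/(2*Real.pi)) * (LambdaR x : ℝ)‖ ≤
      ‖2 * Real.pi * Complex.I * (S + (T/(2*Real.pi)) * (LambdaR x : ℝ))‖ := by
    rw [norm_mul]
    have h5 : ‖(2 * Real.pi * Complex.I : ℂ)‖ = 2 * Real.pi := by
      simp [abs_of_pos Real.pi_pos]
    rw [h5]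
    have := Real.pi_gt_three
    have := norm_nonneg (S + (T/(2*Real.pi)) * (LambdaR x : ℝ))
    nlinarith
  have h5 : ‖(((T₂ - T₁ - T) * LambdaR x : ℝ) : ℂ)‖ ≤ 2 * Real.log (3 * x) := by
    rw [Complex.norm_real, norm_mul, Real.norm_eq_abs, Real.norm_of_nonneg hΛ0]
    have h6 : |T₂ - T₁ - T| ≤ 2 := by
      rw [abs_le]
      constructor <;> linarith
    have h7 : Real.log x ≤ Real.log (3 * x) := Real.log_le_log hx0 (by linarith)
    have h8 := hΛ.trans h7
    gcongr
  have e1 : CH * (x * Real.log T₁ * Real.log (Real.log (3 * x))) ≤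
      CH * (x * (2 * Real.log (2 * x * T)) * Real.log (Real.log (3 * x))) := by
    gcongr
    exact hlogT _ (by linarith) (by linarith)
  have e2 : CH * (x * Real.log T₂ * Real.log (Real.log (3 * x))) ≤
      CH * (x * (2 * Real.log (2 * x * T)) * Real.log (Real.log (3 * x))) := by
    gcongr
    exact hlogT _ (by linarith) (by linarith)
  have e3 : CR * (x * Real.log (3 * x) * Real.log (Real.log (3 * x))) ≤
      CR * (x * Real.log (2 * x * T) * Real.log (Real.log (3 * x))) := by gcongr
  have hQ0 : 0 < Real.log (2 * x * T) := by linarith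
  have e4 : (CL + 2) * (1 * Real.log (3 * x) * 1) ≤
      (CL + 2) * (x * Real.log (2 * x * T) * (k * Real.log (Real.log (3 * x)))) := by gcongr
  have e5 : Real.log (2 * T + 1) * min T (1 / Real.log x) ≤
      2 * Real.log (T / (2 * Real.pi)) * min T (1 / Real.log x) := by
    have : 0 ≤ min T (1 / Real.log x) := le_min (by linarith) (by positivity)
    gcongr
  linarith

/-- The Landau–Gonek explicit formula:
`Σ_{T≤γ≤2T} x^ρ = -(T/2π)Λ(x) + O(x log(2xT) loglog(3x)) + O(log x · min(T, x/⟨x⟩))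
  + O(log(T/2π) · min(T, 1/log x))`. -/
theorem landau_gonek :
    ∃ C₁ C₂ C₃ : ℝ, ∀ x : ℝ, 1 < x → ∀ T : ℝ, 2 ≤ T →
      ‖zetaZeroSum T (fun ρ => (x:ℂ)^ρ) + (T/(2*Real.pi)) * (LambdaR x : ℝ)‖ ≤
        C₁ * x * Real.log (2*x*T) * Real.log (Real.log (3*x)) +
        C₂ * Real.log x * min T (x / primePowerDist x) +
        C₃ * Real.log (T/(2*Real.pi)) * min T (1 / Real.log x) := by
  obtain ⟨C, hC, hlarge⟩ := exists_norm_zetaZeroSum_add_le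
  obtain ⟨N, hN, hsmall⟩ := exists_norm_zetaZeroSum_le 1000
  obtain ⟨k, hk⟩ : ∃ k : ℝ, k = 1 / Real.log (Real.log 3) := ⟨_, rfl⟩
  have hk0 : 0 < k := by
    have := loglog_three_pos
    rw [hk]; positivity
  refine ⟨C + (N + 1000 + 48000000) * k, 72, 24000, ?_⟩
  intro x hx T hT
  have hL := one_lt_log_three_mul hx
  have hll := one_le_mul_loglog hx
  rw [← hk] at hll
  have hx0 : 0 < x := by linarith
  have hK0 : 0 ≤ Real.log (Real.log (3 * x)) := Real.log_nonneg hL.le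
  have hlx := Real.log_pos hx
  have h3x : Real.log (3 * x) ≤ Real.log (2 * x * T) := by
    apply Real.log_le_log (by positivity)
    nlinarith
  have hQ0 : 0 < Real.log (2 * x * T) := by linarith
  rcases le_total 1000 T with h | h
  · have h1 := hlarge x hx T h
    have h2 : 0 ≤ (N + 1000 + 48000000) * k *
        (x * Real.log (2 * x * T) * Real.log (Real.log (3 * x))) := by positivity
    linarith
  · have h1 := hsmall x hx T hT h
    have hpi := Real.pi_gt_three
    have hpi' := Real.pi_lt_d2
    have h2 : ‖((T/(2*Real.pi)) * (LambdaR x : ℝ) : ℂ)‖ ≤ 1000 * Real.log (2 * x * T) := by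
      have h3 : ((T/(2*Real.pi)) * (LambdaR x : ℝ) : ℂ) = ((T/(2*Real.pi) * LambdaR x : ℝ) : ℂ) := by
        push_cast; ring
      have hΛ0 := LambdaR_nonneg x
      rw [h3, Complex.norm_real, Real.norm_of_nonneg (by positivity)]
      have h4 : T / (2 * Real.pi) ≤ 1000 := by
        rw [div_le_iff₀ (by positivity)]
        nlinarith
      have h5 : Real.log x ≤ Real.log (3 * x) := Real.log_le_log hx0 (by linarith)
      have h6 := (LambdaR_le_log hx.le).trans (h5.trans h3x)
      gcongr
    have h3 : 0 ≤ 72 * Real.log x * min T (x / primePowerDist x) := by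
      have h4 : 0 ≤ min T (x / primePowerDist x) :=
        le_min (by linarith) (div_nonneg hx0.le (primePowerDist_nonneg x))
      positivity
    have h4 : -48000000 ≤ 24000 * Real.log (T/(2*Real.pi)) * min T (1 / Real.log x) := by
      have h5 : -2 ≤ Real.log (T / (2 * Real.pi)) := by
        rw [Real.le_log_iff_exp_le (by positivity), le_div_iff₀ (by positivity)]
        have h6 : Real.exp (-2) * Real.exp 2 = 1 := by rw [← Real.exp_add]; simp
        have h7 : (2:ℝ) ^ 2 ≤ Real.exp 2 := by
          have h8 : Real.exp 2 = Real.exp 1 ^ 2 := by rw [← Real.exp_nat_mul]; norm_num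
          have h9 := Real.add_one_le_exp (1:ℝ)
          rw [h8]
          gcongr
          linarith
        have h8 := Real.exp_pos (-2)
        have h9 : Real.exp (-2) ≤ 1 / 4 := by nlinarith
        nlinarith
      have h6 : 0 ≤ min T (1 / Real.log x) := le_min (by linarith) (by positivity)
      have h7 : min T (1 / Real.log x) ≤ 1000 := (min_le_left _ _).trans h
      nlinarith
    have h5 : 1 * 1 * 1 ≤ x * Real.log (2 * x * T) * (k * Real.log (Real.log (3 * x))) := by
      have : 1 ≤ Real.log (2 * x * T) := by linarith
      gcongr
    have h6 : N * (x * 1 * 1) ≤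
        N * (x * Real.log (2 * x * T) * (k * Real.log (Real.log (3 * x)))) := by
      have : 1 ≤ Real.log (2 * x * T) := by linarith
      gcongr
    have h7 : 1 * Real.log (2 * x * T) * 1 ≤
        x * Real.log (2 * x * T) * (k * Real.log (Real.log (3 * x))) := by
      gcongr
    have h8 : 0 ≤ C * (x * Real.log (2 * x * T) * Real.log (Real.log (3 * x))) := by positivity
    refine (norm_add_le _ _).trans ?_
    linarith
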